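/- arXiv:1410.1986 — 2 statements merged into one kernel-verified Lean document; each statement's English description precedes it below -/
import Mathlib

section
/- For every total computable function f : ℕ → ℕ × ℕ there exist an index e and a speedable computably enumerable set B with B = W_e such that, writing (i, j) = f(e), if W_i and W_j are disjoint and W_i ∪ W_j = B, then at least one of W_i and W_j is nonspeedable. -/
open Nat.Partrec (Code)

/-- `Wset e` is the `e`-th computably enumerable set: the domain of the `e`-th
partial computable function in the standard enumeration. -/
def Wset (e : ℕ) : Set ℕ := {x | ((Denumerable.ofNat Code e).eval x).Dom}

/-- `WsetStage e s` is the stage-`s` approximation `W_{e,s}` of `Wset e`,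
given by step-bounded evaluation. -/
def WsetStage (e s : ℕ) : Set ℕ :=
  {x | (Nat.Partrec.Code.evaln s (Denumerable.ofNat Code e) x).isSome}

/-- `Phi e x` is the least stage `s` with `x ∈ W_{e,s}` (for `x ∈ W_e`). -/
noncomputable def Phi (e x : ℕ) : ℕ := sInf {s | x ∈ WsetStage e s}

/-- A set is computably enumerable iff it occurs in the standard enumeration. -/
def CEset (A : Set ℕ) : Prop := ∃ e, Wset e = A

/-- A c.e. set `A` is nonspeedable if there are an index `i` with `W i = A` and a total
computable `h : ℕ × ℕ → ℕ` such that for every `j` with `W j \ A` finite, for all but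
finitely many `x`, if `x ∈ W j ∩ A` then `Φ_i(x) ≤ h(x, Φ_j(x))`. -/
def Nonspeedable (A : Set ℕ) : Prop :=
  ∃ i, Wset i = A ∧ ∃ h : ℕ × ℕ → ℕ, Computable h ∧
    ∀ j, (Wset j \ A).Finite →
      {x | x ∈ Wset j ∩ A ∧ ¬ Phi i x ≤ h (x, Phi j x)}.Finite

/-- A c.e. set is speedable if it is not nonspeedable. -/
def Speedable (A : Set ℕ) : Prop := CEset A ∧ ¬ Nonspeedable A

namespace SP

/-! ### Primitive recursive list helpers -/

theorem prim_filter {α β : Type*} [Primcodable α] [Primcodable β] {f : α → List β}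
    {p : α → β → Bool} (hf : Primrec f) (hp : Primrec₂ p) :
    Primrec fun a => (f a).filter (p a) := by
  have h : Primrec fun a => (f a).filterMap (fun b => if p a b = true then some b else none) := by
    refine Primrec.listFilterMap hf ?_
    refine Primrec.ite (Primrec.eq.comp hp (Primrec.const true)) ?_ (Primrec.const none)
    exact Primrec.option_some.comp Primrec.snd
  refine h.of_eq fun a => ?_
  rw [← List.filterMap_eq_filter]
  congr 1

theorem prim_any {α β : Type*} [Primcodable α] [Primcodable β] {f : α → List β}
    {p : α → β → Bool} (hf : Primrec f) (hp : Primrec₂ p) :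
    Primrec fun a => (f a).any (p a) := by
  have h : Primrec fun a => (((f a).filter (p a)).head?).isSome :=
    Primrec.option_isSome.comp (Primrec.list_head?.comp (prim_filter hf hp))
  refine h.of_eq fun a => ?_
  rw [List.head?_filter, Bool.eq_iff_iff]
  simp

theorem prim_find {α β : Type*} [Primcodable α] [Primcodable β] {f : α → List β}
    {p : α → β → Bool} (hf : Primrec f) (hp : Primrec₂ p) :
    Primrec fun a => (f a).find? (p a) := by
  have h : Primrec fun a => ((f a).filter (p a)).head? :=
    Primrec.list_head?.comp (prim_filter hf hp)
  exact h.of_eq fun a => List.head?_filter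

theorem prim_elem : Primrec fun a : ℕ × List ℕ => decide (a.1 ∈ a.2) := by
  have h : Primrec fun a : ℕ × List ℕ => a.2.any (fun y => a.1 == y) :=
    prim_any Primrec.snd (Primrec.beq.comp (Primrec.fst.comp Primrec.fst) Primrec.snd)
  refine h.of_eq fun a => ?_
  rw [Bool.eq_iff_iff]; simp

theorem prim_lt : Primrec fun a : ℕ × ℕ => decide (a.1 < a.2) := Primrec.nat_lt.decide

/-! ### The construction -/

/-- `x ∈ W_{l,s}` as a Boolean. -/
def inW (l s x : ℕ) : Bool := (Nat.Partrec.Code.evaln s (Denumerable.ofNat Code l) x).isSome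

/-- `φ_q(y)` converges within `n` steps to a value below `n`. -/
def conv (q n y : ℕ) : Bool :=
  (List.range n).any fun v =>
    decide (Nat.Partrec.Code.evaln n (Denumerable.ofNat Code q) y = some v)

def mk (k a τ : ℕ) : ℕ := Nat.pair k (Nat.pair a τ)
def colOf (x : ℕ) : ℕ := x.unpair.1
def idOf (x : ℕ) : ℕ := x.unpair.2.unpair.1
def tagOf (x : ℕ) : ℕ := x.unpair.2.unpair.2

@[simp] theorem colOf_mk (k a τ) : colOf (mk k a τ) = k := by simp [colOf, mk]
@[simp] theorem idOf_mk (k a τ) : idOf (mk k a τ) = a := by simp [idOf, mk]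
@[simp] theorem tagOf_mk (k a τ) : tagOf (mk k a τ) = τ := by simp [tagOf, mk]

/-- (number of S-events, number of F-events, current element, pending sub-elements) -/
abbrev Col := ℕ × ℕ × ℕ × List ℕ
/-- (columns, cancelled elements, enumerated elements) -/
abbrev St := List Col × List ℕ × List ℕ

def dflt (m : ℕ) : Col := (0, 0, mk m 0 0, [])
def colAt (st : St) (m : ℕ) : Col := (st.1[m]?).getD (dflt m)

def flt (i l n : ℕ) (X : List ℕ) : ℕ :=
  ((List.range n).filter fun x => inW l n x && (inW i n x || decide (x ∈ X))).length

def comm (i C n : ℕ) (X : List ℕ) (x : ℕ) : Bool :=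
  (List.range C).any fun l => decide (l + flt i l n X < C) && inW l n x

def kOf (n : ℕ) : ℕ := n.unpair.1

/-- the parameter `C = k + c_k` of the visited column -/
def CC (n : ℕ) (st : St) : ℕ := kOf n + (colAt st (kOf n)).1

def isF (i n : ℕ) (st : St) : Bool :=
  comm i (CC n st) n st.2.1 (colAt st (kOf n)).2.2.1

def isS (n : ℕ) (st : St) : Bool :=
  conv (kOf n) n (Nat.pair (Nat.pair (kOf n) 0) (colAt st (kOf n)).2.2.1)

def sel (n : ℕ) (st : St) : Option ℕ :=
  (colAt st (kOf n)).2.2.2.find? fun x =>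
    conv (tagOf x - 1) n (Nat.pair (Nat.pair (kOf n) (tagOf x)) x)

/-- the selected sub-element is cancelled -/
def canc (i n : ℕ) (st : St) (x : ℕ) : Bool := comm i (CC n st) n st.2.1 x

def newSubs (n : ℕ) (st : St) : List ℕ :=
  ((colAt st (kOf n)).2.2.2.filter fun y => !decide (sel n st = some y)) ++
    [mk (kOf n) (n + 1) ((colAt st (kOf n)).2.1.unpair.1 + 1)]

def newZ (i n : ℕ) (st : St) : ℕ :=
  ((sel n st).casesOn (mk (kOf n) (n + 1) 0)
    fun x => bif canc i n st x then mk (kOf n) (n + 1) 0 else x : ℕ)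

def newK (i n : ℕ) (st : St) : Col :=
  bif isF i n st then
    ((colAt st (kOf n)).1, (colAt st (kOf n)).2.1 + 1, newZ i n st, newSubs n st)
  else bif isS n st then
    ((colAt st (kOf n)).1 + 1, (colAt st (kOf n)).2.1, mk (kOf n) (n + 1) 0, [])
  else colAt st (kOf n)

def newcol (i n : ℕ) (st : St) (m : ℕ) : Col :=
  bif m == kOf n then newK i n st
  else bif isF i n st && decide (CC n st < m) then
    ((colAt st m).1, (colAt st m).2.1, mk m (n + 1) 0, [])
  else colAt st m

def newX (i n : ℕ) (st : St) : List ℕ :=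
  bif isF i n st then
    ((sel n st).casesOn st.2.1 fun x => bif canc i n st x then x :: st.2.1 else st.2.1 : List ℕ)
  else st.2.1

def newB (i n : ℕ) (st : St) : List ℕ :=
  bif isF i n st || isS n st then (colAt st (kOf n)).2.2.1 :: st.2.2 else st.2.2

def step (i n : ℕ) (st : St) : St :=
  ((List.range (n + 1)).map (newcol i n st), newX i n st, newB i n st)

def run (i : ℕ) : ℕ → St
  | 0 => ([], [], [])
  | n + 1 => step i n (run i n)

/-! ### Primitive recursiveness of the construction -/

section
open Primrec
variable {α : Type*} [Primcodable α]

theorem inW_c {f g h : α → ℕ} (hf : Primrec f) (hg : Primrec g) (hh : Primrec h) :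
    Primrec fun a => inW (f a) (g a) (h a) := by
  unfold inW
  exact option_isSome.comp (Nat.Partrec.Code.primrec_evaln.comp
    ((hg.pair ((Primrec.ofNat Code).comp hf)).pair hh))

theorem elem_c {f : α → ℕ} {g : α → List ℕ} (hf : Primrec f) (hg : Primrec g) :
    Primrec fun a => decide (f a ∈ g a) := prim_elem.comp (hf.pair hg)

theorem lt_c {f g : α → ℕ} (hf : Primrec f) (hg : Primrec g) :
    Primrec fun a => decide (f a < g a) := prim_lt.comp (hf.pair hg)

theorem pair_c {f g : α → ℕ} (hf : Primrec f) (hg : Primrec g) :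
    Primrec fun a => Nat.pair (f a) (g a) := Primrec₂.natPair.comp hf hg

theorem add_c {f g : α → ℕ} (hf : Primrec f) (hg : Primrec g) :
    Primrec fun a => f a + g a := nat_add.comp hf hg

theorem and_c {f g : α → Bool} (hf : Primrec f) (hg : Primrec g) :
    Primrec fun a => (f a && g a) := Primrec.and.comp hf hg

theorem or_c {f g : α → Bool} (hf : Primrec f) (hg : Primrec g) :
    Primrec fun a => (f a || g a) := Primrec.or.comp hf hg

theorem conv_c {f g h : α → ℕ} (hf : Primrec f) (hg : Primrec g) (hh : Primrec h) :
    Primrec fun a => conv (f a) (g a) (h a) := by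
  unfold conv
  refine prim_any (list_range.comp hg) ?_
  have h1 : Primrec fun b : α × ℕ =>
      Nat.Partrec.Code.evaln (g b.1) (Denumerable.ofNat Code (f b.1)) (h b.1) :=
    Nat.Partrec.Code.primrec_evaln.comp
      (((hg.comp fst).pair ((Primrec.ofNat Code).comp (hf.comp fst))).pair (hh.comp fst))
  exact Primrec.eq.decide.comp h1 (option_some.comp snd)

theorem mk_c {f g h : α → ℕ} (hf : Primrec f) (hg : Primrec g) (hh : Primrec h) :
    Primrec fun a => mk (f a) (g a) (h a) := pair_c hf (pair_c hg hh)

theorem prim_tag : Primrec tagOf := snd.comp (unpair.comp (snd.comp unpair))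
theorem prim_id : Primrec idOf := fst.comp (unpair.comp (snd.comp unpair))
theorem prim_col : Primrec colOf := fst.comp unpair
theorem prim_kOf : Primrec kOf := fst.comp unpair

theorem prim_dflt : Primrec dflt := by
  unfold dflt
  exact (const 0).pair ((const 0).pair
    ((mk_c Primrec.id (const 0) (const 0)).pair (const [])))

theorem colAt_c {f : α → St} {g : α → ℕ} (hf : Primrec f) (hg : Primrec g) :
    Primrec fun a => colAt (f a) (g a) :=
  option_getD.comp (list_getElem?.comp (fst.comp hf) hg) (prim_dflt.comp hg)

theorem flt_c {f g h : α → ℕ} {X : α → List ℕ} (hf : Primrec f) (hg : Primrec g) (hh : Primrec h)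
    (hX : Primrec X) : Primrec fun a => flt (f a) (g a) (h a) (X a) := by
  unfold flt
  refine list_length.comp (prim_filter (list_range.comp hh) ?_)
  have hn := hh.comp (fst : Primrec (@Prod.fst α ℕ))
  exact and_c (inW_c (hg.comp fst) hn snd)
    (or_c (inW_c (hf.comp fst) hn snd) (elem_c snd (hX.comp fst)))

theorem comm_c {f g h y : α → ℕ} {X : α → List ℕ} (hf : Primrec f) (hg : Primrec g)
    (hh : Primrec h) (hX : Primrec X) (hy : Primrec y) :
    Primrec fun a => comm (f a) (g a) (h a) (X a) (y a) := by
  unfold comm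
  refine prim_any (list_range.comp hg) ?_
  exact and_c (lt_c (add_c snd (flt_c (hf.comp fst) snd (hh.comp fst) (hX.comp fst)))
    (hg.comp fst)) (inW_c snd (hh.comp fst) (hy.comp fst))

end

section
open Primrec

abbrev Arg := ℕ × ℕ × St

theorem pI : Primrec fun a : Arg => a.1 := fst
theorem pN : Primrec fun a : Arg => a.2.1 := fst.comp snd
theorem pSt : Primrec fun a : Arg => a.2.2 := snd.comp snd
theorem pK : Primrec fun a : Arg => kOf a.2.1 := prim_kOf.comp pN
theorem pCol : Primrec fun a : Arg => colAt a.2.2 (kOf a.2.1) := colAt_c pSt pK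
theorem pc : Primrec fun a : Arg => (colAt a.2.2 (kOf a.2.1)).1 := fst.comp pCol
theorem pt : Primrec fun a : Arg => (colAt a.2.2 (kOf a.2.1)).2.1 := fst.comp (snd.comp pCol)
theorem pz : Primrec fun a : Arg => (colAt a.2.2 (kOf a.2.1)).2.2.1 :=
  fst.comp (snd.comp (snd.comp pCol))
theorem psubs : Primrec fun a : Arg => (colAt a.2.2 (kOf a.2.1)).2.2.2 :=
  snd.comp (snd.comp (snd.comp pCol))
theorem pCC : Primrec fun a : Arg => CC a.2.1 a.2.2 := add_c pK pc
theorem pX : Primrec fun a : Arg => a.2.2.2.1 := fst.comp (snd.comp pSt)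
theorem pB : Primrec fun a : Arg => a.2.2.2.2 := snd.comp (snd.comp pSt)

theorem prim_isF : Primrec fun a : Arg => isF a.1 a.2.1 a.2.2 := by
  unfold isF
  exact comm_c pI pCC pN pX pz

theorem prim_isS : Primrec fun a : Arg => isS a.2.1 a.2.2 := by
  unfold isS
  exact conv_c pK pN (pair_c (pair_c pK (const 0)) pz)

theorem prim_sel : Primrec fun a : Arg => sel a.2.1 a.2.2 := by
  unfold sel
  refine prim_find psubs ?_
  have ht : Primrec fun b : Arg × ℕ => tagOf b.2 := prim_tag.comp snd
  have ht1 : Primrec fun b : Arg × ℕ => tagOf b.2 - 1 := nat_sub.comp ht (const 1)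
  have hK : Primrec fun b : Arg × ℕ => kOf b.1.2.1 := pK.comp fst
  have hN : Primrec fun b : Arg × ℕ => b.1.2.1 := pN.comp fst
  exact conv_c ht1 hN (pair_c (pair_c hK ht) snd)

theorem prim_canc : Primrec fun a : Arg × ℕ => canc a.1.1 a.1.2.1 a.1.2.2 a.2 := by
  unfold canc
  have hI : Primrec fun b : Arg × ℕ => b.1.1 := pI.comp fst
  have hC : Primrec fun b : Arg × ℕ => CC b.1.2.1 b.1.2.2 := pCC.comp fst
  have hN : Primrec fun b : Arg × ℕ => b.1.2.1 := pN.comp fst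
  have hX : Primrec fun b : Arg × ℕ => b.1.2.2.2.1 := pX.comp fst
  exact comm_c hI hC hN hX snd

theorem pFresh : Primrec fun a : Arg => mk (kOf a.2.1) (a.2.1 + 1) 0 :=
  mk_c pK (add_c pN (const 1)) (const 0)

theorem prim_newSubs : Primrec fun a : Arg => newSubs a.2.1 a.2.2 := by
  unfold newSubs
  have h1 : Primrec fun a : Arg => (colAt a.2.2 (kOf a.2.1)).2.2.2.filter
      fun y => !decide (sel a.2.1 a.2.2 = some y) := by
    refine prim_filter psubs ?_
    have hs : Primrec fun b : Arg × ℕ => sel b.1.2.1 b.1.2.2 := prim_sel.comp fst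
    have hb : Primrec fun b : Arg × ℕ => decide (sel b.1.2.1 b.1.2.2 = some b.2) :=
      Primrec.eq.decide.comp hs (option_some.comp snd)
    exact Primrec.not.comp hb
  have ht : Primrec fun a : Arg => (colAt a.2.2 (kOf a.2.1)).2.1.unpair.1 :=
    fst.comp (unpair.comp pt)
  have h2 := mk_c pK (add_c pN (const 1)) (add_c ht (const 1))
  exact list_append.comp h1 (list_cons.comp h2 (const []))

theorem prim_newZ : Primrec fun a : Arg => newZ a.1 a.2.1 a.2.2 := by
  unfold newZ
  have h : Primrec fun b : Arg × ℕ => bif canc b.1.1 b.1.2.1 b.1.2.2 b.2 then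
      mk (kOf b.1.2.1) (b.1.2.1 + 1) 0 else b.2 :=
    Primrec.cond prim_canc (pFresh.comp fst) snd
  exact option_casesOn prim_sel pFresh h.to₂

theorem prim_newK : Primrec fun a : Arg => newK a.1 a.2.1 a.2.2 := by
  unfold newK
  have h1 : Primrec fun a : Arg => ((colAt a.2.2 (kOf a.2.1)).1,
      (colAt a.2.2 (kOf a.2.1)).2.1 + 1, newZ a.1 a.2.1 a.2.2, newSubs a.2.1 a.2.2) :=
    pc.pair ((add_c pt (const 1)).pair (prim_newZ.pair prim_newSubs))
  have h2 : Primrec fun a : Arg => (((colAt a.2.2 (kOf a.2.1)).1 + 1,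
      (colAt a.2.2 (kOf a.2.1)).2.1, mk (kOf a.2.1) (a.2.1 + 1) 0, []) : Col) :=
    (add_c pc (const 1)).pair (pt.pair (pFresh.pair (const [])))
  exact Primrec.cond prim_isF h1 (Primrec.cond prim_isS h2 pCol)

theorem prim_newcol : Primrec₂ fun (a : Arg) (m : ℕ) => newcol a.1 a.2.1 a.2.2 m := by
  unfold newcol
  have hSt : Primrec fun b : Arg × ℕ => b.1.2.2 := pSt.comp fst
  have hN : Primrec fun b : Arg × ℕ => b.1.2.1 := pN.comp fst
  have hK : Primrec fun b : Arg × ℕ => kOf b.1.2.1 := pK.comp fst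
  have hC : Primrec fun b : Arg × ℕ => CC b.1.2.1 b.1.2.2 := pCC.comp fst
  have hF : Primrec fun b : Arg × ℕ => isF b.1.1 b.1.2.1 b.1.2.2 := prim_isF.comp fst
  have hc : Primrec fun b : Arg × ℕ => colAt b.1.2.2 b.2 := colAt_c hSt snd
  have hnk : Primrec fun b : Arg × ℕ => newK b.1.1 b.1.2.1 b.1.2.2 := prim_newK.comp fst
  have hb : Primrec fun b : Arg × ℕ => (b.2 == kOf b.1.2.1) := Primrec.beq.comp snd hK
  have hr : Primrec fun b : Arg × ℕ => (((colAt b.1.2.2 b.2).1, (colAt b.1.2.2 b.2).2.1,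
      mk b.2 (b.1.2.1 + 1) 0, []) : Col) :=
    (fst.comp hc).pair ((fst.comp (snd.comp hc)).pair
      ((mk_c snd (add_c hN (const 1)) (const 0)).pair (const [])))
  exact (Primrec.cond hb hnk (Primrec.cond (and_c hF (lt_c hC snd)) hr hc)).to₂

theorem prim_newX : Primrec fun a : Arg => newX a.1 a.2.1 a.2.2 := by
  unfold newX
  have hX : Primrec fun b : Arg × ℕ => b.1.2.2.2.1 := pX.comp fst
  have h : Primrec fun b : Arg × ℕ => bif canc b.1.1 b.1.2.1 b.1.2.2 b.2 then
      b.2 :: b.1.2.2.2.1 else b.1.2.2.2.1 :=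
    Primrec.cond prim_canc (list_cons.comp snd hX) hX
  exact Primrec.cond prim_isF (option_casesOn prim_sel pX h.to₂) pX

theorem prim_newB : Primrec fun a : Arg => newB a.1 a.2.1 a.2.2 := by
  unfold newB
  exact Primrec.cond (or_c prim_isF prim_isS) (list_cons.comp pz pB) pB

theorem prim_step : Primrec fun a : Arg => step a.1 a.2.1 a.2.2 := by
  unfold step
  have h1 : Primrec fun a : Arg => List.range (a.2.1 + 1) := list_range.comp (add_c pN (const 1))
  exact (list_map h1 prim_newcol).pair (prim_newX.pair prim_newB)

theorem prim_run : Primrec₂ run := by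
  have hs : Primrec fun b : ℕ × ℕ × St => step b.1 b.2.1 b.2.2 := prim_step
  have h : Primrec₂ fun (i : ℕ) (n : ℕ) =>
      (Nat.rec (([], [], []) : St) (fun n st => step i n st) n : St) :=
    Primrec.nat_rec (const _) hs.to₂
  refine h.of_eq fun a n => ?_
  induction n with
  | zero => rfl
  | succ n ih => simp only [run]; rw [← ih]

end

/-! ### Dynamics -/

def cA (i n m : ℕ) : ℕ := (colAt (run i n) m).1
def tA (i n m : ℕ) : ℕ := (colAt (run i n) m).2.1
def zA (i n m : ℕ) : ℕ := (colAt (run i n) m).2.2.1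
def sA (i n m : ℕ) : List ℕ := (colAt (run i n) m).2.2.2
def Xs (i n : ℕ) : List ℕ := (run i n).2.1
def Bs (i n : ℕ) : List ℕ := (run i n).2.2
def selA (i n : ℕ) : Option ℕ := sel n (run i n)

/-- `x` is committed (for column `m`) at stage `n` -/
def cmt (i n m x : ℕ) : Prop := comm i (m + cA i n m) n (Xs i n) x = true

def EF (i m n : ℕ) : Prop := kOf n = m ∧ cmt i n m (zA i n m)
def ES (i m n : ℕ) : Prop := kOf n = m ∧ ¬ cmt i n m (zA i n m) ∧
  conv m n (Nat.pair (Nat.pair m 0) (zA i n m)) = true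
def ER (i m n : ℕ) : Prop := EF i (kOf n) n ∧ kOf n + cA i n (kOf n) < m ∧ m ≤ n

theorem kOf_le (n : ℕ) : kOf n ≤ n := Nat.unpair_left_le n

theorem run_succ (i n : ℕ) : run i (n + 1) = step i n (run i n) := rfl

theorem run_len (i n : ℕ) : (run i n).1.length = n := by
  cases n with
  | zero => rfl
  | succ n => simp [run_succ, step]

theorem colAt_succ (i n m : ℕ) (h : m ≤ n) :
    colAt (run i (n + 1)) m = newcol i n (run i n) m := by
  rw [run_succ, step, colAt]
  have : m < n + 1 := by omega
  simp [this]

theorem colAt_big (i n m : ℕ) (h : n ≤ m) : colAt (run i n) m = dflt m := by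
  have : (run i n).1.length ≤ m := by rw [run_len]; exact h
  simp [colAt, List.getElem?_eq_none this]

theorem isF_iff (i n : ℕ) : isF i n (run i n) = true ↔ EF i (kOf n) n := by
  simp [EF, isF, cmt, CC, cA, zA, Xs]

theorem isF_false_iff (i n : ℕ) : isF i n (run i n) = false ↔ ¬ EF i (kOf n) n := by
  rw [← isF_iff]; simp

theorem col_F {i m n : ℕ} (h : EF i m n) : colAt (run i (n + 1)) m =
    (cA i n m, tA i n m + 1, newZ i n (run i n), newSubs n (run i n)) := by
  obtain ⟨rfl, h2⟩ := h
  have hF := (isF_iff i n).2 ⟨rfl, h2⟩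
  rw [colAt_succ _ _ _ (kOf_le n)]
  simp [newcol, newK, hF, cA, tA]

theorem col_S {i m n : ℕ} (h : ES i m n) : colAt (run i (n + 1)) m =
    (cA i n m + 1, tA i n m, mk m (n + 1) 0, []) := by
  obtain ⟨rfl, h2, h3⟩ := h
  have hF : isF i n (run i n) = false := (isF_false_iff i n).2 fun h => h2 h.2
  have hS : isS n (run i n) = true := h3
  rw [colAt_succ _ _ _ (kOf_le n)]
  simp [newcol, newK, hF, hS, cA, tA]

theorem col_R {i m n : ℕ} (h : ER i m n) : colAt (run i (n + 1)) m =
    (cA i n m, tA i n m, mk m (n + 1) 0, []) := by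
  obtain ⟨h1, h2, h3⟩ := h
  have hF := (isF_iff i n).2 h1
  have hm : (m == kOf n) = false := by simp; omega
  have hC : CC n (run i n) < m := h2
  rw [colAt_succ _ _ _ h3]
  simp [newcol, hF, hm, hC, cA, tA]

theorem col_N {i m n : ℕ} (hF : ¬ EF i m n) (hS : ¬ ES i m n) (hR : ¬ ER i m n) :
    colAt (run i (n + 1)) m = colAt (run i n) m := by
  by_cases hmn : m ≤ n
  · rw [colAt_succ _ _ _ hmn]
    by_cases hk : kOf n = m
    · subst hk
      have h1 : isF i n (run i n) = false := (isF_false_iff i n).2 hF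
      have h2 : isS n (run i n) = false := by
        by_contra hc
        exact hS ⟨rfl, fun h => hF ⟨rfl, h⟩, by simpa [isS, zA] using hc⟩
      simp [newcol, newK, h1, h2]
    · have hm : (m == kOf n) = false := by simp; exact fun h => hk h.symm
      by_cases hf : EF i (kOf n) n
      · have hC : ¬ CC n (run i n) < m := fun h => hR ⟨hf, h, hmn⟩
        simp [newcol, hm, hC]
      · have h1 := (isF_false_iff i n).2 hf
        simp [newcol, hm, h1]
  · rw [colAt_big _ _ _ (by omega), colAt_big _ _ _ (by omega)]

theorem B_ev {i n : ℕ} (h : EF i (kOf n) n ∨ ES i (kOf n) n) :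
    Bs i (n + 1) = zA i n (kOf n) :: Bs i n := by
  have : (isF i n (run i n) || isS n (run i n)) = true := by
    rcases h with h | h
    · simp [(isF_iff i n).2 h]
    · have : isS n (run i n) = true := h.2.2
      simp [this]
  simp only [Bs, run_succ, step, newB, this, cond_true]; rfl

theorem B_nev {i n : ℕ} (h : ¬ EF i (kOf n) n) (h' : ¬ ES i (kOf n) n) :
    Bs i (n + 1) = Bs i n := by
  have h1 : isF i n (run i n) = false := (isF_false_iff i n).2 h
  have h2 : isS n (run i n) = false := by
    by_contra hc
    exact h' ⟨rfl, fun hh => h ⟨rfl, hh⟩, by simpa [isS, zA] using hc⟩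
  simp [Bs, run_succ, step, newB, h1, h2]

theorem canc_iff (i n x : ℕ) : canc i n (run i n) x = true ↔ cmt i n (kOf n) x := Iff.rfl

theorem X_succ (i n x : ℕ) : x ∈ Xs i (n + 1) ↔ x ∈ Xs i n ∨
    (EF i (kOf n) n ∧ selA i n = some x ∧ cmt i n (kOf n) x) := by
  rw [← isF_iff, ← canc_iff]
  simp only [Xs, run_succ, step, newX, selA]
  cases hF : isF i n (run i n) with
  | false => simp
  | true =>
    cases hs : sel n (run i n) with
    | none => simp
    | some y =>
      cases hc : canc i n (run i n) y with
      | false =>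
        simp only [cond_true, cond_false, hc, Option.some.injEq, true_and]
        constructor
        · exact Or.inl
        · rintro (h | ⟨rfl, h⟩)
          · exact h
          · rw [hc] at h; cases h
      | true =>
        simp only [cond_true, hc, Option.some.injEq, true_and, List.mem_cons]
        constructor
        · rintro (rfl | h)
          · exact Or.inr ⟨rfl, hc⟩
          · exact Or.inl h
        · rintro (h | ⟨rfl, h⟩)
          · exact Or.inr h
          · exact Or.inl rfl

theorem B_mono {i n n' x : ℕ} (h : n ≤ n') (hx : x ∈ Bs i n) : x ∈ Bs i n' := by
  induction n', h using Nat.le_induction with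
  | base => exact hx
  | succ n' _ ih =>
    by_cases h : EF i (kOf n') n' ∨ ES i (kOf n') n'
    · rw [B_ev h]; exact List.mem_cons_of_mem _ ih
    · rw [not_or] at h; rw [B_nev h.1 h.2]; exact ih

theorem X_mono {i n n' x : ℕ} (h : n ≤ n') (hx : x ∈ Xs i n) : x ∈ Xs i n' := by
  induction n', h using Nat.le_induction with
  | base => exact hx
  | succ n' _ ih => rw [X_succ]; exact Or.inl ih

/-- `newZ` is fresh or the fed selected element -/
theorem newZ_cases (i n : ℕ) :
    newZ i n (run i n) = mk (kOf n) (n + 1) 0 ∨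
    ∃ x, selA i n = some x ∧ ¬ cmt i n (kOf n) x ∧ newZ i n (run i n) = x := by
  rw [newZ]
  simp only [selA]
  cases hs : sel n (run i n) with
  | none => left; rfl
  | some y =>
    cases hc : canc i n (run i n) y with
    | true => left; simp [hc]
    | false =>
      right
      refine ⟨y, rfl, ?_, by simp [hc]⟩
      rw [← canc_iff, hc]; simp

theorem newZ_fed {i n x : ℕ} (hs : selA i n = some x) (hc : ¬ cmt i n (kOf n) x) :
    newZ i n (run i n) = x := by
  rw [newZ]
  simp only [selA] at hs
  rw [← canc_iff] at hc
  simp [hs, hc]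

theorem sel_mem {i n x : ℕ} (hs : selA i n = some x) : x ∈ sA i n (kOf n) :=
  List.mem_of_find?_eq_some hs

theorem sel_conv {i n x : ℕ} (hs : selA i n = some x) :
    conv (tagOf x - 1) n (Nat.pair (Nat.pair (kOf n) (tagOf x)) x) = true :=
  List.find?_some (p := fun x => conv (tagOf x - 1) n (Nat.pair (Nat.pair (kOf n) (tagOf x)) x)) hs

theorem mem_newSubs (i n x : ℕ) : x ∈ newSubs n (run i n) ↔
    (x ∈ sA i n (kOf n) ∧ selA i n ≠ some x) ∨
      x = mk (kOf n) (n + 1) ((tA i n (kOf n)).unpair.1 + 1) := by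
  simp [newSubs, sA, tA, selA]

/-! projections -/

theorem c_F {i m n : ℕ} (h : EF i m n) : cA i (n + 1) m = cA i n m := by
  rw [cA, col_F h]
theorem t_F {i m n : ℕ} (h : EF i m n) : tA i (n + 1) m = tA i n m + 1 := by
  rw [tA, col_F h]
theorem z_F {i m n : ℕ} (h : EF i m n) : zA i (n + 1) m = newZ i n (run i n) := by
  rw [zA, col_F h]
theorem s_F {i m n : ℕ} (h : EF i m n) : sA i (n + 1) m = newSubs n (run i n) := by
  rw [sA, col_F h]
theorem c_S {i m n : ℕ} (h : ES i m n) : cA i (n + 1) m = cA i n m + 1 := by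
  rw [cA, col_S h]
theorem t_S {i m n : ℕ} (h : ES i m n) : tA i (n + 1) m = tA i n m := by
  rw [tA, col_S h]
theorem z_S {i m n : ℕ} (h : ES i m n) : zA i (n + 1) m = mk m (n + 1) 0 := by
  rw [zA, col_S h]
theorem s_S {i m n : ℕ} (h : ES i m n) : sA i (n + 1) m = [] := by
  rw [sA, col_S h]
theorem c_R {i m n : ℕ} (h : ER i m n) : cA i (n + 1) m = cA i n m := by
  rw [cA, col_R h]
theorem t_R {i m n : ℕ} (h : ER i m n) : tA i (n + 1) m = tA i n m := by
  rw [tA, col_R h]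
theorem z_R {i m n : ℕ} (h : ER i m n) : zA i (n + 1) m = mk m (n + 1) 0 := by
  rw [zA, col_R h]
theorem s_R {i m n : ℕ} (h : ER i m n) : sA i (n + 1) m = [] := by
  rw [sA, col_R h]
theorem c_N {i m n : ℕ} (hF : ¬ EF i m n) (hS : ¬ ES i m n) (hR : ¬ ER i m n) :
    cA i (n + 1) m = cA i n m := by rw [cA, col_N hF hS hR]; rfl
theorem t_N {i m n : ℕ} (hF : ¬ EF i m n) (hS : ¬ ES i m n) (hR : ¬ ER i m n) :
    tA i (n + 1) m = tA i n m := by rw [tA, col_N hF hS hR]; rfl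
theorem z_N {i m n : ℕ} (hF : ¬ EF i m n) (hS : ¬ ES i m n) (hR : ¬ ER i m n) :
    zA i (n + 1) m = zA i n m := by rw [zA, col_N hF hS hR]; rfl
theorem s_N {i m n : ℕ} (hF : ¬ EF i m n) (hS : ¬ ES i m n) (hR : ¬ ER i m n) :
    sA i (n + 1) m = sA i n m := by rw [sA, col_N hF hS hR]; rfl

def alive (i n m x : ℕ) : Prop := x = zA i n m ∨ x ∈ sA i n m

theorem alive_succ {i n m x : ℕ} (h : alive i (n + 1) m x) :
    alive i n m x ∨ (idOf x = n + 1 ∧ colOf x = m) := by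
  by_cases hF : EF i m n
  · rw [alive, z_F hF, s_F hF, mem_newSubs, hF.1] at h
    rcases h with h | ⟨h, -⟩ | h
    · rcases newZ_cases i n with h' | ⟨y, hy, -, h'⟩
      · right; rw [h, h', hF.1]; simp
      · left; right; rw [h, h']; have := sel_mem hy; rwa [hF.1] at this
    · left; right; exact h
    · right; rw [h]; simp
  by_cases hS : ES i m n
  · rw [alive, z_S hS, s_S hS] at h
    rcases h with h | h
    · right; rw [h]; simp
    · cases h
  by_cases hR : ER i m n
  · rw [alive, z_R hR, s_R hR] at h
    rcases h with h | h
    · right; rw [h]; simp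
    · cases h
  rw [alive, z_N hF hS hR, s_N hF hS hR] at h
  exact Or.inl h

structure Inv (i n : ℕ) : Prop where
  col : ∀ m x, alive i n m x → colOf x = m
  idd : ∀ m x, alive i n m x → idOf x ≤ n
  zs : ∀ m, zA i n m ∉ sA i n m
  nB : ∀ m x, alive i n m x → x ∉ Bs i n
  nX : ∀ m x, alive i n m x → x ∉ Xs i n
  BX : ∀ x, x ∈ Bs i n → x ∉ Xs i n
  idB : ∀ x, x ∈ Bs i n → idOf x ≤ n
  idX : ∀ x, x ∈ Xs i n → idOf x ≤ n

theorem inv (i n : ℕ) : Inv i n := by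
  induction n with
  | zero =>
    have hz : ∀ m, zA i 0 m = mk m 0 0 := fun m => by simp [zA, colAt_big i 0 m (by omega), dflt]
    have hs : ∀ m, sA i 0 m = [] := fun m => by simp [sA, colAt_big i 0 m (by omega), dflt]
    have hB : Bs i 0 = [] := rfl
    have hX : Xs i 0 = [] := rfl
    constructor <;> simp [alive, hz, hs, hB, hX]
  | succ n ih =>
    have entry : ∀ x, x ∈ Bs i (n + 1) → x ∈ Bs i n ∨
        (x = zA i n (kOf n) ∧ (EF i (kOf n) n ∨ ES i (kOf n) n)) := by
      intro x hx
      by_cases h : EF i (kOf n) n ∨ ES i (kOf n) n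
      · rw [B_ev h, List.mem_cons] at hx
        rcases hx with hx | hx
        · exact Or.inr ⟨hx, h⟩
        · exact Or.inl hx
      · rw [not_or] at h; rw [B_nev h.1 h.2] at hx; exact Or.inl hx
    have hidB : ∀ x, x ∈ Bs i (n + 1) → idOf x ≤ n := by
      intro x hx
      rcases entry x hx with h | ⟨h, -⟩
      · exact ih.idB x h
      · exact ih.idd _ x (Or.inl h)
    have hidX : ∀ x, x ∈ Xs i (n + 1) → idOf x ≤ n := by
      intro x hx
      rcases (X_succ i n x).1 hx with h | ⟨h, h', -⟩
      · exact ih.idX x h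
      · exact ih.idd _ x (Or.inr (sel_mem h'))
    constructor
    · intro m x h
      rcases alive_succ h with h | h
      · exact ih.col m x h
      · exact h.2
    · intro m x h
      rcases alive_succ h with h | h
      · exact (ih.idd m x h).trans (by omega)
      · exact h.1.le
    · intro m h
      by_cases hF : EF i m n
      · rw [z_F hF, s_F hF, mem_newSubs, hF.1] at h
        rcases newZ_cases i n with h' | ⟨y, hy, -, h'⟩
        · rw [h'] at h
          rcases h with ⟨h, -⟩ | h
          · have := ih.idd _ _ (Or.inr h); simp at this
          · have := congrArg tagOf h; simp at this
        · rw [h'] at h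
          rcases h with ⟨-, h⟩ | h
          · exact h hy
          · have := ih.idd _ _ (Or.inr (sel_mem hy)); rw [h] at this; simp at this
      by_cases hS : ES i m n
      · rw [s_S hS] at h; cases h
      by_cases hR : ER i m n
      · rw [s_R hR] at h; cases h
      rw [z_N hF hS hR, s_N hF hS hR] at h
      exact ih.zs m h
    · intro m x h hB
      have hid := hidB x hB
      rcases alive_succ h with ha | ha
      · rcases entry x hB with hb | ⟨hb, he⟩
        · exact ih.nB m x ha hb
        · have hm : m = kOf n := by
            rw [← ih.col m x ha, hb]; exact (ih.col _ _ (Or.inl rfl))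
          subst hm
          rcases he with he | he
          · rw [alive, z_F he, s_F he, mem_newSubs] at h
            rcases h with h | ⟨h, -⟩ | h
            · rcases newZ_cases i n with h' | ⟨y, hy, -, h'⟩
              · rw [h, h'] at hid; simp at hid
              · have := sel_mem hy
                rw [← h', ← h, hb] at this
                exact ih.zs _ this
            · rw [hb] at h; exact ih.zs _ h
            · rw [h] at hid; simp at hid
          · rw [alive, z_S he, s_S he] at h
            rcases h with h | h
            · rw [h] at hid; simp at hid
            · cases h
      · omega
    · intro m x h hX
      have hid := hidX x hX
      rcases alive_succ h with ha | ha
      · rcases (X_succ i n x).1 hX with hb | ⟨he, hb, hc⟩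
        · exact ih.nX m x ha hb
        · have hm : m = kOf n := by
            rw [← ih.col m x ha]; exact (ih.col _ _ (Or.inr (sel_mem hb)))
          subst hm
          rw [alive, z_F he, s_F he, mem_newSubs] at h
          rcases h with h | ⟨-, h⟩ | h
          · rcases newZ_cases i n with h' | ⟨y, hy, hc', h'⟩
            · rw [h, h'] at hid; simp at hid
            · rw [hb] at hy; cases hy; exact hc' hc
          · exact h hb
          · rw [h] at hid; simp at hid
      · omega
    · intro x hB hX
      rcases entry x hB with hb | ⟨hb, he⟩
      · rcases (X_succ i n x).1 hX with hx | ⟨he, hx, hc⟩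
        · exact ih.BX x hb hx
        · exact ih.nB _ x (Or.inr (sel_mem hx)) hb
      · rcases (X_succ i n x).1 hX with hx | ⟨he, hx, hc⟩
        · exact ih.nX _ x (Or.inl hb) hx
        · have := sel_mem hx; rw [hb] at this; exact ih.zs _ this
    · intro x hx; exact (hidB x hx).trans (by omega)
    · intro x hx; exact (hidX x hx).trans (by omega)

theorem entry {i n x : ℕ} (hx : x ∈ Bs i (n + 1)) : x ∈ Bs i n ∨
    (x = zA i n (kOf n) ∧ (EF i (kOf n) n ∨ ES i (kOf n) n)) := by
  by_cases h : EF i (kOf n) n ∨ ES i (kOf n) n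
  · rw [B_ev h, List.mem_cons] at hx
    rcases hx with hx | hx
    · exact Or.inr ⟨hx, h⟩
    · exact Or.inl hx
  · rw [not_or] at h; rw [B_nev h.1 h.2] at hx; exact Or.inl hx

/-- dead elements stay dead and out of `B` -/
theorem gone {i n n' x : ℕ} (hn : n ≤ n') (hid : idOf x ≤ n) (ha : ¬ alive i n (colOf x) x)
    (hB : x ∉ Bs i n) : ¬ alive i n' (colOf x) x ∧ x ∉ Bs i n' := by
  induction n', hn using Nat.le_induction with
  | base => exact ⟨ha, hB⟩
  | succ n' hn ih =>
    refine ⟨fun h => ?_, fun h => ?_⟩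
    · rcases alive_succ h with h | h
      · exact ih.1 h
      · omega
    · rcases entry h with h | ⟨h, -⟩
      · exact ih.2 h
      · refine ih.1 (Or.inl ?_)
        have : colOf x = kOf n' := by rw [h]; exact (inv i n').col _ _ (Or.inl rfl)
        rw [this]; exact h

/-- the set enumerated -/
def BB (i : ℕ) : Set ℕ := {x | ∃ n, x ∈ Bs i n}

theorem c_mono {i n n' m : ℕ} (h : n ≤ n') : cA i n m ≤ cA i n' m := by
  induction n', h using Nat.le_induction with
  | base => exact le_rfl
  | succ n' _ ih =>
    refine ih.trans ?_
    by_cases hF : EF i m n'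
    · rw [c_F hF]
    by_cases hS : ES i m n'
    · rw [c_S hS]; omega
    by_cases hR : ER i m n'
    · rw [c_R hR]
    rw [c_N hF hS hR]

/-! ### Computability criteria -/

theorem inW_mono {l s s' x : ℕ} (h : s ≤ s') (hx : inW l s x = true) : inW l s' x = true := by
  rw [inW, Option.isSome_iff_exists] at hx ⊢
  obtain ⟨v, hv⟩ := hx
  exact ⟨v, Nat.Partrec.Code.evaln_mono h hv⟩

theorem inW_lt {l s x : ℕ} (hx : inW l s x = true) : x < s := by
  rw [inW, Option.isSome_iff_exists] at hx
  obtain ⟨v, hv⟩ := hx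
  exact Nat.Partrec.Code.evaln_bound hv

theorem mem_W {l x : ℕ} : x ∈ Wset l ↔ ∃ s, inW l s x = true := by
  rw [Wset, Set.mem_ofPred_eq, Part.dom_iff_mem]
  constructor
  · rintro ⟨v, hv⟩
    obtain ⟨s, hs⟩ := Nat.Partrec.Code.evaln_complete.1 hv
    exact ⟨s, by rw [inW, Option.isSome_iff_exists]; exact ⟨v, hs⟩⟩
  · rintro ⟨s, hs⟩
    rw [inW, Option.isSome_iff_exists] at hs
    obtain ⟨v, hv⟩ := hs
    exact ⟨v, Nat.Partrec.Code.evaln_sound hv⟩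

theorem Phi_spec {l x : ℕ} (h : x ∈ Wset l) : inW l (Phi l x) x = true := by
  obtain ⟨s, hs⟩ := mem_W.1 h
  exact Nat.sInf_mem (s := {s | x ∈ WsetStage l s}) ⟨s, hs⟩

theorem Phi_le {l x s : ℕ} (h : inW l s x = true) : Phi l x ≤ s :=
  Nat.sInf_le (s := {s | x ∈ WsetStage l s}) h

theorem find_b {α : Type*} [Primcodable α] {P : α → ℕ → Bool} (hP : Computable₂ P)
    (hex : ∀ x, ∃ n, P x n = true) : Computable fun x => Nat.find (hex x) :=
  Computable.find (P := fun x n => P x n = true) (ComputablePred.computable_iff.2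
    ⟨fun p => P p.1 p.2, hP, rfl⟩) hex

/-- total unbounded search -/
def mu (p : ℕ → Bool) : Part ℕ := Nat.rfind (fun n => Part.some (p n) : ℕ →. Bool)

theorem mem_mu {p : ℕ → Bool} {n : ℕ} : n ∈ mu p ↔ p n = true ∧ ∀ m < n, p m = false := by
  unfold mu
  refine Nat.mem_rfind.trans ?_
  simp only [Part.mem_some_iff]
  exact ⟨fun h => ⟨h.1.symm, fun m hm => (h.2 hm).symm⟩, fun h => ⟨h.1.symm, fun hm => (h.2 _ hm).symm⟩⟩

theorem mu_dom {p : ℕ → Bool} : (mu p).Dom ↔ ∃ n, p n = true := by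
  rw [Part.dom_iff_mem]
  constructor
  · rintro ⟨n, hn⟩; exact ⟨n, (mem_mu.1 hn).1⟩
  · intro h
    exact ⟨Nat.find h, mem_mu.2 ⟨Nat.find_spec h, fun m hm => by simpa using Nat.find_min h hm⟩⟩

theorem mu_part {α : Type*} [Primcodable α] {P : α → ℕ → Bool} (hP : Computable₂ P) :
    Partrec fun a => mu (P a) :=
  Partrec.rfind (p := fun a n => Part.some (P a n)) (Computable.partrec hP)

theorem conv_of {q y v : ℕ} (h : v ∈ (Denumerable.ofNat Code q).eval y) :
    ∃ n0, ∀ n ≥ n0, conv q n y = true := by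
  obtain ⟨s, hs⟩ := Nat.Partrec.Code.evaln_complete.1 h
  refine ⟨max s (v + 1), fun n hn => ?_⟩
  have := Nat.Partrec.Code.evaln_mono (le_of_max_le_left hn) hs
  rw [conv, List.any_eq_true]
  exact ⟨v, by simp; omega, by simpa using this⟩

theorem of_conv {q n y : ℕ} (h : conv q n y = true) :
    ∃ v, v ∈ (Denumerable.ofNat Code q).eval y ∧ v < n := by
  rw [conv, List.any_eq_true] at h
  obtain ⟨v, hv, h⟩ := h
  exact ⟨v, Nat.Partrec.Code.evaln_sound (by simpa using h), by simpa using hv⟩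

/-- stage approximation to the c.e. sets `V_p` -/
def vB (i p n x : ℕ) : Bool :=
  bif p.unpair.2 == 0 then decide (x = zA i n p.unpair.1)
  else (decide (x ∈ sA i n p.unpair.1) && decide (tagOf x = p.unpair.2))

def VV (i p : ℕ) : Set ℕ := {x | ∃ n, vB i p n x = true}

section
open Primrec
variable {α : Type*} [Primcodable α]

theorem Bs_c {f g : α → ℕ} (hf : Primrec f) (hg : Primrec g) :
    Primrec fun a => Bs (f a) (g a) := by
  have h : Primrec fun a => run (f a) (g a) := prim_run.comp hf hg
  exact snd.comp (snd.comp h)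

theorem colA_c {f g h : α → ℕ} (hf : Primrec f) (hg : Primrec g) (hh : Primrec h) :
    Primrec fun a => colAt (run (f a) (g a)) (h a) := by
  have h : Primrec fun a => run (f a) (g a) := prim_run.comp hf hg
  exact colAt_c h hh

theorem cA_c {f g h : α → ℕ} (hf : Primrec f) (hg : Primrec g) (hh : Primrec h) :
    Primrec fun a => cA (f a) (g a) (h a) := fst.comp (colA_c hf hg hh)
theorem zA_c {f g h : α → ℕ} (hf : Primrec f) (hg : Primrec g) (hh : Primrec h) :
    Primrec fun a => zA (f a) (g a) (h a) := fst.comp (snd.comp (snd.comp (colA_c hf hg hh)))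
theorem sA_c {f g h : α → ℕ} (hf : Primrec f) (hg : Primrec g) (hh : Primrec h) :
    Primrec fun a => sA (f a) (g a) (h a) := snd.comp (snd.comp (snd.comp (colA_c hf hg hh)))

theorem eq_c {f g : α → ℕ} (hf : Primrec f) (hg : Primrec g) :
    Primrec fun a => decide (f a = g a) := Primrec.eq.decide.comp hf hg

theorem cmt_c {i : ℕ} {f g h : α → ℕ} (hf : Primrec f) (hg : Primrec g) (hh : Primrec h) :
    Primrec fun a => comm i (g a + cA i (f a) (g a)) (f a) (Xs i (f a)) (h a) := by
  have hr : Primrec fun a => run i (f a) := prim_run.comp (const i) hf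
  have hX : Primrec fun a => Xs i (f a) := fst.comp (snd.comp hr)
  exact comm_c (const i) (add_c hg (cA_c (const i) hf hg)) hf hX hh

theorem vB_c {i : ℕ} {f g h : α → ℕ} (hf : Primrec f) (hg : Primrec g) (hh : Primrec h) :
    Primrec fun a => vB i (f a) (g a) (h a) := by
  unfold vB
  have h1 : Primrec fun a => (f a).unpair.1 := fst.comp (unpair.comp hf)
  have h2 : Primrec fun a => (f a).unpair.2 := snd.comp (unpair.comp hf)
  have hb : Primrec fun a => ((f a).unpair.2 == 0) := Primrec.beq.comp h2 (const 0)
  exact Primrec.cond hb (eq_c hh (zA_c (const i) hg h1))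
    (and_c (elem_c hh (sA_c (const i) hg h1)) (eq_c (prim_tag.comp hh) h2))
end

theorem criterion (i : ℕ)
    (H : ∀ q, ∃ p, (∀ x ∈ VV i p, ((Denumerable.ofNat Code q).eval (Nat.pair p x)).Dom) →
      (VV i p \ BB i).Finite ∧
      {x | x ∈ VV i p ∩ BB i ∧ ∃ n v, v ∈ (Denumerable.ofNat Code q).eval (Nat.pair p x) ∧
        v < n ∧ x ∉ Bs i n}.Infinite) : ¬ Nonspeedable (BB i) := by
  rintro ⟨i0, hi0, h, hh, hns⟩
  -- code for `V`
  have e1 : Primrec fun b : ℕ × ℕ => b.1.unpair.1 :=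
    Primrec.fst.comp (Primrec.unpair.comp Primrec.fst)
  have e2 : Primrec fun b : ℕ × ℕ => b.1.unpair.2 :=
    Primrec.snd.comp (Primrec.unpair.comp Primrec.fst)
  have hv : Partrec fun y : ℕ => mu fun n => vB i y.unpair.1 n y.unpair.2 := by
    have h0 : Primrec fun b : ℕ × ℕ => vB i b.1.unpair.1 b.2 b.1.unpair.2 :=
      vB_c e1 Primrec.snd e2
    have h1 : Computable₂ fun y n : ℕ => vB i y.unpair.1 n y.unpair.2 := Primrec.to_comp h0
    exact mu_part h1
  obtain ⟨cV, hcV⟩ := Nat.Partrec.Code.exists_code.1 (Partrec.nat_iff.1 hv)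
  let J : ℕ → ℕ := fun p => Encodable.encode (Nat.Partrec.Code.curry cV p)
  have hJp : Primrec J := Primrec.encode.comp
    (Nat.Partrec.Code.primrec₂_curry.comp (Primrec.const cV) Primrec.id)
  have hJ : ∀ p, Wset (J p) = VV i p := by
    intro p
    ext x
    simp only [Wset, Set.mem_ofPred_eq, J, Denumerable.ofNat_encode, Nat.Partrec.Code.eval_curry,
      hcV, Nat.unpair_pair, VV]
    exact mu_dom
  -- the diagonal function
  have hψ : Partrec fun y : ℕ => (mu fun s => inW (J y.unpair.1) s y.unpair.2).bind fun s =>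
        bif inW i0 (h (y.unpair.2, s)) y.unpair.2 then
          mu fun n => decide (y.unpair.2 ∈ Bs i n)
        else Part.some 0 := by
    refine Partrec.bind ?_ ?_
    · have h0 : Primrec fun b : ℕ × ℕ => inW (J b.1.unpair.1) b.2 b.1.unpair.2 :=
        inW_c (hJp.comp e1) Primrec.snd e2
      have h1 : Computable₂ fun y s : ℕ => inW (J y.unpair.1) s y.unpair.2 := Primrec.to_comp h0
      exact mu_part h1
    · have hx : Computable fun b : ℕ × ℕ => b.1.unpair.2 := e2.to_comp
      have hv : Computable fun b : ℕ × ℕ => h (b.1.unpair.2, b.2) :=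
        hh.comp (hx.pair Computable.snd)
      have hin : Computable₂ fun b c : ℕ => inW i0 b c := Primrec.to_comp
        (inW_c (Primrec.const i0) Primrec.fst Primrec.snd)
      have hin2 : Computable fun b : ℕ × ℕ => inW i0 (h (b.1.unpair.2, b.2)) b.1.unpair.2 :=
        hin.comp hv hx
      have hr : Partrec fun b : ℕ × ℕ => mu fun n => decide (b.1.unpair.2 ∈ Bs i n) := by
        have e3 : Primrec fun d : (ℕ × ℕ) × ℕ => d.1.1.unpair.2 := e2.comp Primrec.fst
        have h0 : Primrec fun d : (ℕ × ℕ) × ℕ => decide (d.1.1.unpair.2 ∈ Bs i d.2) :=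
          elem_c e3 (Bs_c (Primrec.const i) Primrec.snd)
        have h1 : Computable₂ fun (b : ℕ × ℕ) (n : ℕ) => decide (b.1.unpair.2 ∈ Bs i n) :=
          Primrec.to_comp h0
        exact mu_part h1
      have hz : Partrec fun b : ℕ × ℕ => (Part.some 0 : Part ℕ) :=
        (Computable.const 0).partrec
      exact (Partrec.cond hin2 hr hz).to₂
  obtain ⟨cq, hcq⟩ := Nat.Partrec.Code.exists_code.1 (Partrec.nat_iff.1 hψ)
  obtain ⟨p, hp⟩ := H (Encodable.encode cq)
  rw [Denumerable.ofNat_encode, hcq] at hp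
  simp only [Nat.unpair_pair] at hp
  have hfind : ∀ x ∈ VV i p, Phi (J p) x ∈ mu fun s => inW (J p) s x := by
    intro x hx
    rw [← hJ] at hx
    rw [mem_mu]
    refine ⟨Phi_spec hx, ?_⟩
    intro m hm
    have : inW (J p) m x ≠ true := fun h => absurd (Phi_le h) (by omega)
    simpa using this
  obtain ⟨h1, h2⟩ := hp (by
    intro x hx
    rw [Part.eq_some_iff.2 (hfind x hx), Part.bind_some]
    cases hc : inW i0 (h (x, Phi (J p) x)) x with
    | false => simp
    | true =>
      have hxB : x ∈ BB i := by rw [← hi0]; exact mem_W.2 ⟨_, hc⟩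
      obtain ⟨n, hn⟩ := hxB
      rw [cond_true, mu_dom]
      exact ⟨n, by simpa using hn⟩)
  have h3 := hns (J p) (by rw [hJ]; exact h1)
  refine h2 (h3.subset ?_)
  rintro x ⟨⟨hxV, hxB⟩, n, v, hv, hvn, hn⟩
  refine ⟨⟨by rw [hJ]; exact hxV, hxB⟩, fun hle => ?_⟩
  have hxW : x ∈ Wset i0 := by rw [hi0]; exact hxB
  have hc := inW_mono hle (Phi_spec hxW)
  rw [Part.eq_some_iff.2 (hfind x hxV), Part.bind_some, hc, cond_true] at hv
  have := (mem_mu.1 hv).1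
  have hvB : x ∈ Bs i v := by simpa using this
  exact hn (B_mono hvn.le hvB)

theorem nonspeed (i j a : ℕ) (ha : a = i ∨ a = j) (hd : Disjoint (Wset i) (Wset j))
    (hu : Wset i ∪ Wset j = BB i) (D : ℕ × ℕ → ℕ → Bool) (hD : Computable₂ D)
    (hex : ∀ b, ∃ n, D b n = true)
    (H : ∀ v, (Wset v \ Wset a).Finite →
      {x | x ∈ Wset v ∩ Wset a ∧ ∃ n, D (x, Phi v x) n = true ∧ x ∉ Bs i (n + 1)}.Finite) :
    Nonspeedable (Wset a) := by
  have hN := find_b hD hex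
  let P2 : ℕ × ℕ → ℕ → Bool := fun b s =>
    ((!decide (b.1 ∈ Bs i (Nat.find (hex b) + 1))) || (inW i s b.1 || inW j s b.1))
  have hex2 : ∀ b, ∃ s, P2 b s = true := by
    intro b
    by_cases hb : b.1 ∈ Bs i (Nat.find (hex b) + 1)
    · have : b.1 ∈ Wset i ∪ Wset j := by rw [hu]; exact ⟨_, hb⟩
      rcases this with h | h <;> obtain ⟨s, hs⟩ := mem_W.1 h <;> exact ⟨s, by simp [P2, hs]⟩
    · exact ⟨0, by simp [P2, hb]⟩
  have hP2 : Computable₂ P2 := by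
    have g : Primrec fun d : (ℕ × ℕ) × ℕ =>
        ((!decide (d.1.1 ∈ Bs i (d.1.2 + 1))) || (inW i d.2 d.1.1 || inW j d.2 d.1.1)) := by
      have hx : Primrec fun d : (ℕ × ℕ) × ℕ => d.1.1 := Primrec.fst.comp Primrec.fst
      have hn : Primrec fun d : (ℕ × ℕ) × ℕ => d.1.2 := Primrec.snd.comp Primrec.fst
      have h1 : Primrec fun d : (ℕ × ℕ) × ℕ => decide (d.1.1 ∈ Bs i (d.1.2 + 1)) :=
        elem_c hx (Bs_c (Primrec.const i) (add_c hn (Primrec.const 1)))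
      have h2 : Primrec fun d : (ℕ × ℕ) × ℕ => !decide (d.1.1 ∈ Bs i (d.1.2 + 1)) :=
        Primrec.not.comp h1
      exact or_c h2 (or_c (inW_c (Primrec.const i) Primrec.snd hx) (inW_c (Primrec.const j) Primrec.snd hx))
    have hN' : Computable fun b : (ℕ × ℕ) × ℕ => Nat.find (hex b.1) := hN.comp Computable.fst
    have hx : Computable fun b : (ℕ × ℕ) × ℕ => b.1.1 := Computable.fst.comp Computable.fst
    have hxN : Computable fun b : (ℕ × ℕ) × ℕ => ((b.1.1, Nat.find (hex b.1)), b.2) :=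
      (hx.pair hN').pair Computable.snd
    have g1 := g.to_comp
    have g2 := g1.comp hxN
    exact g2
  refine ⟨a, rfl, fun b => Nat.find (hex2 b), find_b hP2 hex2, fun v hv => ?_⟩
  refine (H v hv).subset ?_
  rintro x ⟨hx, hle⟩
  refine ⟨hx, Nat.find (hex (x, Phi v x)), Nat.find_spec (hex (x, Phi v x)), fun hB => hle ?_⟩
  have := Nat.find_spec (hex2 (x, Phi v x))
  show Phi a x ≤ Nat.find (hex2 (x, Phi v x))
  generalize Nat.find (hex2 (x, Phi v x)) = s at this ⊢
  simp only [P2, hB, decide_true, Bool.not_true, Bool.false_or, Bool.or_eq_true] at this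
  refine Phi_le ?_
  rcases ha with rfl | rfl
  · rcases this with h | h
    · exact h
    · exact absurd (mem_W.2 ⟨_, h⟩) (Set.disjoint_left.1 hd hx.2)
  · rcases this with h | h
    · exact absurd hx.2 (Set.disjoint_left.1 hd (mem_W.2 ⟨_, h⟩))
    · exact h

theorem final (main : ∀ i, ¬ Nonspeedable (BB i) ∧ ∀ j, Disjoint (Wset i) (Wset j) →
      Wset i ∪ Wset j = BB i → Nonspeedable (Wset i) ∨ Nonspeedable (Wset j))
    (f : ℕ → ℕ × ℕ) (hf : Computable f) :
    ∃ (e : ℕ) (B : Set ℕ), Wset e = B ∧ Speedable B ∧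
      (Disjoint (Wset (f e).1) (Wset (f e).2) → Wset (f e).1 ∪ Wset (f e).2 = B →
        Nonspeedable (Wset (f e).1) ∨ Nonspeedable (Wset (f e).2)) := by
  have hp : Partrec₂ fun (c : Code) (x : ℕ) => mu fun n =>
      decide (x ∈ Bs (f (Encodable.encode c)).1 n) := by
    refine mu_part (P := fun (b : Code × ℕ) n =>
      decide (b.2 ∈ Bs (f (Encodable.encode b.1)).1 n)) ?_
    have h0 : Primrec fun d : (ℕ × ℕ) × ℕ => decide (d.1.1 ∈ Bs d.1.2 d.2) :=
      elem_c (Primrec.fst.comp Primrec.fst) (Bs_c (Primrec.snd.comp Primrec.fst) Primrec.snd)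
    have h1 : Computable fun d : (Code × ℕ) × ℕ => (f (Encodable.encode d.1.1)).1 :=
      Computable.fst.comp (hf.comp (Computable.encode.comp (Computable.fst.comp Computable.fst)))
    have h2 : Computable fun d : (Code × ℕ) × ℕ => d.1.2 := Computable.snd.comp Computable.fst
    have h3 : Computable fun d : (Code × ℕ) × ℕ =>
        ((d.1.2, (f (Encodable.encode d.1.1)).1), d.2) := (h2.pair h1).pair Computable.snd
    have g1 := h0.to_comp
    have g2 := g1.comp h3
    exact g2
  obtain ⟨c, hc⟩ := Nat.Partrec.Code.fixed_point₂ hp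
  have hW : Wset (Encodable.encode c) = BB (f (Encodable.encode c)).1 := by
    ext x
    simp only [Wset, Set.mem_ofPred_eq, Denumerable.ofNat_encode, hc, BB]
    rw [mu_dom]
    simp
  obtain ⟨h1, h2⟩ := main (f (Encodable.encode c)).1
  exact ⟨Encodable.encode c, BB (f (Encodable.encode c)).1, hW, ⟨⟨_, hW⟩, h1⟩, h2 _⟩

/-! ### Limit behaviour of columns -/

/-- infinitely many F-events, finitely many S-events -/
def dead (i k : ℕ) : Prop := (∀ N, ∃ n ≥ N, EF i k n) ∧ ∃ N, ∀ n ≥ N, ¬ ES i k n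

theorem visit (k N : ℕ) : ∃ n ≥ N, kOf n = k :=
  ⟨Nat.pair k N, Nat.right_le_pair k N, by simp [kOf]⟩

theorem c_unbdd {i m : ℕ} (h : ∀ N, ∃ n ≥ N, ES i m n) (K : ℕ) :
    ∃ N, ∀ n ≥ N, K ≤ cA i n m := by
  induction K with
  | zero => exact ⟨0, fun _ _ => Nat.zero_le _⟩
  | succ K ih =>
    obtain ⟨N, hN⟩ := ih
    obtain ⟨n, hn, hS⟩ := h N
    refine ⟨n + 1, fun n' hn' => ?_⟩
    have h1 := c_mono (i := i) (m := m) hn'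
    rw [c_S hS] at h1
    have := hN n hn
    omega

theorem bdd_all {P : ℕ → ℕ → Prop} (m : ℕ) (h : ∀ k < m, ∃ N, ∀ n ≥ N, P k n) :
    ∃ N, ∀ n ≥ N, ∀ k < m, P k n := by
  induction m with
  | zero => exact ⟨0, fun _ _ k hk => absurd hk (by omega)⟩
  | succ m ih =>
    obtain ⟨N, hN⟩ := ih fun k hk => h k (by omega)
    obtain ⟨N', hN'⟩ := h m (by omega)
    refine ⟨max N N', fun n hn k hk => ?_⟩
    rcases Nat.lt_succ_iff_lt_or_eq.1 hk with hk | rfl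
    · exact hN n (le_of_max_le_left hn) k hk
    · exact hN' n (le_of_max_le_right hn)

theorem resets_finite {i m : ℕ} (h : ∀ k < m, ¬ dead i k) : ∃ N, ∀ n ≥ N, ¬ ER i m n := by
  have key : ∀ k < m, ∃ N, ∀ n ≥ N, ¬ (kOf n = k ∧ ER i m n) := by
    intro k hk
    by_cases hF : ∀ N, ∃ n ≥ N, EF i k n
    · have hS : ∀ N, ∃ n ≥ N, ES i k n := by
        by_contra hc
        push Not at hc
        exact h k hk ⟨hF, hc⟩
      obtain ⟨N, hN⟩ := c_unbdd hS m
      refine ⟨N, fun n hn hc => ?_⟩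
      obtain ⟨rfl, -, h2, -⟩ := hc
      have := hN n hn
      omega
    · push Not at hF
      obtain ⟨N, hN⟩ := hF
      refine ⟨N, fun n hn hc => ?_⟩
      obtain ⟨rfl, h1, -⟩ := hc
      exact hN n hn h1
  obtain ⟨N, hN⟩ := bdd_all m key
  refine ⟨N, fun n hn hR => hN n hn (kOf n) ?_ ⟨rfl, hR⟩⟩
  have := hR.2.1
  omega

theorem col_const {i m N n : ℕ} (hn : N ≤ n)
    (h : ∀ n', N ≤ n' → n' < n → ¬ EF i m n' ∧ ¬ ES i m n' ∧ ¬ ER i m n') :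
    colAt (run i n) m = colAt (run i N) m := by
  induction n, hn using Nat.le_induction with
  | base => rfl
  | succ n hn ih =>
    obtain ⟨h1, h2, h3⟩ := h n hn (by omega)
    rw [col_N h1 h2 h3]
    exact ih fun n' h1 h2 => h n' h1 (by omega)

theorem c_const {i m N n : ℕ} (hn : N ≤ n) (h : ∀ n', N ≤ n' → ¬ ES i m n') :
    cA i n m = cA i N m := by
  induction n, hn using Nat.le_induction with
  | base => rfl
  | succ n hn ih =>
    rw [← ih]
    have hS := h n hn
    by_cases hF : EF i m n
    · rw [c_F hF]
    by_cases hR : ER i m n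
    · rw [c_R hR]
    rw [c_N hF hS hR]

theorem next_ev {i m N n : ℕ} (hR : ∀ n ≥ N, ¬ ER i m n) (hn : N ≤ n)
    (hE : ∃ n' ≥ n, EF i m n' ∨ ES i m n') :
    ∃ n' ≥ n, (EF i m n' ∨ ES i m n') ∧ colAt (run i n') m = colAt (run i n) m := by
  classical
  refine ⟨Nat.find hE, (Nat.find_spec hE).1, (Nat.find_spec hE).2,
    col_const (Nat.find_spec hE).1 fun n' h1 h2 => ?_⟩
  have := Nat.find_min hE h2
  push Not at this
  exact ⟨(this h1).1, (this h1).2, hR n' (by omega)⟩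

theorem z_enters {i m N n : ℕ} (hR : ∀ n ≥ N, ¬ ER i m n) (hn : N ≤ n)
    (hE : ∃ n' ≥ n, EF i m n' ∨ ES i m n') : zA i n m ∈ BB i := by
  obtain ⟨n', -, he, hc⟩ := next_ev hR hn hE
  have hk : kOf n' = m := by rcases he with h | h <;> exact h.1
  refine ⟨n' + 1, ?_⟩
  subst hk
  rw [B_ev he, zA, hc]
  exact List.mem_cons_self

theorem inf_of_late {i : ℕ} {S : Set ℕ} (hS : S ⊆ BB i) (h : ∀ N, ∃ x ∈ S, x ∉ Bs i N) :
    S.Infinite := by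
  intro hf
  have : ∃ N, ∀ x ∈ S, x ∈ Bs i N := by
    choose! g hg using hS
    obtain ⟨N, hN⟩ := (hf.image g).bddAbove
    exact ⟨N, fun x hx => B_mono (hN ⟨x, hx, rfl⟩) (hg hx)⟩
  obtain ⟨N, hN⟩ := this
  obtain ⟨x, hx, hx'⟩ := h N
  exact hx' (hN x hx)

theorem VV0 {i q x : ℕ} : x ∈ VV i (Nat.pair q 0) ↔ ∃ n, x = zA i n q := by
  simp [VV, vB]

theorem VV1 {i k q x : ℕ} : x ∈ VV i (Nat.pair k (q + 1)) ↔
    ∃ n, x ∈ sA i n k ∧ tagOf x = q + 1 := by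
  simp [VV, vB]

theorem caseA_speed {i : ℕ} (hA : ∀ k, ¬ dead i k) : ¬ Nonspeedable (BB i) := by
  refine criterion i fun q => ⟨Nat.pair q 0, fun hdom => ?_⟩
  obtain ⟨NR, hNR⟩ := resets_finite (i := i) (m := q) fun k _ => hA k
  have hS : ∀ N, ∃ n ≥ N, ES i q n := by
    by_contra hc
    push Not at hc
    obtain ⟨NS, hNS⟩ := hc
    have hF : ∃ N, ∀ n ≥ N, ¬ EF i q n := by
      by_contra hc
      push Not at hc
      exact hA q ⟨hc, NS, hNS⟩
    obtain ⟨NF, hNF⟩ := hF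
    set N := max NR (max NS NF) with hN
    have hd := hdom (zA i N q) (VV0.2 ⟨N, rfl⟩)
    obtain ⟨v, hv⟩ := Part.dom_iff_mem.1 hd
    obtain ⟨n0, hn0⟩ := conv_of hv
    obtain ⟨n, hn, hk⟩ := visit q (max N n0)
    have hz : zA i n q = zA i N q := by
      rw [zA, zA, col_const (N := N) (by omega)]
      intro n' h1 h2
      exact ⟨hNF _ (by omega), hNS _ (by omega), hNR _ (by omega)⟩
    have hcv := hn0 n (by omega)
    rw [← hz] at hcv
    exact hNS n (by omega) ⟨hk, fun h => hNF n (by omega) ⟨hk, h⟩, hcv⟩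
  constructor
  · refine Set.Finite.subset (Set.Finite.image (fun n => zA i n q) (Set.finite_Iio NR)) ?_
    rintro x ⟨hx, hxB⟩
    obtain ⟨n, rfl⟩ := VV0.1 hx
    refine ⟨n, ?_, rfl⟩
    by_contra hc
    have hn : NR ≤ n := by simpa using hc
    obtain ⟨n', hn', hE⟩ := hS n
    exact hxB (z_enters hNR hn ⟨n', hn', Or.inr hE⟩)
  · refine inf_of_late (i := i) (fun x hx => hx.1.2) fun N => ?_
    obtain ⟨n, hn, hE⟩ := hS N
    have hnB : zA i n q ∉ Bs i n := (inv i n).nB q _ (Or.inl rfl)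
    have hB : zA i n q ∈ BB i := by
      refine ⟨n + 1, ?_⟩
      obtain rfl := hE.1
      rw [B_ev (Or.inr hE)]; exact List.mem_cons_self
    obtain ⟨v, hv, hvn⟩ := of_conv hE.2.2
    exact ⟨zA i n q, ⟨⟨VV0.2 ⟨n, rfl⟩, hB⟩, n, v, hv, hvn, hnB⟩, fun h => hnB (B_mono hn h)⟩

theorem z_fin {i : ℕ} (hA : ∀ k, ¬ dead i k) (m ρ : ℕ) :
    {x | ∃ n, x = zA i n m ∧ m + cA i n m ≤ ρ}.Finite := by
  have : ∃ N, ∀ n, m + cA i n m ≤ ρ → ∃ n' ≤ N, zA i n m = zA i n' m := by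
    by_cases hS : ∀ N, ∃ n ≥ N, ES i m n
    · obtain ⟨N, hN⟩ := c_unbdd hS (ρ + 1)
      refine ⟨N, fun n hn => ⟨n, ?_, rfl⟩⟩
      by_contra hc
      have := hN n (by omega)
      omega
    · push Not at hS
      obtain ⟨NS, hNS⟩ := hS
      have hF : ∃ N, ∀ n ≥ N, ¬ EF i m n := by
        by_contra hc
        push Not at hc
        exact hA m ⟨hc, NS, hNS⟩
      obtain ⟨NF, hNF⟩ := hF
      obtain ⟨NR, hNR⟩ := resets_finite (i := i) (m := m) fun k _ => hA k
      refine ⟨max NR (max NS NF), fun n _ => ?_⟩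
      by_cases hn : n ≤ max NR (max NS NF)
      · exact ⟨n, hn, rfl⟩
      · refine ⟨_, le_rfl, ?_⟩
        rw [zA, zA, col_const (N := max NR (max NS NF)) (by omega)]
        intro n' h1 h2
        exact ⟨hNF _ (by omega), hNS _ (by omega), hNR _ (by omega)⟩
  obtain ⟨N, hN⟩ := this
  refine Set.Finite.subset (Set.Finite.image (fun n => zA i n m) (Set.finite_Iic N)) ?_
  rintro x ⟨n, rfl, hn⟩
  obtain ⟨n', h1, h2⟩ := hN n hn
  exact ⟨n', h1, h2.symm⟩

theorem X_not_B {i n x : ℕ} (h : x ∈ Xs i n) : x ∉ BB i := by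
  rintro ⟨n', h'⟩
  exact (inv i (max n n')).BX x (B_mono (le_max_right _ _) h') (X_mono (le_max_left _ _) h)

theorem cmt_of {i n m l x : ℕ} (h1 : l + flt i l n (Xs i n) < m + cA i n m)
    (h2 : inW l n x = true) : cmt i n m x := by
  rw [cmt, comm, List.any_eq_true]
  exact ⟨l, by simp; omega, by simp [h1, h2]⟩

theorem of_cmt {i C n x : ℕ} (h : comm i C n (Xs i n) x = true) :
    ∃ l < C, l + flt i l n (Xs i n) < C ∧ inW l n x = true := by
  rw [comm, List.any_eq_true] at h
  obtain ⟨l, hl, h⟩ := h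
  simp only [Bool.and_eq_true, decide_eq_true_eq] at h
  exact ⟨l, by simpa using hl, h.1, h.2⟩

/-- a pending sub-element that eventually enters `B` must be fed -/
theorem fed_of {i n m x : ℕ} (hx : x ∈ sA i n m) (hB : x ∈ BB i) :
    ∃ n' ≥ n, EF i m n' ∧ ¬ cmt i n' m x ∧ zA i (n' + 1) m = x := by
  by_contra hc
  push Not at hc
  have hcol : colOf x = m := (inv i n).col m x (Or.inr hx)
  have hid : idOf x ≤ n := (inv i n).idd m x (Or.inr hx)
  have key : ∀ n' ≥ n, x ∉ Bs i n' ∧ x ≠ zA i n' m := by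
    intro n' hn'
    induction n', hn' using Nat.le_induction with
    | base => exact ⟨(inv i n).nB m x (Or.inr hx), fun h => (inv i n).zs m (h ▸ hx)⟩
    | succ n' hn' ih =>
      refine ⟨fun h => ?_, fun h => ?_⟩
      · rcases entry h with h | ⟨h, -⟩
        · exact ih.1 h
        · have : kOf n' = m := by
            rw [← hcol, h]; exact ((inv i n').col _ _ (Or.inl rfl)).symm
          exact ih.2 (this ▸ h)
      · by_cases hF : EF i m n'
        · by_cases hcm : cmt i n' m x
          · rw [z_F hF] at h
            rcases newZ_cases i n' with h' | ⟨y, hy, hyc, h'⟩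
            · rw [h, h'] at hid; simp at hid; omega
            · rw [h'] at h; subst h; exact hyc (hF.1.symm ▸ hcm)
          · exact hc n' hn' hF hcm h.symm
        by_cases hS : ES i m n'
        · rw [h, z_S hS] at hid; simp at hid; omega
        by_cases hR : ER i m n'
        · rw [h, z_R hR] at hid; simp at hid; omega
        rw [z_N hF hS hR] at h
        exact ih.2 h
  obtain ⟨n', hn'⟩ := hB
  exact (key (max n n') (le_max_left _ _)).1 (B_mono (le_max_right _ _) hn')

theorem caseA_non {i j : ℕ} (hA : ∀ k, ¬ dead i k) (hd : Disjoint (Wset i) (Wset j))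
    (hu : Wset i ∪ Wset j = BB i) : Nonspeedable (Wset j) := by
  refine nonspeed i j j (Or.inr rfl) hd hu
    (fun b n => decide (kOf n = colOf b.1) && (decide (b.2 < n) && decide (idOf b.1 < n)))
    ?_ ?_ ?_
  · have h1 : Primrec fun a : (ℕ × ℕ) × ℕ => kOf a.2 := prim_kOf.comp Primrec.snd
    have hx : Primrec fun a : (ℕ × ℕ) × ℕ => a.1.1 := Primrec.fst.comp Primrec.fst
    have hs : Primrec fun a : (ℕ × ℕ) × ℕ => a.1.2 := Primrec.snd.comp Primrec.fst
    have h2 : Primrec fun a : (ℕ × ℕ) × ℕ => colOf a.1.1 := prim_col.comp hx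
    have h3 : Primrec fun a : (ℕ × ℕ) × ℕ => idOf a.1.1 := prim_id.comp hx
    have h := and_c (eq_c h1 h2) (and_c (lt_c hs Primrec.snd) (lt_c h3 Primrec.snd))
    exact Primrec.to_comp h
  · rintro ⟨x, s⟩
    obtain ⟨n, hn, hk⟩ := visit (colOf x) (s + idOf x + 1)
    exact ⟨n, by simp [hk]; omega⟩
  · intro l hl
    set M := hl.toFinset.card with hM
    have hflt : ∀ n, flt i l n (Xs i n) ≤ M := by
      intro n
      rw [flt, ← List.toFinset_card_of_nodup (List.nodup_range.filter _)]
      refine Finset.card_le_card fun x hx => ?_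
      simp only [List.mem_toFinset, List.mem_filter, Bool.and_eq_true, Bool.or_eq_true,
        decide_eq_true_eq] at hx
      rw [Set.Finite.mem_toFinset]
      refine ⟨mem_W.2 ⟨n, hx.2.1⟩, fun hj => ?_⟩
      rcases hx.2.2 with h | h
      · exact Set.disjoint_left.1 hd (mem_W.2 ⟨n, h⟩) hj
      · exact X_not_B h (hu ▸ Or.inr hj)
    refine Set.Finite.subset ((Set.finite_Iic (l + M)).biUnion fun m _ => z_fin hA m (l + M)) ?_
    rintro x ⟨⟨hxl, hxj⟩, n, hD, hnB⟩
    simp only [Bool.and_eq_true, decide_eq_true_eq] at hD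
    obtain ⟨hk, hs, hid⟩ := hD
    have hxB : x ∈ BB i := hu ▸ Or.inr hxj
    have hin : ∀ n' ≥ n, inW l n' x = true := fun n' hn' => inW_mono (by omega) (Phi_spec hxl)
    have fin : ∀ n', x = zA i n' (colOf x) → colOf x + cA i n' (colOf x) ≤ l + M →
        x ∈ ⋃ m ∈ Set.Iic (l + M), {x | ∃ n, x = zA i n m ∧ m + cA i n m ≤ l + M} := by
      intro n' h1 h2
      simp only [Set.mem_iUnion]
      exact ⟨colOf x, by simp; omega, n', h1, h2⟩
    have hal : alive i n (colOf x) x := by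
      by_contra hc
      obtain ⟨n', hn'⟩ := hxB
      exact (gone (le_max_left n n') hid.le hc fun h => hnB (B_mono (by omega) h)).2
        (B_mono (le_max_right _ _) hn')
    rcases hal with hz | hsub
    · refine fin n hz ?_
      by_contra hc
      have := hflt n
      have hcm : cmt i n (colOf x) x := cmt_of (l := l) (by omega) (hin n le_rfl)
      have hF : EF i (colOf x) n := ⟨hk, by rw [← hz]; exact hcm⟩
      apply hnB
      rw [← hk] at hF hz
      rw [B_ev (Or.inl hF), ← hz]
      exact List.mem_cons_self
    · obtain ⟨n', hn', hF, hncm, hz⟩ := fed_of hsub hxB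
      refine fin (n' + 1) hz.symm ?_
      rw [c_F hF]
      by_contra hc
      have := hflt n'
      exact hncm (cmt_of (l := l) (by omega) (hin n' hn'))

/-! ### The case of a dead column -/

theorem flt_ge {i l : ℕ} {Q : Set ℕ} (hQ : Q.Infinite) (h1 : Q ⊆ Wset l)
    (h2 : ∀ x ∈ Q, x ∈ Wset i ∨ ∃ n, x ∈ Xs i n) (M : ℕ) :
    ∃ N, ∀ n ≥ N, M ≤ flt i l n (Xs i n) := by
  obtain ⟨t, ht, hc⟩ := hQ.exists_subset_card_eq M
  have key : ∀ x ∈ t, ∃ N, ∀ n ≥ N, inW l n x = true ∧ (inW i n x = true ∨ x ∈ Xs i n) := by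
    intro x hx
    obtain ⟨s, hs⟩ := mem_W.1 (h1 (ht hx))
    rcases h2 x (ht hx) with h | ⟨n', h⟩
    · obtain ⟨s', hs'⟩ := mem_W.1 h
      exact ⟨max s s', fun n hn => ⟨inW_mono (le_of_max_le_left hn) hs,
        Or.inl (inW_mono (le_of_max_le_right hn) hs')⟩⟩
    · exact ⟨max s n', fun n hn => ⟨inW_mono (le_of_max_le_left hn) hs,
        Or.inr (X_mono (le_of_max_le_right hn) h)⟩⟩
  choose! g hg using key
  refine ⟨t.sup g, fun n hn => ?_⟩
  rw [flt, ← List.toFinset_card_of_nodup (List.nodup_range.filter _), ← hc]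
  refine Finset.card_le_card fun x hx => ?_
  have := hg x hx n ((Finset.le_sup hx).trans hn)
  simp only [List.mem_toFinset, List.mem_filter, Bool.and_eq_true, Bool.or_eq_true,
    decide_eq_true_eq, List.mem_range]
  exact ⟨inW_lt this.1, this⟩

theorem pig {i C : ℕ} {Q : Set ℕ} (h1 : ∀ x ∈ Q, ∃ n, comm i C n (Xs i n) x = true)
    (h2 : ∀ x ∈ Q, x ∈ Wset i ∨ ∃ n, x ∈ Xs i n) : Q.Finite := by
  have hsub : Q ⊆ ⋃ l ∈ Set.Iio C, {x | x ∈ Q ∧ ∃ n, l + flt i l n (Xs i n) < C ∧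
      inW l n x = true} := by
    intro x hx
    obtain ⟨n, hn⟩ := h1 x hx
    obtain ⟨l, hl, h⟩ := of_cmt hn
    simp only [Set.mem_iUnion]
    exact ⟨l, hl, hx, n, h⟩
  refine Set.Finite.subset ((Set.finite_Iio C).biUnion fun l _ => ?_) hsub
  by_contra hinf
  obtain ⟨N, hN⟩ := flt_ge (i := i) (l := l) hinf
    (fun x hx => by obtain ⟨-, n, -, h⟩ := hx; exact mem_W.2 ⟨n, h⟩)
    (fun x hx => h2 x hx.1) C
  refine hinf ((Set.finite_Iio N).subset ?_)
  rintro x ⟨-, n, h3, h4⟩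
  have hlt := inW_lt h4
  by_contra hc
  have := hN n (by simp at hc; omega)
  omega

theorem t_le (i n m : ℕ) : tA i n m ≤ n := by
  induction n with
  | zero => simp [tA, colAt_big i 0 m (by omega), dflt]
  | succ n ih =>
    by_cases hF : EF i m n
    · rw [t_F hF]; omega
    by_cases hS : ES i m n
    · rw [t_S hS]; omega
    by_cases hR : ER i m n
    · rw [t_R hR]; omega
    rw [t_N hF hS hR]; omega

section

theorem next_F {i k N0 : ℕ} (hF : ∀ N, ∃ n ≥ N, EF i k n) (hS : ∀ n ≥ N0, ¬ ES i k n)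
    (hR : ∀ n ≥ N0, ¬ ER i k n) {n : ℕ} (hn : N0 ≤ n) :
    ∃ n' ≥ n, EF i k n' ∧ colAt (run i n') k = colAt (run i n) k := by
  obtain ⟨n1, h1, hE⟩ := hF n
  obtain ⟨n', hn', he, hc⟩ := next_ev hR hn ⟨n1, h1, Or.inl hE⟩
  rcases he with he | he
  · exact ⟨n', hn', he, hc⟩
  · exact absurd he (hS n' (by omega))

theorem t_hits {i k N0 : ℕ} (hF : ∀ N, ∃ n ≥ N, EF i k n) (hS : ∀ n ≥ N0, ¬ ES i k n)
    (hR : ∀ n ≥ N0, ¬ ER i k n) (d : ℕ) :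
    ∃ n ≥ N0, EF i k n ∧ tA i n k = tA i N0 k + d := by
  induction d with
  | zero =>
    obtain ⟨n', hn', he, hc⟩ := next_F hF hS hR le_rfl
    exact ⟨n', hn', he, by rw [tA, hc]; rfl⟩
  | succ d ih =>
    obtain ⟨n, hn, he, ht⟩ := ih
    obtain ⟨n', hn', he', hc⟩ := next_F hF hS hR (n := n + 1) (by omega)
    refine ⟨n', by omega, he', ?_⟩
    have : tA i n' k = tA i (n + 1) k := by rw [tA, hc]; rfl
    rw [this, t_F he, ht]; omega

theorem sel_pos {i k N0 : ℕ} (hF : ∀ N, ∃ n ≥ N, EF i k n) (hS : ∀ n ≥ N0, ¬ ES i k n)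
    (hR : ∀ n ≥ N0, ¬ ER i k n) {x : ℕ}
    (hcv : ∀ n ≥ N0, conv (tagOf x - 1) n (Nat.pair (Nat.pair k (tagOf x)) x) = true)
    (d : ℕ) : ∀ (L R : List ℕ) (n : ℕ), L.length ≤ d → N0 ≤ n → sA i n k = L ++ x :: R →
      ∃ n' ≥ n, EF i k n' ∧ selA i n' = some x := by
  induction d with
  | zero =>
    intro L R n hL hn hs
    obtain ⟨n', hn', he, hc⟩ := next_F hF hS hR hn
    refine ⟨n', hn', he, ?_⟩
    have hL : L = [] := List.length_eq_zero_iff.1 (by omega)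
    have hs' : sA i n' k = x :: R := by rw [sA, hc]; rw [hL] at hs; exact hs
    have hk := he.1
    subst hk
    have : selA i n' = (sA i n' (kOf n')).find? fun x =>
      conv (tagOf x - 1) n' (Nat.pair (Nat.pair (kOf n') (tagOf x)) x) := rfl
    rw [this, hs', List.find?_cons, hcv n' (by omega)]
  | succ d ih =>
    intro L R n hL hn hs
    obtain ⟨n', hn', he, hc⟩ := next_F hF hS hR hn
    have hs' : sA i n' k = L ++ x :: R := by rw [sA, hc]; exact hs
    by_cases hx : selA i n' = some x
    · exact ⟨n', hn', he, hx⟩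
    have hk := he.1
    subst hk
    have hsel : selA i n' = (sA i n' (kOf n')).find? fun x =>
      conv (tagOf x - 1) n' (Nat.pair (Nat.pair (kOf n') (tagOf x)) x) := rfl
    have hy : ∃ y ∈ L, selA i n' = some y := by
      rw [hsel, hs', List.find?_append] at hx ⊢
      rw [List.find?_cons, hcv n' (by omega)] at hx ⊢
      cases hf : L.find? fun x =>
        conv (tagOf x - 1) n' (Nat.pair (Nat.pair (kOf n') (tagOf x)) x) with
      | none => rw [hf] at hx; exact absurd rfl hx
      | some y => exact ⟨y, List.mem_of_find?_eq_some hf, rfl⟩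
    obtain ⟨y, hyL, hy⟩ := hy
    have hxy : ¬ selA i n' = some x := hx
    have hnew : sA i (n' + 1) (kOf n') =
        (L.filter fun w => !decide (selA i n' = some w)) ++ x ::
          ((R.filter fun w => !decide (selA i n' = some w)) ++
            [mk (kOf n') (n' + 1) ((tA i n' (kOf n')).unpair.1 + 1)]) := by
      rw [s_F he]
      have : newSubs n' (run i n') = ((sA i n' (kOf n')).filter fun w =>
        !decide (selA i n' = some w)) ++
          [mk (kOf n') (n' + 1) ((tA i n' (kOf n')).unpair.1 + 1)] := rfl
      rw [this, hs', List.filter_append, List.filter_cons]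
      simp [hxy]
    have hlen : (L.filter fun w => !decide (selA i n' = some w)).length < L.length := by
      rw [List.length_filter_lt_length_iff_exists]
      exact ⟨y, hyL, by simp [hy]⟩
    obtain ⟨n'', h1, h2⟩ := ih _ _ (n' + 1) (by omega) (by omega) hnew
    exact ⟨n'', by omega, h2⟩

theorem selected {i k N0 : ℕ} (hF : ∀ N, ∃ n ≥ N, EF i k n) (hS : ∀ n ≥ N0, ¬ ES i k n)
    (hR : ∀ n ≥ N0, ¬ ER i k n) {x n : ℕ} (hn : N0 ≤ n) (hx : x ∈ sA i n k)
    (hdom : ((Denumerable.ofNat Code (tagOf x - 1)).eval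
      (Nat.pair (Nat.pair k (tagOf x)) x)).Dom) :
    ∃ n' ≥ n, EF i k n' ∧ selA i n' = some x := by
  by_contra hc
  push Not at hc
  have hst : ∀ n' ≥ n, x ∈ sA i n' k := by
    intro n' hn'
    induction n', hn' using Nat.le_induction with
    | base => exact hx
    | succ n' hn' ih =>
      by_cases he : EF i k n'
      · rw [s_F he, mem_newSubs, he.1]
        exact Or.inl ⟨ih, hc n' hn' he⟩
      · rw [s_N he (hS n' (by omega)) (hR n' (by omega))]; exact ih
  obtain ⟨v, hv⟩ := Part.dom_iff_mem.1 hdom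
  obtain ⟨n0, hn0⟩ := conv_of hv
  obtain ⟨L, R, hLR⟩ := List.append_of_mem (hst (max n n0) (le_max_left _ _))
  obtain ⟨n', hn', h1, h2⟩ := sel_pos (N0 := max n n0) hF (fun n h => hS n (by omega))
    (fun n h => hR n (by omega)) (fun n h => hn0 n (by omega)) L.length L R _ le_rfl le_rfl hLR
  exact hc n' (by omega) h1 h2

end

theorem caseB_speed {i k : ℕ} (hk : dead i k) (hR : ∃ N, ∀ n ≥ N, ¬ ER i k n) :
    ¬ Nonspeedable (BB i) := by
  obtain ⟨hF, NS, hNS⟩ := hk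
  obtain ⟨NR, hNR⟩ := hR
  obtain ⟨N0, hN0⟩ : ∃ N0, N0 = max NS NR := ⟨_, rfl⟩
  have hS : ∀ n ≥ N0, ¬ ES i k n := fun n hn => hNS n (by omega)
  have hR : ∀ n ≥ N0, ¬ ER i k n := fun n hn => hNR n (by omega)
  refine criterion i fun q => ⟨Nat.pair k (q + 1), fun hdom => ?_⟩
  set Q : Set ℕ := {x | ∃ n ≥ N0, EF i k n ∧ selA i n = some x ∧ cmt i n k x} with hQ
  have hQf : Q.Finite := by
    refine pig (i := i) (C := k + cA i N0 k) ?_ ?_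
    · rintro x ⟨n, hn, he, hs, hc⟩
      refine ⟨n, ?_⟩
      rw [cmt, c_const hn hS] at hc
      exact hc
    · rintro x ⟨n, hn, he, hs, hc⟩
      refine Or.inr ⟨n + 1, (X_succ i n x).2 (Or.inr ?_)⟩
      rw [he.1]; exact ⟨he, hs, hc⟩
  have main : ∀ x n, N0 ≤ n → x ∈ sA i n k → tagOf x = q + 1 → x ∉ Q →
      x ∈ BB i ∧ ∃ n v, v ∈ (Denumerable.ofNat Code q).eval
        (Nat.pair (Nat.pair k (q + 1)) x) ∧ v < n ∧ x ∉ Bs i n := by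
    intro x n hn hx ht hxQ
    have hd := hdom x (VV1.2 ⟨n, hx, ht⟩)
    obtain ⟨n', hn', he, hs⟩ := selected hF hS hR hn hx (by rw [ht]; exact hd)
    have hnc : ¬ cmt i n' k x := fun h => hxQ ⟨n', by omega, he, hs, h⟩
    constructor
    · have hz : zA i (n' + 1) k = x := by
        rw [z_F he]
        exact newZ_fed hs (by rw [he.1]; exact hnc)
      obtain ⟨n2, h2, he2⟩ := hF (n' + 1)
      rw [← hz]
      exact z_enters hR (by omega) ⟨n2, h2, Or.inl he2⟩
    · have hcv := sel_conv hs
      obtain ⟨v, hv, hvn⟩ := of_conv hcv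
      rw [ht, he.1] at hv
      exact ⟨n', v, hv, hvn, (inv i n').nB _ x (Or.inr (sel_mem hs))⟩
  constructor
  · refine Set.Finite.subset (((Set.finite_Iio N0).biUnion fun n _ =>
      (sA i n k).finite_toSet).union hQf) ?_
    rintro x ⟨hx, hxB⟩
    obtain ⟨n, hx, ht⟩ := VV1.1 hx
    by_contra hc
    simp only [Set.mem_union, Set.mem_iUnion, not_or, not_exists] at hc
    have hn : N0 ≤ n := by
      by_contra hlt
      exact hc.1 n (by simpa using hlt) hx
    exact hxB (main x n hn hx ht hc.2).1
  · refine inf_of_late (i := i) (fun x hx => hx.1.2) fun N => ?_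
    obtain ⟨b, hb⟩ := (hQf.image idOf).bddAbove
    have hT : tA i N0 k ≤ Nat.pair q (tA i N0 k + N + b) := by
      have := Nat.right_le_pair q (tA i N0 k + N + b)
      omega
    obtain ⟨n, hn, he, ht⟩ := t_hits hF hS hR (Nat.pair q (tA i N0 k + N + b) - tA i N0 k)
    have ht' : tA i n k = Nat.pair q (tA i N0 k + N + b) := by omega
    have hle := t_le i n k
    have hge := Nat.right_le_pair q (tA i N0 k + N + b)
    have hmem : mk k (n + 1) (q + 1) ∈ sA i (n + 1) k := by
      rw [s_F he, mem_newSubs, he.1, ht']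
      right; simp
    have hxQ : mk k (n + 1) (q + 1) ∉ Q := by
      intro h
      have := hb ⟨_, h, rfl⟩
      simp at this; omega
    have hm := main _ (n + 1) (by omega) hmem (by simp) hxQ
    refine ⟨_, ⟨⟨VV1.2 ⟨n + 1, hmem, by simp⟩, hm.1⟩, hm.2⟩, fun h => ?_⟩
    have := (inv i N).idB _ h
    simp at this; omega

theorem bad_fin {i m : ℕ} (hS : ∃ N, ∀ n ≥ N, ¬ ES i m n) :
    {x | x ∈ Wset i ∧ x ∈ BB i ∧ colOf x = m}.Finite := by
  obtain ⟨N, hN⟩ := hS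
  have hQ : {x | x ∈ Wset i ∧ ∃ n ≥ N, cmt i n m x}.Finite := by
    refine pig (i := i) (C := m + cA i N m) ?_ fun x hx => Or.inl hx.1
    rintro x ⟨-, n, hn, hc⟩
    rw [cmt, c_const hn hN] at hc
    exact ⟨n, hc⟩
  refine Set.Finite.subset ((Bs i N).finite_toSet.union hQ) ?_
  rintro x ⟨hW, ⟨n', hn'⟩, hcol⟩
  by_contra hc
  simp only [Set.mem_union, not_or] at hc
  have key : ∀ n ≥ N, x ∉ Bs i n := by
    intro n hn
    induction n, hn using Nat.le_induction with
    | base => exact hc.1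
    | succ n hn ih =>
      intro h
      rcases entry h with h | ⟨h, he⟩
      · exact ih h
      · have hk : kOf n = m := by
          rw [← hcol, h]; exact ((inv i n).col _ _ (Or.inl rfl)).symm
        rw [hk] at he h
        rcases he with he | he
        · exact hc.2 ⟨hW, n, hn, by rw [h]; exact he.2⟩
        · exact hN n hn he
  exact key (max N n') (le_max_left _ _) (B_mono (le_max_right _ _) hn')

theorem not_B_of_fresh {i n x : ℕ} (hid : idOf x ≤ n) (hz : zA i (n + 1) (colOf x) = mk (colOf x) (n + 1) 0)
    (hs : sA i (n + 1) (colOf x) = []) (hB : x ∉ Bs i (n + 1)) : x ∉ BB i := by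
  have hal : ¬ alive i (n + 1) (colOf x) x := by
    rintro (h | h)
    · have := congrArg idOf h
      rw [hz] at this; simp at this; omega
    · rw [hs] at h; cases h
  rintro ⟨n', hn'⟩
  exact (gone (le_max_left (n + 1) n') (by omega) hal hB).2 (B_mono (le_max_right _ _) hn')

theorem caseB_non {i j k : ℕ} (hk : dead i k) (hd : Disjoint (Wset i) (Wset j))
    (hu : Wset i ∪ Wset j = BB i) : Nonspeedable (Wset i) := by
  classical
  obtain ⟨hF, N0, hS⟩ := hk
  obtain ⟨C, hC⟩ : ∃ C, C = k + cA i N0 k := ⟨_, rfl⟩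
  obtain ⟨T, hT⟩ : ∃ T : List ℕ, ∀ m, m ∈ T ↔ m ≤ C ∧ ∀ N, ∃ n ≥ N, ES i m n :=
    ⟨(List.range (C + 1)).filter fun m => decide (∀ N, ∃ n ≥ N, ES i m n), fun m => by
      simp⟩
  refine nonspeed i j i (Or.inl rfl) hd hu
    (fun b n => (decide (colOf b.1 < C + 1) && !decide (colOf b.1 ∈ T)) ||
      ((decide (colOf b.1 ∈ T) && (decide (kOf n = colOf b.1) &&
          ((!comm i (colOf b.1 + cA i n (colOf b.1)) n (Xs i n) (zA i n (colOf b.1))) &&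
            (conv (colOf b.1) n (Nat.pair (Nat.pair (colOf b.1) 0) (zA i n (colOf b.1))) &&
              decide (idOf b.1 < n))))) ||
       (decide (C < colOf b.1) && (decide (kOf n = k) &&
          (comm i (k + cA i n k) n (Xs i n) (zA i n k) && (decide (N0 < n) &&
            (decide (colOf b.1 < n) && decide (idOf b.1 < n)))))))) ?_ ?_ ?_
  · have hn : Primrec fun a : (ℕ × ℕ) × ℕ => a.2 := Primrec.snd
    have hx : Primrec fun a : (ℕ × ℕ) × ℕ => a.1.1 := Primrec.fst.comp Primrec.fst
    have h1 : Primrec fun a : (ℕ × ℕ) × ℕ => kOf a.2 := prim_kOf.comp Primrec.snd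
    have h2 : Primrec fun a : (ℕ × ℕ) × ℕ => colOf a.1.1 := prim_col.comp hx
    have h3 : Primrec fun a : (ℕ × ℕ) × ℕ => idOf a.1.1 := prim_id.comp hx
    have hc : ∀ c : ℕ, Primrec fun _ : (ℕ × ℕ) × ℕ => c := fun c => Primrec.const c
    have hz := zA_c (hc i) hn h2
    have hzk := zA_c (hc i) hn (hc k)
    have hTm : Primrec fun a : (ℕ × ℕ) × ℕ => decide (colOf a.1.1 ∈ T) :=
      elem_c h2 (Primrec.const T)
    have hnT := Primrec.not.comp hTm
    have hcm := Primrec.not.comp (cmt_c (i := i) hn h2 hz)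
    have hcmk := cmt_c (i := i) hn (hc k) hzk
    have hcv := conv_c h2 hn (pair_c (pair_c h2 (hc 0)) hz)
    have h := or_c (and_c (lt_c h2 (hc (C + 1))) hnT)
      (or_c (and_c hTm (and_c (eq_c h1 h2) (and_c hcm (and_c hcv (lt_c h3 hn)))))
        (and_c (lt_c (hc C) h2) (and_c (eq_c h1 (hc k)) (and_c hcmk (and_c (lt_c (hc N0) hn)
          (and_c (lt_c h2 hn) (lt_c h3 hn)))))))
    exact Primrec.to_comp h
  · rintro ⟨x, s⟩
    by_cases hxT : colOf x ∈ T
    · obtain ⟨n, hn, he⟩ := ((hT _).1 hxT).2 (idOf x + 1)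
      refine ⟨n, ?_⟩
      have h2 : comm i (colOf x + cA i n (colOf x)) n (Xs i n) (zA i n (colOf x)) = false := by
        simpa [cmt] using he.2.1
      have h3 : idOf x < n := hn
      simp [hxT, he.1, he.2.2, h2, h3]
    · by_cases hxC : C < colOf x
      · obtain ⟨n, hn, he⟩ := hF (N0 + colOf x + idOf x + 1)
        refine ⟨n, ?_⟩
        have h2 : comm i (k + cA i n k) n (Xs i n) (zA i n k) = true := he.2
        have h3 : idOf x < n := by omega
        have h4 : N0 < n := by omega
        have h5 : colOf x < n := by omega
        simp [hxC, he.1, h2, h3, h4, h5]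
      · exact ⟨0, by simp [hxT]; omega⟩
  · intro v hv
    refine Set.Finite.subset (((List.range (C + 1)).filter fun m =>
      decide (m ∉ T)).finite_toSet.biUnion (t := fun m =>
        {x | x ∈ Wset i ∧ x ∈ BB i ∧ colOf x = m}) fun m hm => bad_fin ?_) ?_
    · have hm' : m < C + 1 ∧ m ∉ T := by simpa using hm
      by_contra hc
      push Not at hc
      exact hm'.2 ((hT m).2 ⟨by omega, hc⟩)
    · rintro x ⟨⟨-, hxi⟩, n, hD, hnB⟩
      have hxB : x ∈ BB i := hu ▸ Or.inl hxi
      simp only [Bool.or_eq_true, Bool.and_eq_true, decide_eq_true_eq, Bool.not_eq_true',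
        decide_eq_false_iff_not] at hD
      rcases hD with ⟨h1, h2⟩ | ⟨h1, h2, h3, h4, h5⟩ | ⟨h1, h2, h3, h4, h5, h6⟩
      · simp only [Set.mem_iUnion]
        exact ⟨colOf x, by simp [h2]; omega, hxi, hxB, rfl⟩
      · have he : ES i (colOf x) n := ⟨h2, by simp [cmt, h3], h4⟩
        exact absurd hxB (not_B_of_fresh h5.le (z_S he) (s_S he) hnB)
      · have he : ER i (colOf x) n := by
          refine ⟨?_, ?_, h5.le⟩
          · rw [h2]; exact ⟨h2, h3⟩
          · rw [h2, c_const h4.le hS]; omega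
        exact absurd hxB (not_B_of_fresh h6.le (z_R he) (s_R he) hnB)

theorem main_i (i : ℕ) : ¬ Nonspeedable (BB i) ∧ ∀ j, Disjoint (Wset i) (Wset j) →
    Wset i ∪ Wset j = BB i → Nonspeedable (Wset i) ∨ Nonspeedable (Wset j) := by
  classical
  by_cases h : ∃ k, dead i k
  · have hk := Nat.find_spec h
    have hR := resets_finite (i := i) (m := Nat.find h) fun k hk => Nat.find_min h hk
    exact ⟨caseB_speed hk hR, fun j hd hu => Or.inl (caseB_non hk hd hu)⟩
  · push Not at h
    exact ⟨caseA_speed h, fun j hd hu => Or.inr (caseA_non h hd hu)⟩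

end SP

/-- For every total computable `f : ℕ → ℕ × ℕ` there are an index `e` and a speedable c.e.
set `B = W e` such that, with `(i, j) = f e`, if `W i` and `W j` are disjoint and
`W i ∪ W j = B`, then at least one of `W i`, `W j` is nonspeedable. -/
theorem one_split_nonspeedable (f : ℕ → ℕ × ℕ) (hf : Computable f) :
    ∃ (e : ℕ) (B : Set ℕ), Wset e = B ∧ Speedable B ∧
      (Disjoint (Wset (f e).1) (Wset (f e).2) → Wset (f e).1 ∪ Wset (f e).2 = B →
        Nonspeedable (Wset (f e).1) ∨ Nonspeedable (Wset (f e).2)) := by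
  exact SP.final SP.main_i f hf
end

section
/- For every total computable function f : ℕ → ℕ × ℕ there exist an index e and a speedable computably enumerable set B with B = W_e such that, writing (i, j) = f(e), if W_i and W_j are disjoint and W_i ∪ W_j = B, then either W_i is nonspeedable or W_j is computable. -/
open Nat.Partrec (Code)

namespace OS

/-- step-bounded halting -/
def stg (k x s : ℕ) : Bool := (Nat.Partrec.Code.evaln s (Denumerable.ofNat Code k) x).isSome

theorem stg_mono {k x s t : ℕ} (h : s ≤ t) (hs : stg k x s = true) : stg k x t = true := by
  unfold stg at *
  rw [Option.isSome_iff_exists] at *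
  obtain ⟨v, hv⟩ := hs
  exact ⟨v, Nat.Partrec.Code.evaln_mono h hv⟩

theorem mem_Wset_iff {k x : ℕ} : x ∈ Wset k ↔ ∃ s, stg k x s = true := by
  unfold Wset stg
  simp only [Set.mem_ofPred_eq, Part.dom_iff_mem, Option.isSome_iff_exists]
  constructor
  · rintro ⟨v, hv⟩
    obtain ⟨s, hs⟩ := Nat.Partrec.Code.evaln_complete.1 hv
    exact ⟨s, v, hs⟩
  · rintro ⟨s, v, hv⟩
    exact ⟨v, Nat.Partrec.Code.evaln_sound hv⟩

theorem stg_Phi {k x : ℕ} (h : x ∈ Wset k) : stg k x (Phi k x) = true := by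
  obtain ⟨s, hs⟩ := mem_Wset_iff.1 h
  have : Phi k x ∈ {s | x ∈ WsetStage k s} := Nat.sInf_mem ⟨s, hs⟩
  exact this

theorem Phi_le {k x s : ℕ} (h : stg k x s = true) : Phi k x ≤ s := Nat.sInf_le h

theorem stg_lt {k x s : ℕ} (h : stg k x s = true) : x < s := by
  unfold stg at h
  rw [Option.isSome_iff_exists] at h
  obtain ⟨v, hv⟩ := h
  exact Nat.Partrec.Code.evaln_bound hv

theorem Phi_eq {k x n : ℕ} (h : stg k x n = true) (h0 : n = 0 ∨ stg k x (n-1) = false) :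
    Phi k x = n := by
  apply le_antisymm (Phi_le h)
  by_contra hc
  have h1 := stg_Phi (mem_Wset_iff.2 ⟨_, h⟩)
  rcases h0 with h0 | h0
  · omega
  · have := stg_mono (t := n-1) (by omega) h1
    simp [this] at h0

theorem primrec_stg : Primrec fun p : ℕ × ℕ × ℕ => stg p.1 p.2.1 p.2.2 := by
  unfold stg
  apply Primrec.option_isSome.comp
  exact Nat.Partrec.Code.primrec_evaln.comp
    (Primrec.pair (Primrec.pair (Primrec.snd.comp Primrec.snd)
      ((Primrec.ofNat Code).comp Primrec.fst)) (Primrec.fst.comp Primrec.snd))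

theorem find_computable {α : Type*} [Primcodable α] (R : α → ℕ → Bool) (hR : Computable₂ R)
    (h : ∀ a, ∃ n, R a n = true) : ∃ g : α → ℕ, Computable g ∧ ∀ a, R a (g a) = true := by
  refine ⟨fun a => Nat.find (h a), ?_, fun a => Nat.find_spec (h a)⟩
  have h1 : Partrec fun a => Nat.rfind (fun n => (R a n : Part Bool)) :=
    Partrec.rfind hR.partrec₂
  refine h1.of_eq fun a => ?_
  apply Part.eq_some_iff.2
  apply Nat.mem_rfind.2
  refine ⟨by simpa using (Nat.find_spec (h a)), ?_⟩
  intro m hm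
  have := Nat.find_min (h a) hm
  simpa using this

theorem sum_computable {α : Type*} [Primcodable α] (H : ℕ → α → ℕ)
    (hH : Computable fun q : ℕ × α => H q.1 q.2) :
    ∃ g : ℕ → α → ℕ, (Computable fun q : ℕ × α => g q.1 q.2) ∧
      ∀ n a p, p ≤ n → H p a ≤ g n a := by
  refine ⟨fun n a => Nat.rec (H 0 a) (fun p acc => acc + H (p+1) a) n, ?_, ?_⟩
  · have h1 := Computable.nat_rec (α := ℕ × α) (σ := ℕ) (f := fun q => q.1) (g := fun q => H 0 q.2)
      (h := fun q p => p.2 + H (p.1+1) q.2) Computable.fst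
      (hH.comp (Computable.pair (Computable.const 0) Computable.snd)) ?_
    · exact h1
    · have : Computable fun z : (ℕ × α) × (ℕ × ℕ) => H (z.2.1+1) z.1.2 :=
        hH.comp (Computable.pair (Computable.succ.comp (Computable.fst.comp Computable.snd))
          (Computable.snd.comp Computable.fst))
      exact Primrec.nat_add.to_comp.comp (Computable.snd.comp Computable.snd) this
  · intro n a p hp
    induction n with
    | zero => obtain rfl : p = 0 := by omega
              simp
    | succ n ih =>
      rcases Nat.lt_or_ge n p with h | h
      · obtain rfl : p = n+1 := by omega
        simp
      · have := ih h
        simp only at *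
        omega

/-- unbounded search for a Boolean predicate -/
def srch (r : ℕ → Bool) : Part ℕ := Nat.rfind (fun n => Part.some (r n) : ℕ →. Bool)

theorem srch_dom (r : ℕ → Bool) : (srch r).Dom ↔ ∃ n, r n = true := by
  unfold srch
  constructor
  · intro h
    have := Nat.rfind_spec (Part.get_mem h)
    exact ⟨_, by simpa using this⟩
  · rintro ⟨s, hs⟩
    refine Nat.rfind_dom.2 ⟨s, ?_, ?_⟩
    · rw [hs]; exact Part.mem_some _
    · intro m _; trivial

theorem srch_partrec {α : Type*} [Primcodable α] (R : α → ℕ → Bool) (hR : Computable₂ R) :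
    Partrec fun a => srch (R a) := Partrec.rfind (p := fun a n => Part.some (R a n)) hR


theorem comp3 {α : Type*} [Primcodable α] {v : ℕ → ℕ → ℕ → Bool}
    (hv : Computable fun q : ℕ × ℕ × ℕ => v q.1 q.2.1 q.2.2) {f g h : α → ℕ}
    (hf : Computable f) (hg : Computable g) (hh : Computable h) :
    Computable fun z => v (f z) (g z) (h z) :=
  Computable.comp hv (Computable.pair hf (Computable.pair hg hh))

theorem pu1 : Computable fun n : ℕ => n.unpair.1 := (Primrec.fst.comp Primrec.unpair).to_comp

theorem pu2 : Computable fun n : ℕ => n.unpair.2 := (Primrec.snd.comp Primrec.unpair).to_comp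

theorem ei1 (v : ℕ → ℕ → ℕ → Bool)
    (hv : Computable fun q : ℕ × ℕ × ℕ => v q.1 q.2.1 q.2.2) :
    ∃ c : Code, ∀ p x, c.eval (Nat.pair p x) = srch (v p x) := by
  have hq : Computable fun z : ℕ × ℕ => v z.1.unpair.1 z.1.unpair.2 z.2 :=
    comp3 (f := fun z : ℕ × ℕ => z.1.unpair.1) hv (pu1.comp Computable.fst)
      (pu2.comp Computable.fst) Computable.snd
  have h2 : Partrec fun n : ℕ => srch (v n.unpair.1 n.unpair.2) :=
    srch_partrec (fun n : ℕ => v n.unpair.1 n.unpair.2) hq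
  obtain ⟨c, hc⟩ := Nat.Partrec.Code.exists_code.1 (Partrec.nat_iff.1 h2)
  refine ⟨c, fun p x => ?_⟩
  have h3 := congrFun hc (Nat.pair p x)
  rw [h3]; simp only [Nat.unpair_pair]

theorem ei2 (c : Code) : Computable fun p : ℕ => Encodable.encode (Nat.Partrec.Code.curry c p) := by
  have h : Computable fun p : ℕ => Nat.Partrec.Code.curry c p :=
    (Nat.Partrec.Code.primrec₂_curry.comp (Primrec.const c) Primrec.id).to_comp
  exact Computable.encode.comp h

theorem exists_index (v : ℕ → ℕ → ℕ → Bool)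
    (hv : Computable fun q : ℕ × ℕ × ℕ => v q.1 q.2.1 q.2.2) :
    ∃ κ : ℕ → ℕ, Computable κ ∧ ∀ p x, x ∈ Wset (κ p) ↔ ∃ s, v p x s = true := by
  obtain ⟨c, hc⟩ := ei1 v hv
  refine ⟨_, ei2 c, fun p x => ?_⟩
  have h4 : x ∈ Wset (Encodable.encode (Nat.Partrec.Code.curry c p)) ↔
      ((Nat.Partrec.Code.curry c p).eval x).Dom := by
    unfold Wset
    rw [Denumerable.ofNat_encode]
    exact Iff.rfl
  rw [h4, Nat.Partrec.Code.eval_curry, hc]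
  exact srch_dom _

theorem speed_lemma (A : Set ℕ) (a : ℕ → ℕ → Bool) (ha : Computable₂ a)
    (hA : ∀ x, x ∈ A ↔ ∃ t, a x t = true) (hN : Nonspeedable A)
    (v : ℕ → ℕ → ℕ → Bool) (hv : Computable fun q : ℕ × ℕ × ℕ => v q.1 q.2.1 q.2.2) :
    ∃ h : ℕ × ℕ → ℕ, Computable h ∧ ∀ p, ({x | ∃ s, v p x s = true} \ A).Finite →
      {x | ∃ s, v p x s = true ∧ x ∈ A ∧ ∀ t ≤ h (x, s), a x t = false}.Finite := by
  obtain ⟨i, hi, h0, hh0, hs⟩ := hN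
  obtain ⟨κ, hκ, hκW⟩ := exists_index v hv
  let R : (ℕ × ℕ × ℕ) → ℕ → Bool := fun q n =>
    !(v q.1 q.2.1 q.2.2) || ((stg (κ q.1) q.2.1 n.unpair.1 &&
      (n.unpair.1 == 0 || !stg (κ q.1) q.2.1 (n.unpair.1 - 1))) &&
      (!stg i q.2.1 (h0 (q.2.1, n.unpair.1)) || a q.2.1 n.unpair.2))
  have c1 : Computable fun z : (ℕ × ℕ × ℕ) × ℕ => z.1.1 := Computable.fst.comp Computable.fst
  have c2 : Computable fun z : (ℕ × ℕ × ℕ) × ℕ => z.1.2.1 :=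
    Computable.fst.comp (Computable.snd.comp Computable.fst)
  have c4 : Computable fun z : (ℕ × ℕ × ℕ) × ℕ => z.2.unpair.1 :=
    Computable.fst.comp (Computable.unpair.comp Computable.snd)
  have c5 : Computable fun z : (ℕ × ℕ × ℕ) × ℕ => z.2.unpair.2 :=
    Computable.snd.comp (Computable.unpair.comp Computable.snd)
  have ck : Computable fun z : (ℕ × ℕ × ℕ) × ℕ => κ z.1.1 := hκ.comp c1
  have cS : ∀ {f g h : (ℕ × ℕ × ℕ) × ℕ → ℕ}, Computable f → Computable g → Computable h →
      Computable fun z => stg (f z) (g z) (h z) := fun hf hg hh =>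
    primrec_stg.to_comp.comp (Computable.pair hf (Computable.pair hg hh))
  have hnot : ∀ {f : (ℕ × ℕ × ℕ) × ℕ → Bool}, Computable f → Computable fun z => !(f z) :=
    fun hf => Primrec.not.to_comp.comp hf
  have hand : ∀ {f g : (ℕ × ℕ × ℕ) × ℕ → Bool}, Computable f → Computable g →
    Computable fun z => (f z && g z) := fun hf hg => Primrec.and.to_comp.comp hf hg
  have hor : ∀ {f g : (ℕ × ℕ × ℕ) × ℕ → Bool}, Computable f → Computable g →
    Computable fun z => (f z || g z) := fun hf hg => Primrec.or.to_comp.comp hf hg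
  have hR : Computable₂ R := by
    refine hor (hnot (hv.comp Computable.fst)) (hand (hand (cS ck c2 c4) (hor ?_ (hnot (cS ck c2 ?_))))
      (hor (hnot (cS (Computable.const i) c2 (hh0.comp (Computable.pair c2 c4)))) (ha.comp c2 c5)))
    · exact (Primrec.beq (α := ℕ)).to_comp.comp c4 (Computable.const 0)
    · exact Primrec.nat_sub.to_comp.comp c4 (Computable.const 1)
  have hex : ∀ q, ∃ n, R q n = true := by
    rintro ⟨p, x, s⟩
    by_cases hvs : v p x s = true
    · have hx : x ∈ Wset (κ p) := (hκW p x).2 ⟨s, hvs⟩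
      have h1 := stg_Phi hx
      have h2 : Phi (κ p) x = 0 ∨ stg (κ p) x (Phi (κ p) x - 1) = false := by
        by_contra hc
        push Not at hc
        have := Phi_le (Bool.of_not_eq_false hc.2)
        omega
      have h3 : ∃ m, stg i x (h0 (x, Phi (κ p) x)) = false ∨ a x m = true := by
        by_cases h4 : stg i x (h0 (x, Phi (κ p) x)) = true
        · have : x ∈ A := hi ▸ mem_Wset_iff.2 ⟨_, h4⟩
          obtain ⟨t, ht⟩ := (hA x).1 this
          exact ⟨t, Or.inr ht⟩
        · exact ⟨0, Or.inl (by simpa using h4)⟩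
      obtain ⟨m, hm⟩ := h3
      refine ⟨Nat.pair (Phi (κ p) x) m, ?_⟩
      simp only [R, Nat.unpair_pair, h1]
      simp only [Bool.or_eq_true, Bool.and_eq_true, Bool.not_eq_true', beq_iff_eq]
      exact Or.inr ⟨⟨trivial, h2⟩, hm⟩
    · refine ⟨0, ?_⟩
      simp [R, hvs]
  obtain ⟨H, hHc, hH⟩ := find_computable R hR hex
  obtain ⟨g, hg, hgH⟩ := sum_computable (α := ℕ × ℕ) (fun p q => H (p, q)) hHc
  refine ⟨fun q => g q.1 q, hg.comp (Computable.pair Computable.fst Computable.id), ?_⟩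
  intro p hp
  have hW : Wset (κ p) = {x | ∃ s, v p x s = true} := by ext x; exact hκW p x
  have hfin := hs (κ p) (by rw [hW]; exact hp)
  refine (hfin.union (Set.finite_lt_nat p)).subset ?_
  rintro x ⟨s, hvs, hxA, hbad⟩
  by_cases hpx : x < p
  · exact Or.inr hpx
  left
  have hx : x ∈ Wset (κ p) := (hκW p x).2 ⟨s, hvs⟩
  refine ⟨⟨hx, hxA⟩, ?_⟩
  have h1 := hH (p, x, s)
  simp only [R, Bool.or_eq_true, Bool.and_eq_true, Bool.not_eq_true', beq_iff_eq, hvs] at h1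
  rcases h1 with h1 | ⟨⟨h1, h2⟩, h3⟩
  · simp at h1
  have h4 := Phi_eq h1 h2
  rcases h3 with h3 | h3
  · intro hle
    rw [h4] at hle
    have hi' : x ∈ Wset i := hi ▸ hxA
    have := stg_mono hle (stg_Phi hi')
    simp [this] at h3
  · exfalso
    have h5 := hbad (H (p, x, s)).unpair.2
      ((Nat.unpair_right_le _).trans (hgH x (x, s) p (by omega)))
    simp [h5] at h3

theorem fixed_index (f : ℕ → ℕ × ℕ) (hf : Computable f) (a : ℕ → ℕ → ℕ → Bool)
    (ha : Computable fun q : ℕ × ℕ × ℕ => a q.1 q.2.1 q.2.2) :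
    ∃ e, ∀ x, x ∈ Wset e ↔ ∃ t, a (f e).2 x t = true := by
  have h0 : Computable₂ fun (z : Code × ℕ) (n : ℕ) => a (f (Encodable.encode z.1)).2 z.2 n :=
    ha.comp (Computable.pair (Computable.snd.comp
        (hf.comp (Computable.encode.comp (Computable.fst.comp Computable.fst))))
        (Computable.pair (Computable.snd.comp Computable.fst) Computable.snd))
  have h1 : Partrec₂ fun (c : Code) (x : ℕ) => srch (a (f (Encodable.encode c)).2 x) :=
    srch_partrec _ h0
  obtain ⟨c, hc⟩ := Nat.Partrec.Code.fixed_point₂ h1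
  refine ⟨Encodable.encode c, fun x => ?_⟩
  simp only [Wset, Set.mem_ofPred_eq, Denumerable.ofNat_encode, hc]
  exact srch_dom _

end OS


namespace OS

section primrecHelpers
variable {α β : Type*} [Primcodable α] [Primcodable β]

theorem pr_any {l : α → List β} {f : α → β → Bool} (hl : Primrec l) (hf : Primrec₂ f) :
    Primrec fun a => (l a).any (f a) := by
  have h : Primrec fun a => (l a).foldr (fun x acc => f a x || acc) false :=
    Primrec.list_foldr (h := fun a p => f a p.1 || p.2) hl (Primrec.const false)
      (Primrec.or.comp (hf.comp Primrec.fst (Primrec.fst.comp Primrec.snd))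
        (Primrec.snd.comp Primrec.snd))
  refine h.of_eq fun a => ?_
  induction l a with
  | nil => rfl
  | cons b t ih => simp only [List.foldr_cons, List.any_cons, ih]

theorem pr_all {l : α → List β} {f : α → β → Bool} (hl : Primrec l) (hf : Primrec₂ f) :
    Primrec fun a => (l a).all (f a) := by
  have h : Primrec fun a => (l a).foldr (fun x acc => f a x && acc) true :=
    Primrec.list_foldr (h := fun a p => f a p.1 && p.2) hl (Primrec.const true)
      (Primrec.and.comp (hf.comp Primrec.fst (Primrec.fst.comp Primrec.snd))
        (Primrec.snd.comp Primrec.snd))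
  refine h.of_eq fun a => ?_
  induction l a with
  | nil => rfl
  | cons b t ih => simp only [List.foldr_cons, List.all_cons, ih]

theorem pr_ite {c : α → Bool} {f g : α → β} (hc : Primrec c) (hf : Primrec f) (hg : Primrec g) :
    Primrec fun a => if c a = true then f a else g a :=
  Primrec.ite (Primrec.eq.comp hc (Primrec.const true)) hf hg

theorem pr_countP {l : α → List β} {f : α → β → Bool} (hl : Primrec l) (hf : Primrec₂ f) :
    Primrec fun a => (l a).countP (f a) := by
  have h : Primrec fun a => (l a).foldr (fun x acc => if f a x = true then acc + 1 else acc) 0 :=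
    Primrec.list_foldr (h := fun a p => if f a p.1 = true then p.2 + 1 else p.2) hl
      (Primrec.const 0)
      (pr_ite (hf.comp Primrec.fst (Primrec.fst.comp Primrec.snd))
        (Primrec.succ.comp (Primrec.snd.comp Primrec.snd)) (Primrec.snd.comp Primrec.snd))
  refine h.of_eq fun a => ?_
  induction l a with
  | nil => rfl
  | cons b t ih => simp only [List.foldr_cons, List.countP_cons, ih]; split <;> simp

theorem pr_and {f g : α → Bool} (hf : Primrec f) (hg : Primrec g) :
    Primrec fun a => (f a && g a) := Primrec.and.comp hf hg
theorem pr_or {f g : α → Bool} (hf : Primrec f) (hg : Primrec g) :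
    Primrec fun a => (f a || g a) := Primrec.or.comp hf hg
theorem pr_not {f : α → Bool} (hf : Primrec f) :
    Primrec fun a => !(f a) := Primrec.not.comp hf
theorem pr_beq [BEq β] [LawfulBEq β] {f g : α → β} (hf : Primrec f) (hg : Primrec g) :
    Primrec fun a => (f a == g a) := by
  classical
  refine ((Primrec.eq (α := β)).decide.comp hf hg).of_eq fun a => ?_
  rw [Bool.eq_iff_iff]
  simp
theorem pr_le {f g : α → ℕ} (hf : Primrec f) (hg : Primrec g) :
    Primrec fun a => decide (f a ≤ g a) := (Primrec.nat_le.decide).comp hf hg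
theorem pr_lt {f g : α → ℕ} (hf : Primrec f) (hg : Primrec g) :
    Primrec fun a => decide (f a < g a) := (Primrec.nat_lt.decide).comp hf hg
theorem pr_stg {f g h : α → ℕ} (hf : Primrec f) (hg : Primrec g) (hh : Primrec h) :
    Primrec fun a => stg (f a) (g a) (h a) :=
  primrec_stg.comp (Primrec.pair hf (Primrec.pair hg hh))
theorem pr_u1 {f : α → ℕ} (hf : Primrec f) : Primrec fun a => (f a).unpair.1 :=
  Primrec.fst.comp (Primrec.unpair.comp hf)
theorem pr_u2 {f : α → ℕ} (hf : Primrec f) : Primrec fun a => (f a).unpair.2 :=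
  Primrec.snd.comp (Primrec.unpair.comp hf)
theorem pr_pair {f g : α → ℕ} (hf : Primrec f) (hg : Primrec g) :
    Primrec fun a => Nat.pair (f a) (g a) := Primrec₂.natPair.comp hf hg

end primrecHelpers

abbrev Node := List ℕ
abbrev Ev := ℕ × ℕ × ℕ
abbrev Log := List Ev

def nd (y : ℕ) : Node := Denumerable.ofNat (List ℕ) y.unpair.1
def rr (y : ℕ) : ℕ := y.unpair.2.unpair.1
def cc (y : ℕ) : ℕ := y.unpair.2.unpair.2
def dd (y : ℕ) : ℕ := (cc y).unpair.1
def mk (ρ : Node) (r c : ℕ) : ℕ := Nat.pair (Encodable.encode ρ) (Nat.pair r c)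

@[simp] theorem nd_mk (ρ r c) : nd (mk ρ r c) = ρ := by simp [nd, mk]
@[simp] theorem rr_mk (ρ r c) : rr (mk ρ r c) = r := by simp [rr, mk]
@[simp] theorem cc_mk (ρ r c) : cc (mk ρ r c) = c := by simp [cc, mk]
theorem encode_nd (y) : Encodable.encode (nd y) = y.unpair.1 := by simp [nd]
theorem mk_nd (y) : mk (nd y) (rr y) (cc y) = y := by simp [mk, encode_nd, rr, cc]

def anc1 (τ : Node) : Node → Bool
  | [] => false
  | b :: ρ => (!(b == 0) && ρ == τ) || anc1 τ ρ

def anc0 (τ : Node) : Node → Bool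
  | [] => false
  | b :: ρ => (!(b == 1) && ρ == τ) || anc0 τ ρ

def has (t y : ℕ) (l : Log) : Bool := l.any fun ev => ev.1 == t && ev.2.1 == y
def inB (y : ℕ) (l : Log) : Bool := has 2 y l || has 3 y l
def isE (ρ : Node) (ev : Ev) : Bool :=
  (ev.1 == 3 && nd ev.2.1 == ρ) || ((ev.1 == 2 || ev.1 == 3) && anc0 (nd ev.2.1) ρ)
def epoch (l : Log) (ρ : Node) : ℕ := l.countP (isE ρ)
def isN (ρ : Node) (ev : Ev) : Bool :=
  ((ev.1 == 0 || ev.1 == 1) || ev.1 == 4) && nd ev.2.1 == ρ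
def nn (l : Log) (ρ : Node) : ℕ := l.countP (isN ρ)
def isP (ρ : Node) (ev : Ev) : Bool := ev.1 == 3 && nd ev.2.1 == ρ
def PP (l : Log) (ρ : Node) : ℕ := l.countP (isP ρ)
def perm (l : Log) (ρ : Node) : Bool :=
  (List.range (ρ.length + 1)).all fun i =>
    !(anc1 (ρ.drop i) ρ) || decide (Encodable.encode ρ + nn l ρ < PP l (ρ.drop i))
def inW (q x s : ℕ) : Bool := decide (q.unpair.2 ≤ x) && stg q.unpair.1 x s
def active (j q s : ℕ) (l : Log) : Bool :=
  (List.range s).all fun x => !(inW q x s) || (!(stg j x s) && !(has 4 x l))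
def declared (j L y : ℕ) (l : Log) (s : ℕ) : Bool :=
  (List.range (L + 1)).any fun q => inW q y s && active j q s l
def halts (s k z : ℕ) : Bool :=
  ((Nat.Partrec.Code.evaln s (Denumerable.ofNat Code k) z).map (fun v => decide (v < s))).getD false
def conv (ρ : Node) (y : ℕ) (l : Log) (s : ℕ) : Bool :=
  l.any fun ev => (ev.1 == 1 && ev.2.1 == y) && halts s ρ.length (Nat.pair y ev.2.2)

def node (s : ℕ) : Node := Denumerable.ofNat (List ℕ) s.unpair.1
def bnd (l : Log) (ρ : Node) : ℕ := epoch l ρ + Encodable.encode ρ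
def elt1 (l : Log) (ρ : Node) : ℕ := mk ρ (epoch l ρ) (nn l ρ - 1).unpair.1
def elt0 (l : Log) (ρ : Node) : ℕ := mk ρ (epoch l ρ) (nn l ρ).unpair.1
def running (l : Log) (ρ : Node) : Bool := has 1 (elt1 l ρ) l && !(inB (elt1 l ρ) l)

def stepR (j : ℕ) (l : Log) (ρ : Node) : Ev :=
  if declared j (bnd l ρ) (elt1 l ρ) l l.length = true then (2, elt1 l ρ, l.length) else
  if conv ρ (elt1 l ρ) l l.length = true then (3, elt1 l ρ, l.length) else
  (5, elt1 l ρ, l.length)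

def stepN (j : ℕ) (l : Log) (ρ : Node) : Ev :=
  if ((has 1 (elt0 l ρ) l || has 4 (elt0 l ρ) l) ||
      !(halts l.length (dd (elt0 l ρ)) (elt0 l ρ))) = true then (0, elt0 l ρ, l.length) else
  if declared j (bnd l ρ) (elt0 l ρ) l l.length = true then (4, elt0 l ρ, l.length) else
  (1, elt0 l ρ, l.length)

def stepA (j : ℕ) (l : Log) (ρ : Node) : Ev :=
  if running l ρ = true then stepR j l ρ else
  if perm l ρ = true then stepN j l ρ else (5, elt0 l ρ, l.length)

def step (j : ℕ) (l : Log) : Ev := stepA j l (node l.length)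

def lg (j : ℕ) : ℕ → Log
  | 0 => []
  | s + 1 => lg j s ++ [step j (lg j s)]

def G (j s : ℕ) : Ev := step j (lg j s)

section primrecDefs
variable {α : Type*} [Primcodable α]

theorem pr_nd {f : α → ℕ} (hf : Primrec f) : Primrec fun a => nd (f a) :=
  (Primrec.ofNat (List ℕ)).comp (pr_u1 hf)
theorem pr_rr {f : α → ℕ} (hf : Primrec f) : Primrec fun a => rr (f a) := pr_u1 (pr_u2 hf)
theorem pr_cc {f : α → ℕ} (hf : Primrec f) : Primrec fun a => cc (f a) := pr_u2 (pr_u2 hf)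
theorem pr_dd {f : α → ℕ} (hf : Primrec f) : Primrec fun a => dd (f a) := pr_u1 (pr_cc hf)
theorem pr_mk {ρ : α → Node} {r c : α → ℕ} (hρ : Primrec ρ) (hr : Primrec r) (hc : Primrec c) :
    Primrec fun a => mk (ρ a) (r a) (c a) :=
  pr_pair (Primrec.encode.comp hρ) (pr_pair hr hc)

theorem pr_anc1 {τ ρ : α → Node} (hτ : Primrec τ) (hρ : Primrec ρ) :
    Primrec fun a => anc1 (τ a) (ρ a) := by
  have h := Primrec.list_rec (f := ρ) (g := fun _ => false)
    (h := fun a (p : ℕ × List ℕ × Bool) => (!(p.1 == 0) && p.2.1 == τ a) || p.2.2)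
    hρ (Primrec.const false)
    (pr_or (pr_and (pr_not (pr_beq (Primrec.fst.comp Primrec.snd) (Primrec.const 0)))
      (pr_beq (Primrec.fst.comp (Primrec.snd.comp Primrec.snd)) (hτ.comp Primrec.fst)))
      (Primrec.snd.comp (Primrec.snd.comp Primrec.snd)))
  refine h.of_eq fun a => ?_
  induction ρ a with
  | nil => rfl
  | cons b t ih => simp only [anc1, ← ih]

theorem pr_anc0 {τ ρ : α → Node} (hτ : Primrec τ) (hρ : Primrec ρ) :
    Primrec fun a => anc0 (τ a) (ρ a) := by
  have h := Primrec.list_rec (f := ρ) (g := fun _ => false)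
    (h := fun a (p : ℕ × List ℕ × Bool) => (!(p.1 == 1) && p.2.1 == τ a) || p.2.2)
    hρ (Primrec.const false)
    (pr_or (pr_and (pr_not (pr_beq (Primrec.fst.comp Primrec.snd) (Primrec.const 1)))
      (pr_beq (Primrec.fst.comp (Primrec.snd.comp Primrec.snd)) (hτ.comp Primrec.fst)))
      (Primrec.snd.comp (Primrec.snd.comp Primrec.snd)))
  refine h.of_eq fun a => ?_
  induction ρ a with
  | nil => rfl
  | cons b t ih => simp only [anc0, ← ih]

theorem pr_evt {f : α → Ev} (hf : Primrec f) : Primrec fun a => (f a).1 := Primrec.fst.comp hf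
theorem pr_evy {f : α → Ev} (hf : Primrec f) : Primrec fun a => (f a).2.1 :=
  Primrec.fst.comp (Primrec.snd.comp hf)
theorem pr_evs {f : α → Ev} (hf : Primrec f) : Primrec fun a => (f a).2.2 :=
  Primrec.snd.comp (Primrec.snd.comp hf)

theorem pr_has {t y : α → ℕ} {l : α → Log} (ht : Primrec t) (hy : Primrec y) (hl : Primrec l) :
    Primrec fun a => has (t a) (y a) (l a) :=
  pr_any hl (pr_and (pr_beq (pr_evt Primrec.snd) (ht.comp Primrec.fst))
    (pr_beq (pr_evy Primrec.snd) (hy.comp Primrec.fst)))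
theorem pr_inB {y : α → ℕ} {l : α → Log} (hy : Primrec y) (hl : Primrec l) :
    Primrec fun a => inB (y a) (l a) :=
  pr_or (pr_has (Primrec.const 2) hy hl) (pr_has (Primrec.const 3) hy hl)
theorem pr_isP {ρ : α → Node} {e : α → Ev} (hρ : Primrec ρ) (he : Primrec e) :
    Primrec fun a => isP (ρ a) (e a) :=
  pr_and (pr_beq (pr_evt he) (Primrec.const 3)) (pr_beq (pr_nd (pr_evy he)) hρ)
theorem pr_isN {ρ : α → Node} {e : α → Ev} (hρ : Primrec ρ) (he : Primrec e) :
    Primrec fun a => isN (ρ a) (e a) :=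
  pr_and (pr_or (pr_or (pr_beq (pr_evt he) (Primrec.const 0))
    (pr_beq (pr_evt he) (Primrec.const 1))) (pr_beq (pr_evt he) (Primrec.const 4)))
    (pr_beq (pr_nd (pr_evy he)) hρ)
theorem pr_isE {ρ : α → Node} {e : α → Ev} (hρ : Primrec ρ) (he : Primrec e) :
    Primrec fun a => isE (ρ a) (e a) :=
  pr_or (pr_isP hρ he) (pr_and (pr_or (pr_beq (pr_evt he) (Primrec.const 2))
    (pr_beq (pr_evt he) (Primrec.const 3))) (pr_anc0 (pr_nd (pr_evy he)) hρ))
theorem pr_epoch {ρ : α → Node} {l : α → Log} (hl : Primrec l) (hρ : Primrec ρ) :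
    Primrec fun a => epoch (l a) (ρ a) :=
  pr_countP hl (pr_isE (hρ.comp Primrec.fst) Primrec.snd)
theorem pr_nn {ρ : α → Node} {l : α → Log} (hl : Primrec l) (hρ : Primrec ρ) :
    Primrec fun a => nn (l a) (ρ a) :=
  pr_countP hl (pr_isN (hρ.comp Primrec.fst) Primrec.snd)
theorem pr_PP {ρ : α → Node} {l : α → Log} (hl : Primrec l) (hρ : Primrec ρ) :
    Primrec fun a => PP (l a) (ρ a) :=
  pr_countP hl (pr_isP (hρ.comp Primrec.fst) Primrec.snd)

theorem pr_range {n : α → ℕ} (hn : Primrec n) : Primrec fun a => List.range (n a) :=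
  Primrec.list_range.comp hn

theorem pr_perm {ρ : α → Node} {l : α → Log} (hl : Primrec l) (hρ : Primrec ρ) :
    Primrec fun a => perm (l a) (ρ a) := by
  have hρ' : Primrec fun z : α × ℕ => ρ z.1 := hρ.comp Primrec.fst
  have hl' : Primrec fun z : α × ℕ => l z.1 := hl.comp Primrec.fst
  have hdr : Primrec fun z : α × ℕ => (ρ z.1).drop z.2 := Primrec.list_drop.comp Primrec.snd hρ'
  exact pr_all (pr_range (Primrec.succ.comp (Primrec.list_length.comp hρ)))
    (pr_or (pr_not (pr_anc1 hdr hρ'))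
      (pr_lt (Primrec.nat_add.comp (Primrec.encode.comp hρ') (pr_nn hl' hρ')) (pr_PP hl' hdr)))

theorem pr_inW {q x s : α → ℕ} (hq : Primrec q) (hx : Primrec x) (hs : Primrec s) :
    Primrec fun a => inW (q a) (x a) (s a) :=
  pr_and (pr_le (pr_u2 hq) hx) (pr_stg (pr_u1 hq) hx hs)

theorem pr_active {j q s : α → ℕ} {l : α → Log} (hj : Primrec j) (hq : Primrec q) (hs : Primrec s)
    (hl : Primrec l) : Primrec fun a => active (j a) (q a) (s a) (l a) :=
  pr_all (pr_range hs) (pr_or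
    (pr_not (pr_inW (hq.comp Primrec.fst) Primrec.snd (hs.comp Primrec.fst)))
    (pr_and (pr_not (pr_stg (hj.comp Primrec.fst) Primrec.snd (hs.comp Primrec.fst)))
      (pr_not (pr_has (Primrec.const 4) Primrec.snd (hl.comp Primrec.fst)))))

theorem pr_declared {j L y s : α → ℕ} {l : α → Log} (hj : Primrec j) (hL : Primrec L)
    (hy : Primrec y) (hl : Primrec l) (hs : Primrec s) :
    Primrec fun a => declared (j a) (L a) (y a) (l a) (s a) :=
  pr_any (pr_range (Primrec.succ.comp hL))
    (pr_and (pr_inW Primrec.snd (hy.comp Primrec.fst) (hs.comp Primrec.fst))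
      (pr_active (hj.comp Primrec.fst) Primrec.snd (hs.comp Primrec.fst) (hl.comp Primrec.fst)))

theorem pr_halts {s k z : α → ℕ} (hs : Primrec s) (hk : Primrec k) (hz : Primrec z) :
    Primrec fun a => halts (s a) (k a) (z a) := by
  have h : Primrec fun a => Nat.Partrec.Code.evaln (s a) (Denumerable.ofNat Code (k a)) (z a) :=
    Nat.Partrec.Code.primrec_evaln.comp
      (Primrec.pair (Primrec.pair hs ((Primrec.ofNat Code).comp hk)) hz)
  exact Primrec.option_getD.comp
    (Primrec.option_map h (pr_lt Primrec.snd (hs.comp Primrec.fst))) (Primrec.const false)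

theorem pr_conv {ρ : α → Node} {y s : α → ℕ} {l : α → Log} (hρ : Primrec ρ)
    (hy : Primrec y) (hl : Primrec l) (hs : Primrec s) :
    Primrec fun a => conv (ρ a) (y a) (l a) (s a) :=
  pr_any hl (pr_and (pr_and (pr_beq (pr_evt Primrec.snd) (Primrec.const 1))
    (pr_beq (pr_evy Primrec.snd) (hy.comp Primrec.fst)))
    (pr_halts (hs.comp Primrec.fst) (Primrec.list_length.comp (hρ.comp Primrec.fst))
      (pr_pair (hy.comp Primrec.fst) (pr_evs Primrec.snd))))

theorem pr_node {s : α → ℕ} (hs : Primrec s) : Primrec fun a => node (s a) :=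
  (Primrec.ofNat (List ℕ)).comp (pr_u1 hs)

theorem pr_stepA {j : α → ℕ} {l : α → Log} {ρ : α → Node} (hj : Primrec j) (hl : Primrec l)
    (hρ : Primrec ρ) : Primrec fun a => stepA (j a) (l a) (ρ a) := by
  have hs : Primrec fun a => (l a).length := Primrec.list_length.comp hl
  have he : Primrec fun a => epoch (l a) (ρ a) := pr_epoch hl hρ
  have hn : Primrec fun a => nn (l a) (ρ a) := pr_nn hl hρ
  have hb : Primrec fun a => bnd (l a) (ρ a) :=
    Primrec.nat_add.comp he (Primrec.encode.comp hρ)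
  have h1 : Primrec fun a => elt1 (l a) (ρ a) :=
    pr_mk hρ he (pr_u1 (Primrec.nat_sub.comp hn (Primrec.const 1)))
  have h0 : Primrec fun a => elt0 (l a) (ρ a) := pr_mk hρ he (pr_u1 hn)
  have hev : ∀ (t : ℕ) {e : α → ℕ}, Primrec e →
      Primrec fun a => ((t, e a, (l a).length) : Ev) := fun t e he =>
    Primrec.pair (Primrec.const t) (Primrec.pair he hs)
  have hR : Primrec fun a => stepR (j a) (l a) (ρ a) :=
    pr_ite (pr_declared hj hb h1 hl hs) (hev 2 h1)
      (pr_ite (pr_conv hρ h1 hl hs) (hev 3 h1) (hev 5 h1))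
  have hN : Primrec fun a => stepN (j a) (l a) (ρ a) :=
    pr_ite (pr_or (pr_or (pr_has (Primrec.const 1) h0 hl) (pr_has (Primrec.const 4) h0 hl))
      (pr_not (pr_halts hs (pr_dd h0) h0))) (hev 0 h0)
      (pr_ite (pr_declared hj hb h0 hl hs) (hev 4 h0) (hev 1 h0))
  exact pr_ite (pr_and (pr_has (Primrec.const 1) h1 hl) (pr_not (pr_inB h1 hl))) hR
    (pr_ite (pr_perm hl hρ) hN (hev 5 h0))

theorem pr_lg0 : Primrec fun q : ℕ × ℕ => lg q.1 q.2 := by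
  have h := Primrec.nat_rec' (α := ℕ × ℕ) (β := Log) (f := fun q => q.2) (g := fun _ => [])
    (h := fun q p => p.2 ++ [step q.1 p.2]) Primrec.snd (Primrec.const []) ?_
  · refine h.of_eq fun q => ?_
    induction q.2 with
    | zero => rfl
    | succ n ih => simp only [lg, ← ih]
  · have hl : Primrec fun z : (ℕ × ℕ) × (ℕ × Log) => z.2.2 := Primrec.snd.comp Primrec.snd
    have hst : Primrec fun z : (ℕ × ℕ) × (ℕ × Log) => step z.1.1 z.2.2 :=
      pr_stepA (Primrec.fst.comp Primrec.fst) hl (pr_node (Primrec.list_length.comp hl))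
    exact Primrec.list_concat.comp hl hst

theorem pr_lg {j s : α → ℕ} (hj : Primrec j) (hs : Primrec s) :
    Primrec fun a => lg (j a) (s a) := pr_lg0.comp (Primrec.pair hj hs)

theorem pr_G {j s : α → ℕ} (hj : Primrec j) (hs : Primrec s) :
    Primrec fun a => G (j a) (s a) := by
  have hl := pr_lg hj hs
  exact pr_stepA hj hl (pr_node (Primrec.list_length.comp hl))

end primrecDefs
end OS


namespace OS

theorem lg_length (j s : ℕ) : (lg j s).length = s := by
  induction s with
  | zero => rfl
  | succ n ih => simp [lg, ih]

theorem lg_succ (j s : ℕ) : lg j (s+1) = lg j s ++ [G j s] := rfl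

theorem mem_lg {j s : ℕ} {ev : Ev} : ev ∈ lg j s ↔ ∃ u < s, G j u = ev := by
  induction s with
  | zero => simp [lg]
  | succ n ih =>
    rw [lg_succ, List.mem_append, ih, List.mem_singleton]
    constructor
    · rintro (⟨u, hu, rfl⟩ | rfl)
      · exact ⟨u, by omega, rfl⟩
      · exact ⟨n, by omega, rfl⟩
    · rintro ⟨u, hu, rfl⟩
      rcases Nat.lt_succ_iff_lt_or_eq.1 hu with h | rfl
      · exact Or.inl ⟨u, h, rfl⟩
      · exact Or.inr rfl

theorem has_iff {j s t y : ℕ} :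
    has t y (lg j s) = true ↔ ∃ u < s, (G j u).1 = t ∧ (G j u).2.1 = y := by
  unfold has
  simp only [List.any_eq_true, mem_lg, Bool.and_eq_true, beq_iff_eq]
  constructor
  · rintro ⟨ev, ⟨u, hu, rfl⟩, h⟩; exact ⟨u, hu, h⟩
  · rintro ⟨u, hu, h⟩; exact ⟨_, ⟨u, hu, rfl⟩, h⟩

theorem has_mono {j s s' t y : ℕ} (hs : s ≤ s') (h : has t y (lg j s) = true) :
    has t y (lg j s') = true := by
  rw [has_iff] at *
  obtain ⟨u, hu, h⟩ := h
  exact ⟨u, by omega, h⟩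

theorem inB_iff {j s y : ℕ} :
    inB y (lg j s) = true ↔ ∃ u < s, ((G j u).1 = 2 ∨ (G j u).1 = 3) ∧ (G j u).2.1 = y := by
  unfold inB
  rw [Bool.or_eq_true, has_iff, has_iff]
  constructor
  · rintro (⟨u, hu, h1, h2⟩ | ⟨u, hu, h1, h2⟩)
    · exact ⟨u, hu, Or.inl h1, h2⟩
    · exact ⟨u, hu, Or.inr h1, h2⟩
  · rintro ⟨u, hu, h1 | h1, h2⟩
    · exact Or.inl ⟨u, hu, h1, h2⟩
    · exact Or.inr ⟨u, hu, h1, h2⟩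

theorem inB_mono {j s s' y : ℕ} (hs : s ≤ s') (h : inB y (lg j s) = true) :
    inB y (lg j s') = true := by
  rw [inB_iff] at *
  obtain ⟨u, hu, h⟩ := h
  exact ⟨u, by omega, h⟩

/-! counting -/

theorem cnt_succ (j s : ℕ) (p : Ev → Bool) :
    (lg j (s+1)).countP p = (lg j s).countP p + (if p (G j s) = true then 1 else 0) := by
  rw [lg_succ, List.countP_append]; simp [List.countP_cons]

theorem cnt_mono {j : ℕ} (p : Ev → Bool) {s t : ℕ} (h : s ≤ t) :
    (lg j s).countP p ≤ (lg j t).countP p := by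
  induction t, h using Nat.le_induction with
  | base => exact le_rfl
  | succ n _ ih => rw [cnt_succ]; omega

theorem cnt_lt {j : ℕ} (p : Ev → Bool) {u t : ℕ} (h : u < t) (hp : p (G j u) = true) :
    (lg j u).countP p < (lg j t).countP p := by
  have := cnt_mono (j := j) p (show u+1 ≤ t from h)
  rw [cnt_succ] at this
  simp [hp] at this
  omega

theorem cnt_unb {j : ℕ} (p : Ev → Bool) (h : {s | p (G j s) = true}.Infinite) (r : ℕ) :
    ∃ s, r < (lg j s).countP p := by
  induction r with
  | zero =>
    obtain ⟨u, hu⟩ := h.nonempty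
    have := cnt_lt p (show u < u+1 by omega) hu
    exact ⟨u+1, by omega⟩
  | succ r ih =>
    obtain ⟨s, hs⟩ := ih
    obtain ⟨u, hu, hsu⟩ := h.exists_gt s
    have h1 := cnt_lt p (show u < u+1 by omega) hu
    have h2 := cnt_mono (j := j) p (show s ≤ u by omega)
    exact ⟨u+1, by omega⟩

theorem cnt_const {j : ℕ} (p : Ev → Bool) (h : {s | p (G j s) = true}.Finite) :
    ∃ s0, ∀ s, s0 ≤ s → (lg j s).countP p = (lg j s0).countP p := by
  obtain ⟨b, hb⟩ := h.bddAbove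
  refine ⟨b+1, fun s hs => ?_⟩
  induction s, hs using Nat.le_induction with
  | base => rfl
  | succ n hn ih =>
    rw [cnt_succ, ih]
    have : ¬ p (G j n) = true := fun hp => by
      have := hb hp
      omega
    simp [this]

theorem cnt_bdd {j : ℕ} (p : Ev → Bool) (h : {s | p (G j s) = true}.Finite) :
    ∃ M, ∀ s, (lg j s).countP p < M := by
  obtain ⟨s0, h0⟩ := cnt_const p h
  refine ⟨(lg j s0).countP p + 1, fun s => ?_⟩
  rcases le_total s s0 with h1 | h1
  · have := cnt_mono (j := j) p h1
    omega
  · rw [h0 s h1]; omega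

theorem cnt_hit {j : ℕ} (p : Ev → Bool) (h : ∀ r, ∃ s, r < (lg j s).countP p) (k : ℕ) :
    ∃ s, p (G j s) = true ∧ (lg j s).countP p = k := by
  classical
  have hk := h k
  have h1 := Nat.find_spec hk
  have h2 := fun m => Nat.find_min hk (m := m)
  generalize Nat.find hk = n at *
  cases n with
  | zero => simp [lg] at h1
  | succ n =>
    have h3 := h2 n (by omega)
    have h4 := cnt_succ j n p
    split_ifs at h4 with hp
    · exact ⟨n, hp, by omega⟩
    · omega

/-! case analysis of a step -/

theorem G_all (j s : ℕ) :
    (G j s).2.2 = s ∧ nd (G j s).2.1 = node s ∧ rr (G j s).2.1 = epoch (lg j s) (node s) := by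
  unfold G step
  rw [lg_length]
  unfold stepA stepR stepN
  simp only [lg_length]
  split_ifs <;> simp [elt0, elt1]

theorem G_stage (j s : ℕ) : (G j s).2.2 = s := (G_all j s).1
theorem G_node (j s : ℕ) : nd (G j s).2.1 = node s := (G_all j s).2.1
theorem G_rr (j s : ℕ) : rr (G j s).2.1 = epoch (lg j s) (node s) := (G_all j s).2.2

theorem G_run {j s : ℕ} (h : running (lg j s) (node s) = true) :
    (G j s).2.1 = elt1 (lg j s) (node s) ∧
    (((G j s).1 = 2 ∧ declared j (bnd (lg j s) (node s)) (elt1 (lg j s) (node s)) (lg j s) s = true)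
    ∨ ((G j s).1 = 3 ∧ declared j (bnd (lg j s) (node s)) (elt1 (lg j s) (node s)) (lg j s) s = false
        ∧ conv (node s) (elt1 (lg j s) (node s)) (lg j s) s = true)
    ∨ ((G j s).1 = 5 ∧ declared j (bnd (lg j s) (node s)) (elt1 (lg j s) (node s)) (lg j s) s = false
        ∧ conv (node s) (elt1 (lg j s) (node s)) (lg j s) s = false)) := by
  unfold G step
  rw [lg_length]
  unfold stepA stepR
  simp only [lg_length, h, if_true]
  split_ifs <;> simp_all

theorem G_nrun {j s : ℕ} (h : running (lg j s) (node s) = false) :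
    (G j s).2.1 = elt0 (lg j s) (node s) ∧
    (((G j s).1 = 5 ∧ perm (lg j s) (node s) = false) ∨
    (perm (lg j s) (node s) = true ∧ (((G j s).1 = 0 ∧
      (has 1 (elt0 (lg j s) (node s)) (lg j s) = true ∨ has 4 (elt0 (lg j s) (node s)) (lg j s) = true
        ∨ halts s (dd (elt0 (lg j s) (node s))) (elt0 (lg j s) (node s)) = false)) ∨
      (((G j s).1 = 4 ∧ declared j (bnd (lg j s) (node s)) (elt0 (lg j s) (node s)) (lg j s) s = true
        ∨ (G j s).1 = 1 ∧
          declared j (bnd (lg j s) (node s)) (elt0 (lg j s) (node s)) (lg j s) s = false) ∧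
        has 1 (elt0 (lg j s) (node s)) (lg j s) = false ∧
        has 4 (elt0 (lg j s) (node s)) (lg j s) = false ∧
        halts s (dd (elt0 (lg j s) (node s))) (elt0 (lg j s) (node s)) = true)))) := by
  unfold G step
  rw [lg_length]
  unfold stepA stepN
  simp only [lg_length, h]
  rw [if_neg (by simp)]
  by_cases hp : perm (lg j s) (node s) = true
  · rw [if_pos hp]
    simp only [hp]
    split_ifs with h1 h2
    · simp only [Bool.or_eq_true, Bool.not_eq_true', or_assoc] at h1
      exact ⟨rfl, Or.inr ⟨trivial, Or.inl ⟨rfl, h1⟩⟩⟩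
    · simp only [Bool.or_eq_true, Bool.not_eq_true', not_or, Bool.not_eq_true, Bool.not_eq_false] at h1
      exact ⟨rfl, Or.inr ⟨trivial, Or.inr ⟨Or.inl ⟨rfl, h2⟩, h1.1.1, h1.1.2, h1.2⟩⟩⟩
    · simp only [Bool.or_eq_true, Bool.not_eq_true', not_or, Bool.not_eq_true, Bool.not_eq_false] at h1
      rw [Bool.not_eq_true] at h2
      exact ⟨rfl, Or.inr ⟨trivial, Or.inr ⟨Or.inr ⟨rfl, h2⟩, h1.1.1, h1.1.2, h1.2⟩⟩⟩
  · rw [if_neg hp]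
    rw [Bool.not_eq_true] at hp
    exact ⟨rfl, Or.inl ⟨rfl, hp⟩⟩

theorem G_act {j s : ℕ} (h : (G j s).1 = 2 ∨ (G j s).1 = 3) :
    running (lg j s) (node s) = true := by
  by_contra hc
  rw [Bool.not_eq_true] at hc
  have := (G_nrun hc).2
  rcases this with ⟨h1, _⟩ | ⟨_, ⟨h1, _⟩ | ⟨⟨h1, _⟩ | ⟨h1, _⟩, _⟩⟩ <;> omega

theorem G_isN {j s : ℕ} (h : (G j s).1 = 0 ∨ (G j s).1 = 1 ∨ (G j s).1 = 4) :
    running (lg j s) (node s) = false := by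
  by_contra hc
  rw [Bool.not_eq_false] at hc
  have := (G_run hc).2
  rcases this with ⟨h1, _⟩ | ⟨h1, _⟩ | ⟨h1, _⟩ <;> omega

theorem node_nd {j s y : ℕ} (h : (G j s).2.1 = y) : node s = nd y := by rw [← h, G_node]

theorem act_facts {j s y : ℕ} (h : (G j s).1 = 2 ∨ (G j s).1 = 3) (hy : (G j s).2.1 = y) :
    has 1 y (lg j s) = true ∧ inB y (lg j s) = false ∧ elt1 (lg j s) (nd y) = y
      ∧ rr y = epoch (lg j s) (nd y) := by
  have h1 := G_act h
  have h2 := (G_run h1).1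
  have h3 := G_rr j s
  have hn := node_nd hy
  rw [hn] at h1 h2 h3
  rw [hy] at h2 h3
  unfold running at h1
  rw [← h2] at h1
  simp at h1
  exact ⟨h1.1, h1.2, h2.symm, h3⟩

theorem start_facts {j s y : ℕ} (h : (G j s).1 = 1) (hy : (G j s).2.1 = y) :
    has 1 y (lg j s) = false ∧ has 4 y (lg j s) = false ∧ elt0 (lg j s) (nd y) = y
      ∧ rr y = epoch (lg j s) (nd y) ∧ perm (lg j s) (nd y) = true ∧ halts s (dd y) y = true
      ∧ declared j (bnd (lg j s) (nd y)) y (lg j s) s = false := by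
  have h1 := G_isN (j := j) (s := s) (by omega)
  have h2 := G_nrun h1
  have h3 := G_rr j s
  have hn := node_nd hy
  rw [hn] at h1 h2 h3
  rw [hy] at h2 h3
  obtain ⟨h2, h4⟩ := h2
  rw [← h2] at h4
  rcases h4 with ⟨h4, _⟩ | ⟨hp, ⟨h4, _⟩ | ⟨⟨h4, _⟩ | ⟨h4, h5⟩, h6, h7, h8⟩⟩
  · omega
  · omega
  · omega
  · exact ⟨h6, h7, h2.symm, h3, hp, h8, h5⟩

theorem cancel_facts {j s y : ℕ} (h : (G j s).1 = 4) (hy : (G j s).2.1 = y) :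
    has 1 y (lg j s) = false ∧ has 4 y (lg j s) = false ∧ elt0 (lg j s) (nd y) = y
      ∧ rr y = epoch (lg j s) (nd y)
      ∧ declared j (bnd (lg j s) (nd y)) y (lg j s) s = true := by
  have h1 := G_isN (j := j) (s := s) (by omega)
  have h2 := G_nrun h1
  have h3 := G_rr j s
  have hn := node_nd hy
  rw [hn] at h1 h2 h3
  rw [hy] at h2 h3
  obtain ⟨h2, h4⟩ := h2
  rw [← h2] at h4
  rcases h4 with ⟨h4, _⟩ | ⟨hp, ⟨h4, _⟩ | ⟨⟨h4, h5⟩ | ⟨h4, h5⟩, h6, h7, h8⟩⟩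
  · omega
  · omega
  · exact ⟨h6, h7, h2.symm, h3, h5⟩
  · omega

def isAct (ev : Ev) : Prop := ev.1 = 2 ∨ ev.1 = 3

def Bset (j : ℕ) : Set ℕ := {y | ∃ s, isAct (G j s) ∧ (G j s).2.1 = y}
def Canc (j : ℕ) : Set ℕ := {y | ∃ s, (G j s).1 = 4 ∧ (G j s).2.1 = y}

theorem mem_Bset_iff {j y : ℕ} : y ∈ Bset j ↔ ∃ s, inB y (lg j s) = true := by
  constructor
  · rintro ⟨s, h, h'⟩
    exact ⟨s+1, inB_iff.2 ⟨s, by omega, h, h'⟩⟩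
  · rintro ⟨s, hs⟩
    obtain ⟨u, _, h⟩ := inB_iff.1 hs
    exact ⟨u, h⟩

theorem act_unique {j s s' y : ℕ} (h : isAct (G j s)) (hy : (G j s).2.1 = y)
    (h' : isAct (G j s')) (hy' : (G j s').2.1 = y) : s = s' := by
  by_contra hc
  rcases lt_or_gt_of_ne hc with hl | hl
  · have := (act_facts h' hy').2.1
    rw [inB_iff.2 ⟨s, hl, h, hy⟩] at this
    simp at this
  · have := (act_facts h hy).2.1
    rw [inB_iff.2 ⟨s', hl, h', hy'⟩] at this
    simp at this

theorem start_unique {j s s' y : ℕ} (h : (G j s).1 = 1) (hy : (G j s).2.1 = y)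
    (h' : (G j s').1 = 1) (hy' : (G j s').2.1 = y) : s = s' := by
  by_contra hc
  rcases lt_or_gt_of_ne hc with hl | hl
  · have := (start_facts h' hy').1
    rw [has_iff.2 ⟨s, hl, h, hy⟩] at this
    simp at this
  · have := (start_facts h hy).1
    rw [has_iff.2 ⟨s', hl, h', hy'⟩] at this
    simp at this

theorem act_start {j s y : ℕ} (h : isAct (G j s)) (hy : (G j s).2.1 = y) :
    ∃ u < s, (G j u).1 = 1 ∧ (G j u).2.1 = y := has_iff.1 (act_facts h hy).1

theorem canc_not_mem {j y : ℕ} (h : y ∈ Canc j) : y ∉ Bset j := by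
  obtain ⟨s, h4, hy⟩ := h
  rintro ⟨t, ht, hty⟩
  obtain ⟨u, _, hu, huy⟩ := act_start ht hty
  rcases lt_trichotomy s u with hl | rfl | hl
  · have := (start_facts hu huy).2.1
    rw [has_iff.2 ⟨s, hl, h4, hy⟩] at this
    simp at this
  · omega
  · have := (cancel_facts h4 hy).1
    rw [has_iff.2 ⟨u, hl, hu, huy⟩] at this
    simp at this

theorem epoch_mono {j s t : ℕ} (ρ : Node) (h : s ≤ t) : epoch (lg j s) ρ ≤ epoch (lg j t) ρ :=
  cnt_mono _ h

theorem isN_iff {ρ : Node} {ev : Ev} :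
    isN ρ ev = true ↔ (ev.1 = 0 ∨ ev.1 = 1 ∨ ev.1 = 4) ∧ nd ev.2.1 = ρ := by
  unfold isN; simp [or_assoc]

/-- a started element stays the current one until it acts or the epoch changes -/
theorem run_facts {j u y s : ℕ} (h : (G j u).1 = 1) (hy : (G j u).2.1 = y) (hs : u < s)
    (he : epoch (lg j s) (nd y) = epoch (lg j u) (nd y)) (hB : inB y (lg j s) = false) :
    elt1 (lg j s) (nd y) = y ∧ running (lg j s) (nd y) = true := by
  have key : nn (lg j s) (nd y) = nn (lg j u) (nd y) + 1 ∧
      elt1 (lg j s) (nd y) = y ∧ running (lg j s) (nd y) = true := by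
    have aux : ∀ s, u < s → epoch (lg j s) (nd y) = epoch (lg j u) (nd y) →
        inB y (lg j s) = false → nn (lg j s) (nd y) = nn (lg j u) (nd y) + 1 →
        elt1 (lg j s) (nd y) = y ∧ running (lg j s) (nd y) = true := by
      intro s hs he hB hn
      have h1 : elt1 (lg j s) (nd y) = y := by
        unfold elt1
        rw [hn, he]
        exact (start_facts h hy).2.2.1
      refine ⟨h1, ?_⟩
      unfold running
      rw [h1, hB, has_iff.2 ⟨u, hs, h, hy⟩]
      rfl
    induction s, hs using Nat.le_induction with
    | base =>
      have hn : nn (lg j (u+1)) (nd y) = nn (lg j u) (nd y) + 1 := by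
        unfold nn
        rw [cnt_succ, if_pos (isN_iff.2 ⟨by omega, by rw [hy]⟩)]
      exact ⟨hn, aux _ (Nat.lt_succ_self u) he hB hn⟩
    | succ n hn ih =>
      have hn' : u < n := hn
      have he' : epoch (lg j n) (nd y) = epoch (lg j u) (nd y) := by
        have h1 := epoch_mono (j := j) (nd y) (show n ≤ n+1 by omega)
        have h2 := epoch_mono (j := j) (nd y) (show u ≤ n by omega)
        omega
      have hB' : inB y (lg j n) = false := by
        by_contra hc
        rw [Bool.not_eq_false] at hc
        rw [inB_mono (show n ≤ n+1 by omega) hc] at hB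
        simp at hB
      obtain ⟨i1, i2, i3⟩ := ih he' hB'
      have hnn : nn (lg j (n+1)) (nd y) = nn (lg j u) (nd y) + 1 := by
        rw [← i1]
        unfold nn
        rw [cnt_succ, if_neg]
        · rfl
        intro hc
        obtain ⟨c1, c2⟩ := isN_iff.1 hc
        rw [G_node] at c2
        have := G_isN c1
        rw [c2, i3] at this
        simp at this
      exact ⟨hnn, aux _ (by omega) he hB hnn⟩
  exact key.2

end OS


namespace OS

theorem anc1_iff {τ ρ : Node} : anc1 τ ρ = true ↔ ∃ b, b ≠ 0 ∧ b :: τ <:+ ρ := by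
  induction ρ with
  | nil => simp [anc1]
  | cons c t ih =>
    simp only [anc1, Bool.or_eq_true, ih, Bool.and_eq_true, Bool.not_eq_true', beq_iff_eq,
      beq_eq_false_iff_ne, List.suffix_cons_iff]
    constructor
    · rintro (⟨h, rfl⟩ | ⟨b, h, h'⟩)
      · exact ⟨c, h, Or.inl rfl⟩
      · exact ⟨b, h, Or.inr h'⟩
    · rintro ⟨b, h, h' | h'⟩
      · obtain ⟨rfl, rfl⟩ := List.cons.inj h'
        exact Or.inl ⟨h, rfl⟩
      · exact Or.inr ⟨b, h, h'⟩

theorem anc0_iff {τ ρ : Node} : anc0 τ ρ = true ↔ ∃ b, b ≠ 1 ∧ b :: τ <:+ ρ := by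
  induction ρ with
  | nil => simp [anc0]
  | cons c t ih =>
    simp only [anc0, Bool.or_eq_true, ih, Bool.and_eq_true, Bool.not_eq_true', beq_iff_eq,
      beq_eq_false_iff_ne, List.suffix_cons_iff]
    constructor
    · rintro (⟨h, rfl⟩ | ⟨b, h, h'⟩)
      · exact ⟨c, h, Or.inl rfl⟩
      · exact ⟨b, h, Or.inr h'⟩
    · rintro ⟨b, h, h' | h'⟩
      · obtain ⟨rfl, rfl⟩ := List.cons.inj h'
        exact Or.inl ⟨h, rfl⟩
      · exact Or.inr ⟨b, h, h'⟩

theorem anc_suffix {τ ρ : Node} {b : ℕ} (h : b :: τ <:+ ρ) : τ <:+ ρ :=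
  (List.suffix_cons b τ).trans h

theorem anc1_suffix {τ ρ : Node} (h : anc1 τ ρ = true) : τ <:+ ρ := by
  obtain ⟨b, _, h⟩ := anc1_iff.1 h
  exact anc_suffix h
theorem anc0_suffix {τ ρ : Node} (h : anc0 τ ρ = true) : τ <:+ ρ := by
  obtain ⟨b, _, h⟩ := anc0_iff.1 h
  exact anc_suffix h

theorem finite_suffix (ρ : Node) : {τ : Node | τ <:+ ρ}.Finite := by
  refine (List.finite_toSet ρ.tails).subset ?_
  intro τ h
  exact (List.mem_tails _ _).2 h

theorem list_compare (ρ σ : Node) : ρ = σ ∨ (∃ b, b :: ρ <:+ σ) ∨ (∃ b, b :: σ <:+ ρ) ∨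
    ∃ τ b b', b ≠ b' ∧ b :: τ <:+ σ ∧ b' :: τ <:+ ρ := by
  induction ρ with
  | nil =>
    rcases List.eq_nil_or_concat σ with rfl | ⟨l, b, rfl⟩
    · exact Or.inl rfl
    · exact Or.inr (Or.inl ⟨b, by simp⟩)
  | cons c t ih =>
    rcases ih with rfl | ⟨b, h⟩ | ⟨b, h⟩ | ⟨τ, b, b', h1, h2, h3⟩
    · exact Or.inr (Or.inr (Or.inl ⟨c, List.suffix_rfl⟩))
    · by_cases hbc : b = c
      · subst hbc
        obtain ⟨l, rfl⟩ := h
        rcases List.eq_nil_or_concat l with rfl | ⟨l', b', rfl⟩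
        · exact Or.inl rfl
        · refine Or.inr (Or.inl ⟨b', l', ?_⟩)
          simp
      · exact Or.inr (Or.inr (Or.inr ⟨t, b, c, hbc, h, List.suffix_rfl⟩))
    · exact Or.inr (Or.inr (Or.inl ⟨b, h.trans (List.suffix_cons c t)⟩))
    · exact Or.inr (Or.inr (Or.inr ⟨τ, b, b', h1, h2, h3.trans (List.suffix_cons c t)⟩))

/-! activity sets -/

def Acts (j : ℕ) (τ : Node) : Set ℕ := {s | isAct (G j s) ∧ node s = τ}
def Prog (j : ℕ) (τ : Node) : Set ℕ := {s | (G j s).1 = 3 ∧ node s = τ}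
def Unb (j : ℕ) (ρ : Node) : Prop := ∀ r, ∃ s, r < epoch (lg j s) ρ

theorem Prog_sub (j τ) : Prog j τ ⊆ Acts j τ := fun _ h => ⟨Or.inr h.1, h.2⟩

theorem isE_iff {j s : ℕ} {ρ : Node} : isE ρ (G j s) = true ↔
    s ∈ Prog j ρ ∨ ∃ τ, anc0 τ ρ = true ∧ s ∈ Acts j τ := by
  unfold isE Prog Acts isAct
  rw [G_node]
  simp only [Bool.or_eq_true, Bool.and_eq_true, beq_iff_eq, Set.mem_ofPred_eq]
  constructor
  · rintro (h | h)
    · exact Or.inl h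
    · exact Or.inr ⟨_, h.2, h.1, rfl⟩
  · rintro (h | ⟨τ, h1, h2, rfl⟩)
    · exact Or.inl h
    · exact Or.inr ⟨h2, h1⟩

theorem isP_iff {j s : ℕ} {ρ : Node} : isP ρ (G j s) = true ↔ s ∈ Prog j ρ := by
  unfold isP Prog
  rw [G_node]
  simp

theorem unb_of_prog {j : ℕ} {ρ : Node} (h : (Prog j ρ).Infinite) : Unb j ρ :=
  cnt_unb _ (h.mono fun _ hs => isE_iff.2 (Or.inl hs))

theorem unb_of_anc0 {j : ℕ} {τ ρ : Node} (ha : anc0 τ ρ = true) (h : (Acts j τ).Infinite) :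
    Unb j ρ :=
  cnt_unb _ (h.mono fun _ hs => isE_iff.2 (Or.inr ⟨τ, ha, hs⟩))

theorem PP_unb {j : ℕ} {τ : Node} (h : (Prog j τ).Infinite) (r : ℕ) :
    ∃ s, r < PP (lg j s) τ :=
  cnt_unb _ (h.mono fun _ hs => isP_iff.2 hs) r

theorem PP_bdd {j : ℕ} {τ : Node} (h : (Prog j τ).Finite) : ∃ M, ∀ s, PP (lg j s) τ < M :=
  cnt_bdd _ (h.subset fun _ hs => isP_iff.1 hs)

structure OnPath (j : ℕ) (σ : Node) : Prop where
  one : ∀ τ, anc1 τ σ = true → (Prog j τ).Infinite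
  zero : ∀ τ, anc0 τ σ = true → (Acts j τ).Finite

theorem epoch_const {j : ℕ} {σ : Node} (h0 : ∀ τ, anc0 τ σ = true → (Acts j τ).Finite)
    (h : (Prog j σ).Finite) :
    ∃ s0, ∀ s, s0 ≤ s → epoch (lg j s) σ = epoch (lg j s0) σ := by
  apply cnt_const
  have h1 : (⋃ τ ∈ {τ : Node | τ <:+ σ}, {s | anc0 τ σ = true ∧ s ∈ Acts j τ}).Finite := by
    refine (finite_suffix σ).biUnion fun τ _ => ?_
    by_cases ha : anc0 τ σ = true
    · exact (h0 τ ha).subset fun s hs => hs.2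
    · exact Set.finite_empty.subset fun s hs => (ha hs.1).elim
  refine (h.union h1).subset ?_
  intro s hs
  rcases isE_iff.1 hs with h2 | ⟨τ, h2, h3⟩
  · exact Or.inl h2
  · right
    simp only [Set.mem_iUnion]
    exact ⟨τ, anc0_suffix h2, h2, h3⟩

theorem perm_iff {l : Log} {ρ : Node} : perm l ρ = true ↔
    ∀ τ, anc1 τ ρ = true → Encodable.encode ρ + nn l ρ < PP l τ := by
  unfold perm
  simp only [List.all_eq_true, List.mem_range, Bool.or_eq_true, Bool.not_eq_true',
    decide_eq_true_eq]
  constructor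
  · intro h τ hτ
    obtain ⟨l', rfl⟩ := anc1_suffix hτ
    have := h l'.length (by simp)
    rw [List.drop_left] at this
    rcases this with h1 | h1
    · simp [hτ] at h1
    · exact h1
  · intro h i _
    by_cases ha : anc1 (ρ.drop i) ρ = true
    · exact Or.inr (h _ ha)
    · exact Or.inl (by simpa using ha)

/-- the acts of a node inject into the started elements -/
theorem B_node_finite {j : ℕ} {ρ : Node} (h : (Acts j ρ).Finite) :
    {y | y ∈ Bset j ∧ nd y = ρ}.Finite := by
  refine (h.image fun s => (G j s).2.1).subset ?_
  rintro y ⟨⟨s, hs, hy⟩, hn⟩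
  exact ⟨s, ⟨hs, by rw [node_nd hy, hn]⟩, hy⟩

theorem acts_finite_of_B {j : ℕ} {ρ : Node} (h : {y | y ∈ Bset j ∧ nd y = ρ}.Finite) :
    (Acts j ρ).Finite := by
  refine Set.Finite.of_finite_image (f := fun s => (G j s).2.1) (h.subset ?_) ?_
  · rintro _ ⟨s, ⟨hs, hn⟩, rfl⟩
    exact ⟨⟨s, hs, rfl⟩, by rw [G_node, hn]⟩
  · rintro s ⟨hs, _⟩ s' ⟨hs', _⟩ he
    exact act_unique hs rfl hs' he.symm

theorem B_unb_finite {j : ℕ} {ρ : Node} (h : Unb j ρ) (r : ℕ) :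
    {y | y ∈ Bset j ∧ nd y = ρ ∧ rr y = r}.Finite := by
  obtain ⟨s1, hs1⟩ := h r
  refine ((Set.finite_lt_nat s1).image fun s => (G j s).2.1).subset ?_
  rintro y ⟨⟨s, hs, hy⟩, hn, hr⟩
  refine ⟨s, ?_, hy⟩
  have h1 := (act_facts hs hy).2.2.2
  rw [hr, hn] at h1
  by_contra hc
  have := epoch_mono (j := j) ρ (show s1 ≤ s from not_lt.1 hc)
  omega

theorem perm_finite {j : ℕ} {τ : Node} (h : (Prog j τ).Finite) :
    {y | y ∈ Bset j ∧ anc1 τ (nd y) = true}.Finite := by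
  obtain ⟨M, hM⟩ := PP_bdd h
  have hS : {u | (G j u).1 = 1 ∧ anc1 τ (node u) = true}.Finite := by
    refine Set.Finite.of_finite_image
      (f := fun u => (Encodable.encode (node u), nn (lg j u) (node u)))
      (((Set.finite_lt_nat M).prod (Set.finite_lt_nat M)).subset ?_) ?_
    · rintro _ ⟨u, ⟨hu, ha⟩, rfl⟩
      have := (start_facts hu rfl).2.2.2.2.1
      rw [G_node] at this
      have h1 := perm_iff.1 this τ ha
      have h2 := hM u
      exact ⟨show Encodable.encode (node u) < M by omega, show nn (lg j u) (node u) < M by omega⟩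
    · rintro u ⟨hu, _⟩ u' ⟨hu', _⟩ he
      simp only [Prod.mk.injEq, Encodable.encode_inj] at he
      obtain ⟨he1, he2⟩ := he
      by_contra hc
      rcases lt_or_gt_of_ne hc with hl | hl
      · have h1 := cnt_lt (j := j) (isN (node u)) hl (isN_iff.2 ⟨by omega, G_node j u⟩)
        unfold nn at he2
        rw [he2, ← he1] at h1
        omega
      · have h1 := cnt_lt (j := j) (isN (node u')) hl (isN_iff.2 ⟨by omega, G_node j u'⟩)
        unfold nn at he2
        rw [← he2, he1] at h1
        omega
  refine (hS.image fun u => (G j u).2.1).subset ?_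
  rintro y ⟨⟨s, hs, hy⟩, ha⟩
  obtain ⟨u, _, hu, huy⟩ := act_start hs hy
  exact ⟨u, ⟨hu, by rw [node_nd huy]; exact ha⟩, huy⟩

theorem declared_iff {j L y s : ℕ} {l : Log} : declared j L y l s = true ↔
    ∃ q ≤ L, inW q y s = true ∧ active j q s l = true := by
  unfold declared
  simp

theorem active_iff {j q s : ℕ} {l : Log} : active j q s l = true ↔
    ∀ x, inW q x s = true → stg j x s = false ∧ has 4 x l = false := by
  unfold active
  simp only [List.all_eq_true, List.mem_range, Bool.or_eq_true, Bool.not_eq_true',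
    Bool.and_eq_true]
  constructor
  · intro h x hx
    have hx' : x < s := by
      unfold inW at hx
      simp only [Bool.and_eq_true] at hx
      exact stg_lt hx.2
    rcases h x hx' with h1 | h1
    · simp [hx] at h1
    · exact h1
  · intro h x _
    by_cases hx : inW q x s = true
    · exact Or.inr (h x hx)
    · exact Or.inl (by simpa using hx)

theorem inW_mono {q x s t : ℕ} (h : s ≤ t) (hs : inW q x s = true) : inW q x t = true := by
  unfold inW at *
  simp only [Bool.and_eq_true] at *
  exact ⟨hs.1, stg_mono h hs.2⟩

theorem canc_finite (j : ℕ) (σ : Node) (r : ℕ) :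
    {y | y ∈ Canc j ∧ nd y = σ ∧ rr y = r}.Finite := by
  have hex : ∀ s, ∃ q, ((G j s).1 = 4 ∧ nd (G j s).2.1 = σ ∧ rr (G j s).2.1 = r) →
      q ≤ r + Encodable.encode σ ∧ inW q (G j s).2.1 s = true ∧ active j q s (lg j s) = true := by
    intro s
    by_cases h : ((G j s).1 = 4 ∧ nd (G j s).2.1 = σ ∧ rr (G j s).2.1 = r)
    · obtain ⟨_, _, _, h1, h2⟩ := cancel_facts h.1 rfl
      obtain ⟨q, hq, hq'⟩ := declared_iff.1 h2
      unfold bnd at hq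
      rw [← h1, h.2.1, h.2.2] at hq
      exact ⟨q, fun _ => ⟨hq, hq'⟩⟩
    · exact ⟨0, fun h' => (h h').elim⟩
  choose Q hQ using hex
  have hS : {s | (G j s).1 = 4 ∧ nd (G j s).2.1 = σ ∧ rr (G j s).2.1 = r}.Finite := by
    have key : ∀ s s', s < s' → ((G j s).1 = 4 ∧ nd (G j s).2.1 = σ ∧ rr (G j s).2.1 = r) →
        ((G j s').1 = 4 ∧ nd (G j s').2.1 = σ ∧ rr (G j s').2.1 = r) → Q s ≠ Q s' := by
      intro s s' hl h h' he
      obtain ⟨_, h2, _⟩ := hQ s h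
      obtain ⟨_, _, h3⟩ := hQ s' h'
      have h4 := (active_iff.1 h3 (G j s).2.1 (inW_mono hl.le (he ▸ h2))).2
      rw [has_iff.2 ⟨s, hl, h.1, rfl⟩] at h4
      simp at h4
    refine Set.Finite.of_finite_image (f := Q)
      ((Set.finite_le_nat (r + Encodable.encode σ)).subset ?_) ?_
    · rintro _ ⟨s, hs, rfl⟩
      exact (hQ s hs).1
    · intro s hs s' hs' he
      by_contra hc
      rcases lt_or_gt_of_ne hc with hl | hl
      · exact key s s' hl hs hs' he
      · exact key s' s hl hs' hs he.symm
  refine (hS.image fun u => (G j u).2.1).subset ?_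
  rintro y ⟨⟨s, hs, rfl⟩, hn, hr⟩
  exact ⟨s, ⟨hs, hn, hr⟩, rfl⟩

theorem fast_finite (j : ℕ) (σ : Node) (r : ℕ) :
    {y | y ∈ Wset j ∧ (∃ s, (G j s).1 = 2 ∧ (G j s).2.1 = y) ∧ nd y = σ ∧ rr y = r}.Finite := by
  have h1 : ∀ q, {y | y ∈ Wset j ∧ ∃ s, (G j s).2.1 = y ∧ inW q y s = true ∧
      active j q s (lg j s) = true}.Finite := by
    intro q
    rcases Set.eq_empty_or_nonempty {y | y ∈ Wset j ∧ ∃ s, (G j s).2.1 = y ∧ inW q y s = true ∧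
      active j q s (lg j s) = true} with he | ⟨y0, hy0, s0, _, hq0, _⟩
    · rw [he]; exact Set.finite_empty
    · obtain ⟨t0, ht0⟩ := mem_Wset_iff.1 hy0
      refine ((Set.finite_lt_nat (s0 + t0)).image fun s => (G j s).2.1).subset ?_
      rintro y ⟨_, s, hy, _, ha⟩
      refine ⟨s, ?_, hy⟩
      by_contra hc
      have hc' : s0 + t0 ≤ s := not_lt.1 hc
      have := (active_iff.1 ha y0 (inW_mono (by omega) hq0)).1
      rw [stg_mono (by omega) ht0] at this
      simp at this
  have h2 := (Set.finite_le_nat (r + Encodable.encode σ)).biUnion fun q _ => h1 q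
  refine h2.subset ?_
  rintro y ⟨hW, ⟨s, hs, hy⟩, hn, hr⟩
  have h3 := (G_run (G_act (Or.inl hs))).2
  have h4 := (act_facts (Or.inl hs) hy)
  rw [node_nd hy, h4.2.2.1] at h3
  rcases h3 with ⟨_, h3⟩ | ⟨h3, _⟩ | ⟨h3, _⟩
  · obtain ⟨q, hq, h5, h6⟩ := declared_iff.1 h3
    unfold bnd at hq
    rw [← h4.2.2.2, hn, hr] at hq
    simp only [Set.mem_iUnion]
    exact ⟨q, hq, hW, s, hy, h5, h6⟩
  · omega
  · omega

theorem halts_iff {s k z : ℕ} : halts s k z = true ↔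
    ∃ v < s, v ∈ Nat.Partrec.Code.evaln s (Denumerable.ofNat Code k) z := by
  unfold halts
  cases h : Nat.Partrec.Code.evaln s (Denumerable.ofNat Code k) z with
  | none => simp
  | some v => simp

theorem halts_mono {s t k z : ℕ} (h : s ≤ t) (hs : halts s k z = true) : halts t k z = true := by
  rw [halts_iff] at *
  obtain ⟨v, hv, hm⟩ := hs
  exact ⟨v, by omega, Nat.Partrec.Code.evaln_mono h hm⟩

theorem halts_of_eval {k z v : ℕ} (h : v ∈ (Denumerable.ofNat Code k).eval z) :
    ∃ s, halts s k z = true := by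
  obtain ⟨s, hs⟩ := Nat.Partrec.Code.evaln_complete.1 h
  refine ⟨s + v + 1, halts_iff.2 ⟨v, by omega, Nat.Partrec.Code.evaln_mono (by omega) hs⟩⟩

theorem halts_lt {s k z v : ℕ} (h : v ∈ (Denumerable.ofNat Code k).eval z)
    (hs : halts s k z = true) : v < s := by
  obtain ⟨w, hw, hm⟩ := halts_iff.1 hs
  have := Nat.Partrec.Code.evaln_sound hm
  rwa [Part.mem_unique h this]

theorem sel {j r s0 : ℕ} {σ : Node} (he : ∀ s, s0 ≤ s → epoch (lg j s) σ = r)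
    (hn : ∀ k, ∃ s, k < nn (lg j s) σ) (c : ℕ)
    (hh : ∃ s, halts s (dd (mk σ r c)) (mk σ r c) = true) :
    mk σ r c ∈ Bset j ∨ mk σ r c ∈ Canc j := by
  obtain ⟨s1, hs1⟩ := hh
  generalize hy : mk σ r c = y at *
  have hny : nd y = σ := by rw [← hy]; simp
  have hry : rr y = r := by rw [← hy]; simp
  have hstep : (∃ u, (G j u).1 = 1 ∧ (G j u).2.1 = y) ∨ y ∈ Canc j := by
    obtain ⟨s, hs, hk⟩ := cnt_hit (j := j) (isN σ) hn (Nat.pair c (nn (lg j (s0 + s1)) σ))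
    have hs2 : s0 + s1 ≤ s := by
      by_contra hc
      have h1 := cnt_lt (j := j) (isN σ) (show s < s0 + s1 by omega) hs
      rw [hk] at h1
      have := Nat.right_le_pair c (nn (lg j (s0 + s1)) σ)
      unfold nn at *
      omega
    obtain ⟨ht, hnode⟩ := isN_iff.1 hs
    rw [G_node] at hnode
    have h1 := G_nrun (G_isN ht)
    have h2 : elt0 (lg j s) (node s) = y := by
      unfold elt0
      have h3 : nn (lg j s) σ = Nat.pair c (nn (lg j (s0 + s1)) σ) := hk
      rw [hnode, he s (by omega), h3, Nat.unpair_pair, hy]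
    rw [h2] at h1
    obtain ⟨hGy, h1⟩ := h1
    rcases h1 with ⟨h1, _⟩ | ⟨_, ⟨_, h1 | h1 | h1⟩ | ⟨⟨h1, _⟩ | ⟨h1, _⟩, _⟩⟩
    · omega
    · obtain ⟨u, _, hu⟩ := has_iff.1 h1
      exact Or.inl ⟨u, hu⟩
    · obtain ⟨u, _, hu⟩ := has_iff.1 h1
      exact Or.inr ⟨u, hu⟩
    · rw [halts_mono (by omega) hs1] at h1
      simp at h1
    · exact Or.inr ⟨s, h1, hGy⟩
    · exact Or.inl ⟨s, h1, hGy⟩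
  rcases hstep with ⟨u, hu, huy⟩ | h
  · left
    by_contra hB
    have hBs : ∀ s, inB y (lg j s) = false := by
      intro s
      by_contra hc
      rw [Bool.not_eq_false] at hc
      exact hB (mem_Bset_iff.2 ⟨s, hc⟩)
    have hru := (start_facts hu huy).2.2.2.1
    rw [hny, hry] at hru
    have hst : ∀ s, u < s → ¬ isN σ (G j s) = true := by
      intro s hs hc
      have h1 : epoch (lg j s) (nd y) = epoch (lg j u) (nd y) := by
        rw [hny, ← hru]
        have h2 := epoch_mono (j := j) σ hs.le
        have h3 := epoch_mono (j := j) σ (show s ≤ s + s0 by omega)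
        rw [he (s + s0) (by omega)] at h3
        omega
      have h2 := (run_facts hu huy hs h1 (hBs s)).2
      obtain ⟨ht, hnode⟩ := isN_iff.1 hc
      rw [G_node] at hnode
      have h3 := G_isN ht
      rw [hnode, ← hny, h2] at h3
      simp at h3
    obtain ⟨M, hM⟩ := cnt_bdd (j := j) (isN σ) ((Set.finite_le_nat u).subset fun s hs => by
      by_contra hc
      exact hst s (not_le.1 hc) hs)
    obtain ⟨s, hs⟩ := hn M
    have := hM s
    unfold nn at hs
    omega
  · exact Or.inr h

theorem node_pair (σ : Node) (m : ℕ) : node (Nat.pair (Encodable.encode σ) m) = σ := by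
  unfold node; simp

theorem col_infinite (σ : Node) (r d : ℕ) :
    (Set.range fun l => mk σ r (Nat.pair d l)).Infinite := by
  apply Set.infinite_range_of_injective
  intro l l' h
  simpa [mk] using h

/-- L7 -/
theorem path_total {j : ℕ} {σ : Node} (hp : OnPath j σ) (hf : (Acts j σ).Finite)
    (ht : ∀ z, ((Denumerable.ofNat Code σ.length).eval z).Dom) : False := by
  obtain ⟨s0, hs0⟩ := epoch_const hp.zero (hf.subset (Prog_sub j σ))
  generalize epoch (lg j s0) σ = r at hs0
  have hn : ∀ k, ∃ s, k < nn (lg j s) σ := by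
    by_contra hc
    have hfin : {s | isN σ (G j s) = true}.Finite := by
      by_contra hinf
      exact hc (cnt_unb _ hinf)
    obtain ⟨s1, hs1⟩ := cnt_const (isN σ) hfin
    obtain ⟨b, hb⟩ := hfin.bddAbove
    obtain ⟨b', hb'⟩ := hf.bddAbove
    -- permission is eventually granted
    have hperm : ∃ s2, ∀ s, s2 ≤ s → perm (lg j s) σ = true := by
      have hex : ∀ τ : Node, ∃ t, anc1 τ σ = true →
          Encodable.encode σ + nn (lg j s1) σ < PP (lg j t) τ := by
        intro τ
        by_cases ha : anc1 τ σ = true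
        · obtain ⟨t, ht⟩ := PP_unb (hp.one τ ha) (Encodable.encode σ + nn (lg j s1) σ)
          exact ⟨t, fun _ => ht⟩
        · exact ⟨0, fun h => (ha h).elim⟩
      choose T hT using hex
      obtain ⟨m, hm⟩ := ((finite_suffix σ).image T).bddAbove
      refine ⟨m + s1, fun s hs => perm_iff.2 fun τ ha => ?_⟩
      have h1 := hT τ ha
      have h2 : T τ ≤ m := hm ⟨τ, anc1_suffix ha, rfl⟩
      have h3 := cnt_mono (j := j) (isP τ) (show T τ ≤ s by omega)
      have h4 := hs1 s (by omega)
      unfold nn PP at *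
      omega
    obtain ⟨s2, hs2⟩ := hperm
    have hrun : ∀ s, b + b' + s2 < s → node s = σ → running (lg j s) σ = true ∧
        conv σ (elt1 (lg j s) σ) (lg j s) s = false := by
      intro s hs hnode
      have hnN : ¬ isN σ (G j s) = true := fun h => by
        have := hb h
        omega
      rw [isN_iff, G_node] at hnN
      have hnA : ¬ isAct (G j s) := fun h => by
        have := hb' (show s ∈ Acts j σ from ⟨h, hnode⟩)
        omega
      unfold isAct at hnA
      by_cases hr : running (lg j s) (node s) = true
      · have := (G_run hr).2
        rw [hnode] at this hr
        refine ⟨hr, ?_⟩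
        rcases this with ⟨h, _⟩ | ⟨h, _⟩ | ⟨h, _, h'⟩
        · omega
        · omega
        · exact h'
      · exfalso
        rw [Bool.not_eq_true] at hr
        have := (G_nrun hr).2
        rw [hnode, hs2 s (by omega)] at this
        rcases this with ⟨_, h⟩ | ⟨_, ⟨h, _⟩ | ⟨⟨h, _⟩ | ⟨h, _⟩, _⟩⟩
        · simp at h
        · exact hnN ⟨by omega, hnode⟩
        · exact hnN ⟨by omega, hnode⟩
        · exact hnN ⟨by omega, hnode⟩
    have hlarge : ∀ m, ∃ s, m ≤ s ∧ node s = σ := fun m =>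
      ⟨_, Nat.right_le_pair _ _, node_pair σ m⟩
    obtain ⟨s3, hs3, hn3⟩ := hlarge (b + b' + s2 + s0 + s1 + 1)
    obtain ⟨h3, _⟩ := hrun s3 (by omega) hn3
    unfold running at h3
    simp only [Bool.and_eq_true] at h3
    obtain ⟨u, hu, hu1, huy⟩ := has_iff.1 h3.1
    obtain ⟨t, hth⟩ := halts_of_eval (Part.get_mem (ht (Nat.pair (elt1 (lg j s3) σ) u)))
    obtain ⟨s4, hs4, hn4⟩ := hlarge (s3 + t)
    obtain ⟨_, h4⟩ := hrun s4 (by omega) hn4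
    have hel : elt1 (lg j s4) σ = elt1 (lg j s3) σ := by
      unfold elt1
      have e1 : nn (lg j s4) σ = nn (lg j s3) σ := by
        unfold nn; rw [hs1 s4 (by omega), hs1 s3 (by omega)]
      rw [e1, hs0 s4 (by omega), hs0 s3 (by omega)]
    rw [hel] at h4
    have h5 : conv σ (elt1 (lg j s3) σ) (lg j s4) s4 = true := by
      unfold conv
      simp only [List.any_eq_true, Bool.and_eq_true, beq_iff_eq]
      refine ⟨G j u, mem_lg.2 ⟨u, by omega, rfl⟩, ⟨hu1, huy⟩, ?_⟩
      rw [G_stage]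
      exact halts_mono (by omega) hth
    rw [h5] at h4
    simp at h4
  -- now an infinite column must be covered by finite sets
  have hcol := col_infinite σ r (Encodable.encode (Code.zero))
  apply hcol
  refine ((B_node_finite hf).union (canc_finite j σ r)).subset ?_
  rintro _ ⟨l, rfl⟩
  have hh : ∃ s, halts s (dd (mk σ r (Nat.pair (Encodable.encode (Code.zero)) l)))
      (mk σ r (Nat.pair (Encodable.encode (Code.zero)) l)) = true := by
    apply halts_of_eval (v := 0)
    unfold dd
    rw [cc_mk, Nat.unpair_pair, Denumerable.ofNat_encode]
    exact Part.mem_some 0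
  rcases sel hs0 hn _ hh with h | h
  · exact Or.inl ⟨h, nd_mk _ _ _⟩
  · exact Or.inr ⟨h, nd_mk _ _ _, rr_mk _ _ _⟩

end OS


namespace OS

def aB (j y t : ℕ) : Bool := ((G j t).1 == 2 || (G j t).1 == 3) && (G j t).2.1 == y

theorem aB_iff {j y t : ℕ} : aB j y t = true ↔ isAct (G j t) ∧ (G j t).2.1 = y := by
  unfold aB isAct
  simp

theorem mem_Bset_aB {j : ℕ} (y : ℕ) : y ∈ Bset j ↔ ∃ t, aB j y t = true := by
  simp only [aB_iff]
  rfl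

theorem pr_aB {α : Type*} [Primcodable α] {j y t : α → ℕ} (hj : Primrec j) (hy : Primrec y)
    (ht : Primrec t) : Primrec fun a => aB (j a) (y a) (t a) :=
  pr_and (pr_or (pr_beq (pr_evt (pr_G hj ht)) (Primrec.const 2))
    (pr_beq (pr_evt (pr_G hj ht)) (Primrec.const 3))) (pr_beq (pr_evy (pr_G hj ht)) hy)

theorem co_aB (j : ℕ) : Computable₂ (aB j) :=
  (pr_aB (α := ℕ × ℕ) (Primrec.const j) Primrec.fst Primrec.snd).to_comp

theorem code_of {g : ℕ → ℕ} (hg : Computable g) : ∃ c : Code, ∀ x, g x ∈ c.eval x := by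
  obtain ⟨c, hc⟩ := Nat.Partrec.Code.exists_code.1 (Partrec.nat_iff.1 hg.partrec)
  exact ⟨c, fun x => by rw [hc]; exact Part.mem_some _⟩

theorem caseF_n {j : ℕ} {σ : Node} (hA : ¬ (Acts j σ).Finite) :
    ∀ k, ∃ s, k < nn (lg j s) σ := by
  apply cnt_unb
  intro hf
  apply hA
  apply acts_finite_of_B
  refine (hf.image fun s => (G j s).2.1).subset ?_
  rintro y ⟨⟨s, hs, hy⟩, hn⟩
  obtain ⟨u, _, hu, huy⟩ := act_start hs hy
  exact ⟨u, isN_iff.2 ⟨by omega, by rw [huy, hn]⟩, huy⟩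

theorem caseF_speed {j : ℕ} {σ : Node} (hp : OnPath j σ) (hA : ¬ (Acts j σ).Finite)
    (hP : (Prog j σ).Finite) : ¬ Nonspeedable (Bset j) := by
  intro hN
  obtain ⟨s0, hs0⟩ := epoch_const hp.zero hP
  generalize epoch (lg j s0) σ = r at hs0
  have hn := caseF_n hA
  let v : ℕ → ℕ → ℕ → Bool := fun p x _ => p == Nat.pair x.unpair.1 (Nat.pair (rr x) (dd x))
  have hv : Computable fun q : ℕ × ℕ × ℕ => v q.1 q.2.1 q.2.2 := by
    have hx : Primrec fun q : ℕ × ℕ × ℕ => q.2.1 := Primrec.fst.comp Primrec.snd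
    exact (pr_beq Primrec.fst (pr_pair (pr_u1 hx) (pr_pair (pr_rr hx) (pr_dd hx)))).to_comp
  obtain ⟨h, hh, H⟩ := speed_lemma (Bset j) (aB j) (co_aB j) mem_Bset_aB hN v hv
  obtain ⟨c, hc⟩ := code_of (g := fun x => h (x, 0))
    (hh.comp (Computable.pair Computable.id (Computable.const 0)))
  have hsel : ∀ l, mk σ r (Nat.pair (Encodable.encode c) l) ∈ Bset j ∨
      mk σ r (Nat.pair (Encodable.encode c) l) ∈ Canc j := by
    intro l
    apply sel hs0 hn
    apply halts_of_eval (v := h (mk σ r (Nat.pair (Encodable.encode c) l), 0))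
    unfold dd
    rw [cc_mk, Nat.unpair_pair, Denumerable.ofNat_encode]
    exact hc _
  have hvp : ∀ x s, v (Nat.pair (Encodable.encode σ) (Nat.pair r (Encodable.encode c))) x s = true →
      nd x = σ ∧ rr x = r ∧ x = mk σ r (Nat.pair (Encodable.encode c) (cc x).unpair.2) := by
    intro x s hx
    simp only [v, beq_iff_eq, Nat.pair_eq_pair] at hx
    obtain ⟨h1, h2, h3⟩ := hx
    have h4 : nd x = σ := by
      unfold nd
      rw [← h1, Denumerable.ofNat_encode]
    refine ⟨h4, h2.symm, ?_⟩
    rw [h3]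
    unfold dd
    rw [Nat.pair_unpair]
    conv_lhs => rw [← mk_nd x]
    rw [h4, h2]
  have hfin := H (Nat.pair (Encodable.encode σ) (Nat.pair r (Encodable.encode c))) (by
    refine (canc_finite j σ r).subset ?_
    rintro x ⟨⟨s, hs⟩, hx⟩
    obtain ⟨h1, h2, h3⟩ := hvp x s hs
    refine ⟨?_, h1, h2⟩
    have := hsel (cc x).unpair.2
    rw [← h3] at this
    exact this.resolve_left hx)
  apply col_infinite σ r (Encodable.encode c)
  refine (hfin.union (canc_finite j σ r)).subset ?_
  rintro _ ⟨l, rfl⟩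
  have hl := hsel l
  have hdd : dd (mk σ r (Nat.pair (Encodable.encode c) l)) = Encodable.encode c := by
    unfold dd
    rw [cc_mk, Nat.unpair_pair]
  have hvv : v (Nat.pair (Encodable.encode σ) (Nat.pair r (Encodable.encode c)))
      (mk σ r (Nat.pair (Encodable.encode c) l)) 0 = true := by
    simp only [v, beq_iff_eq]
    rw [hdd, rr_mk, ← encode_nd, nd_mk]
  have hnd := nd_mk σ r (Nat.pair (Encodable.encode c) l)
  have hrr := rr_mk σ r (Nat.pair (Encodable.encode c) l)
  simp only at *
  generalize mk σ r (Nat.pair (Encodable.encode c) l) = y at *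
  rcases hl with hl | hl
  · left
    refine ⟨0, hvv, hl, fun t ht => ?_⟩
    by_contra hcon
    rw [Bool.not_eq_false, aB_iff] at hcon
    obtain ⟨u, hut, hu, huy⟩ := act_start hcon.1 hcon.2
    have h1 := (start_facts hu huy).2.2.2.2.2.1
    rw [hdd] at h1
    have := halts_lt (v := h (y, 0)) (by rw [Denumerable.ofNat_encode]; exact hc y) h1
    omega
  · exact Or.inr ⟨hl, hnd, hrr⟩

def zz (σ ρ : Node) : Bool :=
  (ρ == σ || anc0 ρ σ) || (anc1 σ ρ ||
    (List.range (σ.length + 1)).any fun k => anc0 (σ.drop k) σ && anc1 (σ.drop k) ρ)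

theorem pr_zz {α : Type*} [Primcodable α] (σ : Node) {ρ : α → Node} (hρ : Primrec ρ) :
    Primrec fun a => zz σ (ρ a) := by
  have hd : Primrec fun z : α × ℕ => σ.drop z.2 :=
    Primrec.list_drop.comp Primrec.snd (Primrec.const σ)
  exact pr_or (pr_or (pr_beq hρ (Primrec.const σ)) (pr_anc0 hρ (Primrec.const σ)))
    (pr_or (pr_anc1 (Primrec.const σ) hρ)
      (pr_any (Primrec.const _) (pr_and (pr_anc0 hd (Primrec.const σ))
        (pr_anc1 hd (hρ.comp Primrec.fst)))))

theorem zz_iff {σ ρ : Node} : zz σ ρ = true ↔ ρ = σ ∨ anc0 ρ σ = true ∨ anc1 σ ρ = true ∨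
    ∃ τ, anc0 τ σ = true ∧ anc1 τ ρ = true := by
  unfold zz
  simp only [Bool.or_eq_true, beq_iff_eq, List.any_eq_true, List.mem_range, Bool.and_eq_true,
    or_assoc]
  constructor
  · rintro (h | h | h | ⟨k, _, h⟩)
    · exact Or.inl h
    · exact Or.inr (Or.inl h)
    · exact Or.inr (Or.inr (Or.inl h))
    · exact Or.inr (Or.inr (Or.inr ⟨_, h⟩))
  · rintro (h | h | h | ⟨τ, h1, h2⟩)
    · exact Or.inl h
    · exact Or.inr (Or.inl h)
    · exact Or.inr (Or.inr (Or.inl h))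
    · refine Or.inr (Or.inr (Or.inr ?_))
      obtain ⟨l, hl⟩ := anc0_suffix h1
      refine ⟨l.length, by rw [← hl]; simp, ?_⟩
      have : σ.drop l.length = τ := by rw [← hl, List.drop_left]
      rw [this]
      exact ⟨h1, h2⟩

theorem zz_unb {j : ℕ} {σ ρ : Node} (hp : OnPath j σ) (hA : ¬ (Acts j σ).Finite)
    (hz : ¬ zz σ ρ = true) : Unb j ρ := by
  rw [zz_iff] at hz
  push Not at hz
  obtain ⟨z1, z2, z3, z4⟩ := hz
  rcases list_compare ρ σ with h | ⟨b, h⟩ | ⟨b, h⟩ | ⟨τ, b, b', hb, h1, h2⟩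
  · exact (z1 h).elim
  · by_cases hb : b = 1
    · exact unb_of_prog (hp.one ρ (anc1_iff.2 ⟨b, by omega, h⟩))
    · exact (z2 (anc0_iff.2 ⟨b, hb, h⟩)).elim
  · by_cases hb : b = 0
    · exact unb_of_anc0 (anc0_iff.2 ⟨b, by omega, h⟩) hA
    · exact (z3 (anc1_iff.2 ⟨b, hb, h⟩)).elim
  · by_cases hb' : b' = 0
    · exact unb_of_anc0 (anc0_iff.2 ⟨b', by omega, h2⟩)
        ((hp.one τ (anc1_iff.2 ⟨b, by omega, h1⟩)).mono (Prog_sub j τ))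
    · by_cases hb1 : b = 1
      · exact unb_of_anc0 (anc0_iff.2 ⟨b', by omega, h2⟩)
          ((hp.one τ (anc1_iff.2 ⟨b, by omega, h1⟩)).mono (Prog_sub j τ))
      · exact (z4 τ (anc0_iff.2 ⟨b, hb1, h1⟩) (anc1_iff.2 ⟨b', hb', h2⟩)).elim

theorem zz_fin {j : ℕ} {σ : Node} (hp : OnPath j σ) (hP : (Prog j σ).Finite) :
    {x | x ∈ Wset j ∧ x ∈ Bset j ∧ zz σ (nd x) = true}.Finite := by
  obtain ⟨s0, hs0⟩ := epoch_const hp.zero hP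
  have f1 : {x | x ∈ Wset j ∧ x ∈ Bset j ∧ nd x = σ}.Finite := by
    refine (((Set.finite_le_nat (epoch (lg j s0) σ)).biUnion fun r _ =>
      fast_finite j σ r).union (hP.image fun s => (G j s).2.1)).subset ?_
    rintro x ⟨hW, ⟨s, hs, hy⟩, hn⟩
    rcases hs with hs | hs
    · left
      have h1 := (act_facts (Or.inl hs) hy).2.2.2
      have h2 := epoch_mono (j := j) σ (show s ≤ s + s0 by omega)
      rw [hs0 (s + s0) (by omega)] at h2
      rw [hn] at h1
      simp only [Set.mem_iUnion]
      exact ⟨rr x, (by rw [h1]; exact h2), hW, ⟨s, hs, hy⟩, hn, rfl⟩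
    · right
      exact ⟨s, ⟨hs, by rw [node_nd hy, hn]⟩, hy⟩
  have f2 : (⋃ τ ∈ {τ : Node | τ <:+ σ}, {x | anc0 τ σ = true ∧ x ∈ Bset j ∧ nd x = τ}).Finite := by
    refine (finite_suffix σ).biUnion fun τ _ => ?_
    by_cases ha : anc0 τ σ = true
    · exact (B_node_finite (hp.zero τ ha)).subset fun x hx => hx.2
    · exact Set.finite_empty.subset fun x hx => (ha hx.1).elim
  have f3 := perm_finite hP
  have f4 : (⋃ τ ∈ {τ : Node | τ <:+ σ},
      {x | anc0 τ σ = true ∧ x ∈ Bset j ∧ anc1 τ (nd x) = true}).Finite := by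
    refine (finite_suffix σ).biUnion fun τ _ => ?_
    by_cases ha : anc0 τ σ = true
    · exact (perm_finite ((hp.zero τ ha).subset (Prog_sub j τ))).subset fun x hx => hx.2
    · exact Set.finite_empty.subset fun x hx => (ha hx.1).elim
  refine ((f1.union f2).union (f3.union f4)).subset ?_
  rintro x ⟨hW, hB, hz⟩
  rcases zz_iff.1 hz with h | h | h | ⟨τ, h1, h2⟩
  · exact Or.inl (Or.inl ⟨hW, hB, h⟩)
  · refine Or.inl (Or.inr ?_)
    simp only [Set.mem_iUnion]
    exact ⟨nd x, anc0_suffix h, h, hB, rfl⟩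
  · exact Or.inr (Or.inl ⟨hB, h⟩)
  · refine Or.inr (Or.inr ?_)
    simp only [Set.mem_iUnion]
    exact ⟨τ, anc0_suffix h1, h1, hB, h2⟩

theorem caseF_comp {i j : ℕ} {σ : Node} (hp : OnPath j σ) (hA : ¬ (Acts j σ).Finite)
    (hP : (Prog j σ).Finite) (hd : Disjoint (Wset i) (Wset j))
    (hu : Wset i ∪ Wset j = Bset j) : ComputablePred (· ∈ Wset j) := by
  have hX := zz_fin hp hP
  obtain ⟨X, hX'⟩ : ∃ X : List ℕ, ∀ x, x ∈ X ↔
      x ∈ {x | x ∈ Wset j ∧ x ∈ Bset j ∧ zz σ (nd x) = true} :=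
    ⟨hX.toFinset.toList, fun x => by rw [Finset.mem_toList, Set.Finite.mem_toFinset]⟩
  let R : ℕ → ℕ → Bool := fun x n => (zz σ (nd x) || stg i x n) || (stg j x n ||
    (decide (rr x < epoch (lg j n) (nd x)) && !(inB x (lg j n))))
  have hR : Computable₂ R := by
    have hx : Primrec fun z : ℕ × ℕ => z.1 := Primrec.fst
    have hn : Primrec fun z : ℕ × ℕ => z.2 := Primrec.snd
    have hl : Primrec fun z : ℕ × ℕ => lg j z.2 := pr_lg (Primrec.const j) hn
    exact (pr_or (pr_or (pr_zz σ (pr_nd hx)) (pr_stg (Primrec.const i) hx hn))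
      (pr_or (pr_stg (Primrec.const j) hx hn)
        (pr_and (pr_lt (pr_rr hx) (pr_epoch hl (pr_nd hx))) (pr_not (pr_inB hx hl))))).to_comp
  have hRi : ∀ x n, R x n = true ↔ zz σ (nd x) = true ∨ stg i x n = true ∨ stg j x n = true ∨
      (rr x < epoch (lg j n) (nd x) ∧ inB x (lg j n) = false) := by
    intro x n
    simp [R, or_assoc]
  obtain ⟨g, hg, hgR⟩ := find_computable R hR (by
    intro x
    by_cases hz : zz σ (nd x) = true
    · exact ⟨0, (hRi _ _).2 (Or.inl hz)⟩
    · obtain ⟨s, hs⟩ := zz_unb hp hA hz (rr x)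
      by_cases hB : x ∈ Bset j
      · rw [← hu] at hB
        rcases hB with hB | hB
        · obtain ⟨n, hn⟩ := mem_Wset_iff.1 hB
          exact ⟨n, (hRi _ _).2 (Or.inr (Or.inl hn))⟩
        · obtain ⟨n, hn⟩ := mem_Wset_iff.1 hB
          exact ⟨n, (hRi _ _).2 (Or.inr (Or.inr (Or.inl hn)))⟩
      · refine ⟨s, (hRi _ _).2 (Or.inr (Or.inr (Or.inr ⟨hs, ?_⟩)))⟩
        by_contra hc
        rw [Bool.not_eq_false] at hc
        exact hB (mem_Bset_iff.2 ⟨s, hc⟩))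
  rw [ComputablePred.computable_iff]
  refine ⟨fun x => X.any (fun z => x == z) || (!(zz σ (nd x)) && stg j x (g x)), ?_, ?_⟩
  · have h1 : Computable fun x : ℕ => X.any (fun z => x == z) :=
      (pr_any (Primrec.const X) (pr_beq Primrec.fst Primrec.snd)).to_comp
    have h2 : Computable fun x : ℕ => !(zz σ (nd x)) := (pr_not (pr_zz σ (pr_nd Primrec.id))).to_comp
    have h3 : Computable fun x : ℕ => stg j x (g x) :=
      comp3 (v := stg) (f := fun _ => j) (g := fun x => x) (h := g) primrec_stg.to_comp
        (Computable.const j) Computable.id hg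
    exact (Primrec.or.to_comp).comp h1 ((Primrec.and.to_comp).comp h2 h3)
  · funext x
    apply propext
    simp only [Bool.or_eq_true, List.any_eq_true, beq_iff_eq, exists_eq_right', Bool.and_eq_true,
      Bool.not_eq_true']
    rw [hX']
    constructor
    · intro hx
      have hB : x ∈ Bset j := by rw [← hu]; exact Or.inr hx
      by_cases hz : zz σ (nd x) = true
      · exact Or.inl ⟨hx, hB, hz⟩
      · refine Or.inr ⟨by simpa using hz, ?_⟩
        rcases (hRi _ _).1 (hgR x) with h | h | h | ⟨h, h'⟩
        · exact (hz h).elim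
        · exact (Set.disjoint_left.1 hd (mem_Wset_iff.2 ⟨_, h⟩) hx).elim
        · exact h
        · exfalso
          obtain ⟨t, ht, hty⟩ := hB
          have h1 := (act_facts ht hty).2.2.2
          by_cases hl : t < g x
          · rw [inB_iff.2 ⟨t, hl, ht, hty⟩] at h'
            simp at h'
          · have := epoch_mono (j := j) (nd x) (show g x ≤ t by omega)
            omega
    · rintro (h | h)
      · exact h.1
      · exact mem_Wset_iff.2 ⟨_, h.2⟩

/-! the other case -/

theorem path_exists {j : ℕ} (hN : ∀ σ, OnPath j σ → (Acts j σ).Finite ∨ (Prog j σ).Infinite)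
    (n : ℕ) : ∃ σ : Node, σ.length = n ∧ OnPath j σ := by
  induction n with
  | zero => exact ⟨[], rfl, ⟨fun τ h => by simp [anc1] at h, fun τ h => by simp [anc0] at h⟩⟩
  | succ n ih =>
    obtain ⟨σ, hl, hp⟩ := ih
    rcases hN σ hp with h | h
    · refine ⟨0 :: σ, by simp [hl], ⟨fun τ ht => ?_, fun τ ht => ?_⟩⟩
      · simp only [anc1, Bool.or_eq_true, Bool.and_eq_true, beq_iff_eq] at ht
        rcases ht with ⟨h1, _⟩ | h1
        · simp at h1
        · exact hp.one τ h1
      · simp only [anc0, Bool.or_eq_true, Bool.and_eq_true, beq_iff_eq] at ht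
        rcases ht with ⟨_, rfl⟩ | h1
        · exact h
        · exact hp.zero τ h1
    · refine ⟨1 :: σ, by simp [hl], ⟨fun τ ht => ?_, fun τ ht => ?_⟩⟩
      · simp only [anc1, Bool.or_eq_true, Bool.and_eq_true, beq_iff_eq] at ht
        rcases ht with ⟨_, rfl⟩ | h1
        · exact h
        · exact hp.one τ h1
      · simp only [anc0, Bool.or_eq_true, Bool.and_eq_true, beq_iff_eq] at ht
        rcases ht with ⟨h1, _⟩ | h1
        · simp at h1
        · exact hp.zero τ h1

theorem node_dich {j : ℕ} (hN : ∀ σ, OnPath j σ → (Acts j σ).Finite ∨ (Prog j σ).Infinite)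
    (ρ : Node) : (Acts j ρ).Finite ∨ Unb j ρ := by
  obtain ⟨σ, hl, hp⟩ := path_exists hN ρ.length
  have hperm : ∀ τ, anc0 τ σ = true → anc1 τ ρ = true → (Acts j ρ).Finite := by
    intro τ h0 h1
    apply acts_finite_of_B
    refine (perm_finite ((hp.zero τ h0).subset (Prog_sub j τ))).subset ?_
    rintro y ⟨hy, hn⟩
    exact ⟨hy, by rw [hn]; exact h1⟩
  rcases list_compare ρ σ with h | ⟨b, h⟩ | ⟨b, h⟩ | ⟨τ, b, b', hb, h1, h2⟩
  · subst h
    exact (hN ρ hp).imp id unb_of_prog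
  · have := h.length_le
    simp at this
    omega
  · have := h.length_le
    simp at this
    omega
  · by_cases hb0 : b = 0
    · exact Or.inl (hperm τ (anc0_iff.2 ⟨b, by omega, h1⟩) (anc1_iff.2 ⟨b', by omega, h2⟩))
    · by_cases hb1 : b' = 1
      · exact Or.inl (hperm τ (anc0_iff.2 ⟨b, by omega, h1⟩) (anc1_iff.2 ⟨b', by omega, h2⟩))
      · exact Or.inr (unb_of_anc0 (anc0_iff.2 ⟨b', hb1, h2⟩)
          ((hp.one τ (anc1_iff.2 ⟨b, hb0, h1⟩)).mono (Prog_sub j τ)))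

theorem caseN_speed {j : ℕ}
    (hN : ∀ σ, OnPath j σ → (Acts j σ).Finite ∨ (Prog j σ).Infinite) :
    ¬ Nonspeedable (Bset j) := by
  intro hNS
  let v : ℕ → ℕ → ℕ → Bool := fun p x s => ((G j s).1 == 1 && (G j s).2.1 == x) &&
    (x.unpair.1 == p.unpair.1 && decide (p.unpair.2 ≤ s))
  have hv : Computable fun q : ℕ × ℕ × ℕ => v q.1 q.2.1 q.2.2 := by
    have hp : Primrec fun q : ℕ × ℕ × ℕ => q.1 := Primrec.fst
    have hx : Primrec fun q : ℕ × ℕ × ℕ => q.2.1 := Primrec.fst.comp Primrec.snd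
    have hs : Primrec fun q : ℕ × ℕ × ℕ => q.2.2 := Primrec.snd.comp Primrec.snd
    have hG : Primrec fun q : ℕ × ℕ × ℕ => G j q.2.2 := pr_G (Primrec.const j) hs
    exact (pr_and (pr_and (pr_beq (pr_evt hG) (Primrec.const 1)) (pr_beq (pr_evy hG) hx))
      (pr_and (pr_beq (pr_u1 hx) (pr_u1 hp)) (pr_le (pr_u2 hp) hs))).to_comp
  have hvi : ∀ p x s, v p x s = true ↔ ((G j s).1 = 1 ∧ (G j s).2.1 = x) ∧
      x.unpair.1 = p.unpair.1 ∧ p.unpair.2 ≤ s := by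
    intro p x s
    simp [v]
  obtain ⟨h, hh, H⟩ := speed_lemma (Bset j) (aB j) (co_aB j) mem_Bset_aB hNS v hv
  obtain ⟨c, hc⟩ := code_of (g := fun n => h n.unpair) (hh.comp Primrec.unpair.to_comp)
  obtain ⟨σ, hl, hp⟩ := path_exists hN (Encodable.encode c)
  have hP : (Prog j σ).Infinite := by
    refine (hN σ hp).resolve_left fun hf => path_total hp hf fun z => ?_
    rw [hl, Denumerable.ofNat_encode]
    exact Part.dom_iff_mem.2 ⟨_, hc z⟩
  have hU : Unb j σ := unb_of_prog hP
  obtain ⟨t0, ht0⟩ : ∃ t0, ∀ τ t, anc0 τ σ = true → t ∈ Acts j τ → t < t0 := by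
    have f2 : (⋃ τ ∈ {τ : Node | τ <:+ σ}, {t | anc0 τ σ = true ∧ t ∈ Acts j τ}).Finite := by
      refine (finite_suffix σ).biUnion fun τ _ => ?_
      by_cases ha : anc0 τ σ = true
      · exact (hp.zero τ ha).subset fun x hx => hx.2
      · exact Set.finite_empty.subset fun x hx => (ha hx.1).elim
    obtain ⟨b, hb⟩ := f2.bddAbove
    refine ⟨b + 1, fun τ t h1 h2 => ?_⟩
    have : t ≤ b := hb (by
      simp only [Set.mem_iUnion]
      exact ⟨τ, anc0_suffix h1, h1, h2⟩)
    omega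
  have hp1 : (Nat.pair (Encodable.encode σ) t0).unpair.1 = Encodable.encode σ := by simp
  have hp2 : (Nat.pair (Encodable.encode σ) t0).unpair.2 = t0 := by simp
  have hfin := H (Nat.pair (Encodable.encode σ) t0) (by
    convert Set.finite_empty
    rw [Set.sdiff_eq_empty]
    rintro x ⟨s, hs⟩
    rw [hvi, hp1, hp2, ← encode_nd] at hs
    obtain ⟨⟨hs1, hsx⟩, hnx, hts⟩ := hs
    have hnd : nd x = σ := Encodable.encode_injective hnx
    by_contra hB
    have hBs : ∀ t, inB x (lg j t) = false := by
      intro t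
      by_contra hcon
      rw [Bool.not_eq_false] at hcon
      exact hB (mem_Bset_iff.2 ⟨t, hcon⟩)
    have key : ∀ t, s ≤ t → epoch (lg j t) σ = epoch (lg j s) σ := by
      intro t ht
      induction t, ht using Nat.le_induction with
      | base => rfl
      | succ t ht ih =>
        have h1 : epoch (lg j (t + 1)) σ = _ := cnt_succ j t (isE σ)
        rw [h1, if_neg]
        · exact ih
        · intro hE
          rcases isE_iff.1 hE with ⟨h3, hn⟩ | ⟨τ, ha, hact⟩
          · have hlt : s < t := by
              rcases Nat.eq_or_lt_of_le ht with he | he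
              · subst he
                omega
              · exact he
            have h4 := (run_facts hs1 hsx hlt (by rw [hnd]; exact ih) (hBs t)).1
            have h5 := (G_run (G_act (Or.inr h3))).1
            rw [hn, ← hnd, h4] at h5
            exact hB ⟨t, Or.inr h3, h5⟩
          · have := ht0 τ t ha hact
            omega
    obtain ⟨t, ht⟩ := hU (epoch (lg j s) σ)
    have h1 := key (t + s) (by omega)
    have h2 := epoch_mono (j := j) σ (show t ≤ t + s by omega)
    omega)
  have hinf : ((fun s => (G j s).2.1) '' Prog j σ).Infinite := by
    refine hP.image ?_
    rintro s hs s' hs' he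
    exact act_unique (Or.inr hs.1) rfl (Or.inr hs'.1) he.symm
  apply hinf
  refine (hfin.union ((Set.finite_lt_nat t0).image fun u => (G j u).2.1)).subset ?_
  rintro _ ⟨s, ⟨hs, hn⟩, rfl⟩
  have hact : isAct (G j s) := Or.inr hs
  have hrun := (G_run (G_act hact))
  have hcv : conv σ (G j s).2.1 (lg j s) s = true := by
    rcases hrun.2 with ⟨h1, _⟩ | ⟨_, _, h1⟩ | ⟨h1, _⟩
    · omega
    · rw [← hrun.1, hn] at h1
      exact h1
    · omega
  have hndy : nd (G j s).2.1 = σ := by rw [G_node, hn]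
  simp only
  generalize hy : (G j s).2.1 = y at *
  unfold conv at hcv
  simp only [List.any_eq_true, Bool.and_eq_true, beq_iff_eq] at hcv
  obtain ⟨ev, hev, ⟨hu1, huy⟩, hha⟩ := hcv
  obtain ⟨u, hus, rfl⟩ := mem_lg.1 hev
  rw [G_stage, hl] at hha
  have hlt := halts_lt (v := h (y, u)) (by
    rw [Denumerable.ofNat_encode]
    have := hc (Nat.pair y u)
    simpa using this) hha
  by_cases hut : u < t0
  · exact Or.inr ⟨u, hut, huy⟩
  · left
    refine ⟨u, ?_, ⟨s, hact, hy⟩, fun t ht => ?_⟩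
    · rw [hvi, hp1, hp2, ← encode_nd, hndy]
      exact ⟨⟨hu1, huy⟩, rfl, by omega⟩
    · by_contra hcon
      rw [Bool.not_eq_false, aB_iff] at hcon
      have := act_unique hcon.1 hcon.2 hact hy
      omega

theorem caseN_non {i j : ℕ}
    (hN : ∀ σ, OnPath j σ → (Acts j σ).Finite ∨ (Prog j σ).Infinite)
    (hd : Disjoint (Wset i) (Wset j)) (hu : Wset i ∪ Wset j = Bset j) :
    Nonspeedable (Wset i) := by
  let R : ℕ × ℕ → ℕ → Bool := fun q n =>
    !(inB q.1 (lg j (Nat.pair q.1.unpair.1 q.2 + 1))) || (stg i q.1 n || stg j q.1 n)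
  have hR : Computable₂ R := by
    have hx : Primrec fun z : (ℕ × ℕ) × ℕ => z.1.1 := Primrec.fst.comp Primrec.fst
    have hs : Primrec fun z : (ℕ × ℕ) × ℕ => z.1.2 := Primrec.snd.comp Primrec.fst
    have hn : Primrec fun z : (ℕ × ℕ) × ℕ => z.2 := Primrec.snd
    have hl : Primrec fun z : (ℕ × ℕ) × ℕ => lg j (Nat.pair z.1.1.unpair.1 z.1.2 + 1) :=
      pr_lg (Primrec.const j) (Primrec.succ.comp (pr_pair (pr_u1 hx) hs))
    exact (pr_or (pr_not (pr_inB hx hl)) (pr_or (pr_stg (Primrec.const i) hx hn)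
      (pr_stg (Primrec.const j) hx hn))).to_comp
  have hRi : ∀ x s n, R (x, s) n = true ↔ inB x (lg j (Nat.pair x.unpair.1 s + 1)) = false ∨
      stg i x n = true ∨ stg j x n = true := by
    intro x s n
    simp [R]
  obtain ⟨h, hh, hhR⟩ := find_computable R hR (by
    rintro ⟨x, s⟩
    by_cases hB : inB x (lg j (Nat.pair x.unpair.1 s + 1)) = true
    · have hB' : x ∈ Bset j := mem_Bset_iff.2 ⟨_, hB⟩
      rw [← hu] at hB'
      rcases hB' with hB' | hB'
      · obtain ⟨n, hn⟩ := mem_Wset_iff.1 hB'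
        exact ⟨n, (hRi _ _ _).2 (Or.inr (Or.inl hn))⟩
      · obtain ⟨n, hn⟩ := mem_Wset_iff.1 hB'
        exact ⟨n, (hRi _ _ _).2 (Or.inr (Or.inr hn))⟩
    · exact ⟨0, (hRi _ _ _).2 (Or.inl (by simpa using hB))⟩)
  refine ⟨i, rfl, h, hh, fun k hk => ?_⟩
  obtain ⟨N, hNb⟩ := hk.bddAbove
  have hNb' : ∀ x, N + 1 ≤ x → x ∈ Wset k → x ∈ Wset i := by
    intro x hx hxk
    by_contra hc
    have : x ≤ N := hNb ⟨hxk, hc⟩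
    omega
  obtain ⟨q, hq⟩ : ∃ q, q = Nat.pair k (N + 1) := ⟨_, rfl⟩
  have hinW : ∀ x s, inW q x s = true ↔ N + 1 ≤ x ∧ stg k x s = true := by
    intro x s
    unfold inW
    rw [hq, Nat.unpair_pair]
    simp
  have hact : ∀ s, active j q s (lg j s) = true := by
    intro s
    rw [active_iff]
    intro x hx
    rw [hinW] at hx
    have hxi := hNb' x hx.1 (mem_Wset_iff.2 ⟨s, hx.2⟩)
    constructor
    · by_contra hc
      rw [Bool.not_eq_false] at hc
      exact Set.disjoint_left.1 hd hxi (mem_Wset_iff.2 ⟨s, hc⟩)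
    · by_contra hc
      rw [Bool.not_eq_false] at hc
      obtain ⟨u, _, hu4⟩ := has_iff.1 hc
      exact canc_not_mem (show x ∈ Canc j from ⟨u, hu4⟩) (by rw [← hu]; exact Or.inl hxi)
  have hfin : {x | x ∈ Bset j ∧ rr x + x.unpair.1 < q}.Finite := by
    have h1 : ∀ r m, {x | x ∈ Bset j ∧ nd x = Denumerable.ofNat (List ℕ) m ∧ rr x = r}.Finite := by
      intro r m
      rcases node_dich hN (Denumerable.ofNat (List ℕ) m) with h | h
      · exact (B_node_finite h).subset fun x hx => ⟨hx.1, hx.2.1⟩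
      · exact B_unb_finite h r
    refine ((Set.finite_lt_nat q).biUnion fun r _ => (Set.finite_lt_nat q).biUnion fun m _ =>
      h1 r m).subset ?_
    rintro x ⟨hx, hlt⟩
    simp only [Set.mem_iUnion]
    exact ⟨rr x, (show rr x < q by omega), x.unpair.1, (show x.unpair.1 < q by omega), hx, rfl, rfl⟩
  refine ((Set.finite_lt_nat (N + 1)).union hfin).subset ?_
  rintro x ⟨⟨hxk, hxi⟩, hbad⟩
  by_contra hcon
  have hxB : x ∈ Bset j := by rw [← hu]; exact Or.inl hxi
  have hxN : N + 1 ≤ x := by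
    by_contra hc
    exact hcon (Or.inl (not_le.1 hc))
  have hxq : q ≤ rr x + x.unpair.1 := by
    by_contra hc
    exact hcon (Or.inr ⟨hxB, not_le.1 hc⟩)
  apply hbad
  have hsk := stg_Phi hxk
  generalize Phi k x = s at *
  have hB1 : inB x (lg j (Nat.pair x.unpair.1 s + 1)) = true := by
    obtain ⟨t, ht, hty⟩ := hxB
    obtain ⟨u, hut, hu1, huy⟩ := act_start ht hty
    have hsf := start_facts hu1 huy
    have hus : u < s := by
      by_contra hc
      have : declared j (bnd (lg j u) (nd x)) x (lg j u) u = true := by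
        rw [declared_iff]
        refine ⟨q, ?_, (hinW _ _).2 ⟨hxN, stg_mono (not_lt.1 hc) hsk⟩, hact u⟩
        unfold bnd
        rw [← hsf.2.2.2.1, encode_nd]
        exact hxq
      rw [hsf.2.2.2.2.2.2] at this
      simp at this
    have hnode : node (Nat.pair x.unpair.1 s) = nd x := by
      unfold node nd
      rw [Nat.unpair_pair]
    have hss := Nat.right_le_pair x.unpair.1 s
    generalize Nat.pair x.unpair.1 s = s' at *
    by_contra hc
    rw [Bool.not_eq_true] at hc
    have hc' : inB x (lg j s') = false := by
      by_contra hc2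
      rw [Bool.not_eq_false] at hc2
      rw [inB_mono (Nat.le_succ s') hc2] at hc
      simp at hc
    have hts : s' ≤ t := by
      by_contra hc2
      rw [inB_iff.2 ⟨t, not_le.1 hc2, ht, hty⟩] at hc'
      simp at hc'
    have he1 := epoch_mono (j := j) (nd x) (show u ≤ s' by omega)
    have he2 := epoch_mono (j := j) (nd x) hts
    have he3 := (act_facts ht hty).2.2.2
    have he4 := hsf.2.2.2.1
    have hrf := run_facts hu1 huy (show u < s' by omega) (by omega) hc'
    have hGr := G_run (j := j) (s := s') (by rw [hnode]; exact hrf.2)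
    rw [hnode, hrf.1] at hGr
    have hdec : declared j (bnd (lg j s') (nd x)) x (lg j s') s' = true := by
      rw [declared_iff]
      refine ⟨q, ?_, (hinW _ _).2 ⟨hxN, stg_mono hss hsk⟩, hact s'⟩
      unfold bnd
      rw [encode_nd]
      omega
    rw [hdec] at hGr
    rcases hGr.2 with ⟨h2, _⟩ | ⟨_, h2, _⟩ | ⟨_, h2, _⟩
    · rw [inB_iff.2 ⟨s', Nat.lt_succ_self s', Or.inl h2, hGr.1⟩] at hc
      simp at hc
    · simp at h2
    · simp at h2
  rcases (hRi _ _ _).1 (hhR (x, s)) with h1 | h1 | h1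
  · rw [hB1] at h1
    simp at h1
  · exact Phi_le h1
  · exact (Set.disjoint_left.1 hd hxi (mem_Wset_iff.2 ⟨_, h1⟩)).elim

end OS

/-- For every total computable `f : ℕ → ℕ × ℕ` there are an index `e` and a speedable c.e.
set `B = W e` such that, with `(i, j) = f e`, if `W i` and `W j` are disjoint and
`W i ∪ W j = B`, then `W i` is nonspeedable or `W j` is computable. -/
theorem one_split_nonspeedable_or_computable (f : ℕ → ℕ × ℕ) (hf : Computable f) :
    ∃ (e : ℕ) (B : Set ℕ), Wset e = B ∧ Speedable B ∧
      (Disjoint (Wset (f e).1) (Wset (f e).2) → Wset (f e).1 ∪ Wset (f e).2 = B →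
        Nonspeedable (Wset (f e).1) ∨ ComputablePred (· ∈ Wset (f e).2)) := by
  obtain ⟨e, he⟩ := OS.fixed_index f hf OS.aB
    (OS.pr_aB Primrec.fst (Primrec.fst.comp Primrec.snd) (Primrec.snd.comp Primrec.snd)).to_comp
  have heB : Wset e = OS.Bset (f e).2 := by
    ext x
    rw [he, OS.mem_Bset_aB]
  refine ⟨e, OS.Bset (f e).2, heB, ?_⟩
  by_cases hF : ∃ σ, OS.OnPath (f e).2 σ ∧ ¬ (OS.Acts (f e).2 σ).Finite ∧
      (OS.Prog (f e).2 σ).Finite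
  · obtain ⟨σ, hp, hA, hP⟩ := hF
    exact ⟨⟨⟨e, heB⟩, OS.caseF_speed hp hA hP⟩, fun hd hu => Or.inr (OS.caseF_comp hp hA hP hd hu)⟩
  · have hN : ∀ σ, OS.OnPath (f e).2 σ →
        (OS.Acts (f e).2 σ).Finite ∨ (OS.Prog (f e).2 σ).Infinite := by
      intro σ hp
      by_contra hc
      push Not at hc
      exact hF ⟨σ, hp, hc.1, by simpa using hc.2⟩
    exact ⟨⟨⟨e, heB⟩, OS.caseN_speed hN⟩, fun hd hu => Or.inl (OS.caseN_non hN hd hu)⟩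
end
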